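/- (Moore's theorem for the sphere.) Let r be an equivalence relation on S² such that: (i) each equivalence class of r is compact and connected; (ii) each equivalence class has nonempty connected complement in S² (no class separates S² and no class is all of S²); (iii) the relation r is closed, i.e., {(x,y) ∈ S² × S² | x r y} is a closed subset of S² × S² (equivalently, the decomposition into classes is upper semi-continuous). Then there exists a continuous map φ : S² → S², homotopic to the identity map of S², such that for every p ∈ S² the fiber φ⁻¹({p}) is exactly one equivalence class of r, and every equivalence class of r arises as such a fiber. In particular the quotient space S²/r is homeomorphic to S². -/

import Mathlib

/-- The unit sphere `S²` in `ℝ³`. -/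
abbrev S2 : Set (EuclideanSpace ℝ (Fin 3)) := Metric.sphere (0 : EuclideanSpace ℝ (Fin 3)) 1

namespace MooreSphere
open Set Filter Topology

/-- `x` and `y` lie in a common preconnected subset of `U`. -/
def Conn {X : Type*} [TopologicalSpace X] (U : Set X) (x y : X) : Prop :=
  ∃ S ⊆ U, IsPreconnected S ∧ x ∈ S ∧ y ∈ S

section conn
variable {X Y : Type*} [TopologicalSpace X] [TopologicalSpace Y] {U V : Set X} {x y z : X}

theorem Conn.refl (h : x ∈ U) : Conn U x x :=
  ⟨{x}, by simpa using h, isPreconnected_singleton, rfl, rfl⟩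

theorem Conn.symm (h : Conn U x y) : Conn U y x := by
  obtain ⟨S, h1, h2, h3, h4⟩ := h
  exact ⟨S, h1, h2, h4, h3⟩

theorem Conn.trans (h : Conn U x y) (h' : Conn U y z) : Conn U x z := by
  obtain ⟨S, h1, h2, h3, h4⟩ := h
  obtain ⟨T, g1, g2, g3, g4⟩ := h'
  exact ⟨S ∪ T, union_subset h1 g1, h2.union y h4 g3 g2, Or.inl h3, Or.inr g4⟩

theorem Conn.mono (h : Conn U x y) (hUV : U ⊆ V) : Conn V x y := by
  obtain ⟨S, h1, h2⟩ := h
  exact ⟨S, h1.trans hUV, h2⟩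

theorem Conn.mem_left (h : Conn U x y) : x ∈ U := by
  obtain ⟨S, h1, h2, h3, h4⟩ := h
  exact h1 h3

theorem Conn.mem_right (h : Conn U x y) : y ∈ U := h.symm.mem_left

theorem _root_.IsPreconnected.conn (h : IsPreconnected U) (hx : x ∈ U) (hy : y ∈ U) : Conn U x y :=
  ⟨U, Subset.rfl, h, hx, hy⟩

theorem isPreconnected_of_conn (h : ∀ x ∈ U, ∀ y ∈ U, Conn U x y) : IsPreconnected U := by
  apply isPreconnected_of_forall_pair
  intro x hx y hy
  obtain ⟨S, h1, h2, h3, h4⟩ := h x hx y hy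
  exact ⟨S, h1, h3, h4, h2⟩

theorem conn_iff_mem_connectedComponentIn : Conn U x y ↔ x ∈ U ∧ y ∈ connectedComponentIn U x := by
  constructor
  · rintro h
    refine ⟨h.mem_left, ?_⟩
    obtain ⟨S, h1, h2, h3, h4⟩ := h
    exact h2.subset_connectedComponentIn h3 h1 h4
  · rintro ⟨hx, hy⟩
    exact ⟨_, connectedComponentIn_subset U x, isPreconnected_connectedComponentIn,
      mem_connectedComponentIn hx, hy⟩

theorem Conn.image {f : X → Y} (hf : ContinuousOn f U) (h : Conn U x y) :
    Conn (f '' U) (f x) (f y) := by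
  obtain ⟨S, h1, h2, h3, h4⟩ := h
  exact ⟨f '' S, image_mono h1, h2.image f (hf.mono h1), mem_image_of_mem f h3, mem_image_of_mem f h4⟩

end conn

/-- `f` has a continuous logarithm on `K`. -/
def HasLog (K : Set ℂ) (f : ℂ → ℂ) : Prop :=
  ∃ l : ℂ → ℂ, ContinuousOn l K ∧ ∀ z ∈ K, Complex.exp (l z) = f z

theorem HasLog.one (K : Set ℂ) : HasLog K (fun _ => 1) :=
  ⟨fun _ => 0, continuousOn_const, by simp⟩

theorem HasLog.const (K : Set ℂ) {c : ℂ} (hc : c ≠ 0) : HasLog K (fun _ => c) :=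
  ⟨fun _ => Complex.log c, continuousOn_const, by simp [Complex.exp_log hc]⟩

theorem HasLog.mul {K : Set ℂ} {f g : ℂ → ℂ} (hf : HasLog K f) (hg : HasLog K g) :
    HasLog K (fun z => f z * g z) := by
  obtain ⟨l, hl, h⟩ := hf
  obtain ⟨m, hm, h'⟩ := hg
  exact ⟨fun z => l z + m z, hl.add hm, fun z hz => by rw [Complex.exp_add, h z hz, h' z hz]⟩

theorem HasLog.inv {K : Set ℂ} {f : ℂ → ℂ} (hf : HasLog K f) : HasLog K (fun z => (f z)⁻¹) := by
  obtain ⟨l, hl, h⟩ := hf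
  exact ⟨fun z => - l z, hl.neg, fun z hz => by rw [Complex.exp_neg, h z hz]⟩

theorem HasLog.congr {K : Set ℂ} {f g : ℂ → ℂ} (hf : HasLog K f) (h : ∀ z ∈ K, f z = g z) :
    HasLog K g := by
  obtain ⟨l, hl, h1⟩ := hf
  exact ⟨l, hl, fun z hz => by rw [h1 z hz, h z hz]⟩

theorem HasLog.mono {K L : Set ℂ} {f : ℂ → ℂ} (hf : HasLog K f) (h : L ⊆ K) :
    HasLog L f := by
  obtain ⟨l, hl, h1⟩ := hf
  exact ⟨l, hl.mono h, fun z hz => h1 z (h hz)⟩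

theorem HasLog.ne_zero {K : Set ℂ} {f : ℂ → ℂ} (hf : HasLog K f) {z : ℂ} (hz : z ∈ K) : f z ≠ 0 := by
  obtain ⟨l, hl, h1⟩ := hf
  rw [← h1 z hz]
  exact Complex.exp_ne_zero _

theorem hasLog_of_slitPlane {K : Set ℂ} {f : ℂ → ℂ} (hf : ContinuousOn f K)
    (h : ∀ z ∈ K, f z ∈ Complex.slitPlane) : HasLog K f :=
  ⟨fun z => Complex.log (f z), hf.clog h, fun z hz => Complex.exp_log (Complex.slitPlane_ne_zero (h z hz))⟩

/-- two continuous logarithms of the same function on a preconnected set differ by a constant -/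
theorem log_diff_const {K : Set ℂ} (hK : IsPreconnected K) {l m : ℂ → ℂ} (hl : ContinuousOn l K)
    (hm : ContinuousOn m K) (h : ∀ z ∈ K, Complex.exp (l z) = Complex.exp (m z)) :
    ∃ c : ℂ, Complex.exp c = 1 ∧ ∀ z ∈ K, l z = m z + c := by
  rcases K.eq_empty_or_nonempty with rfl | ⟨z₀, hz₀⟩
  · exact ⟨0, by simp, by simp⟩
  have key : ∀ z ∈ K, ∃ n : ℤ, l z - m z = n * (2 * Real.pi * Complex.I) := by
    intro z hz
    obtain ⟨n, hn⟩ := Complex.exp_eq_exp_iff_exists_int.1 (h z hz)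
    exact ⟨n, by rw [hn]; ring⟩
  choose! n hn using key
  have hpi : (2 * Real.pi * Complex.I) ≠ 0 := Complex.two_pi_I_ne_zero
  have hcont : ContinuousOn n K := by
    have h1 : ContinuousOn (fun z => ((l z - m z) / (2 * Real.pi * Complex.I)).re) K :=
      Complex.continuous_re.comp_continuousOn ((hl.sub hm).div_const _)
    have h2 : ContinuousOn (fun z => ((n z : ℤ) : ℝ)) K := by
      refine h1.congr fun z hz => ?_
      simp only
      rw [hn z hz, mul_div_cancel_right₀ _ hpi]
      simp
    exact Int.isClosedEmbedding_coe_real.isInducing.continuousOn_iff.2 h2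
  refine ⟨n z₀ * (2 * Real.pi * Complex.I), Complex.exp_int_mul_two_pi_mul_I _, fun z hz => ?_⟩
  rw [← hK.constant hcont hz hz₀, ← hn z hz]; ring

theorem HasLog.union {A B : Set ℂ} (hA : IsClosed A) (hB : IsClosed B) (hAB : IsPreconnected (A ∩ B))
    {f : ℂ → ℂ} (h1 : HasLog A f) (h2 : HasLog B f) : HasLog (A ∪ B) f := by
  classical
  obtain ⟨l, hl, hl'⟩ := h1
  obtain ⟨m, hm, hm'⟩ := h2
  obtain ⟨c, hc, hcl⟩ := log_diff_const hAB (hl.mono inter_subset_left) (hm.mono inter_subset_right)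
    (fun z hz => by rw [hl' z hz.1, hm' z hz.2])
  refine ⟨fun z => if z ∈ A then l z else m z + c, ?_, ?_⟩
  · refine ContinuousOn.union_of_isClosed ?_ ?_ hA hB
    · exact hl.congr fun z hz => by simp [hz]
    · refine (hm.add_const c).congr fun z hz => ?_
      by_cases hzA : z ∈ A
      · simp [hzA, hcl z ⟨hzA, hz⟩]
      · simp [hzA]
  · intro z hz
    by_cases hzA : z ∈ A
    · simp [hzA, hl' z hzA]
    · have := hm' z (hz.resolve_left hzA)
      simp [hzA, Complex.exp_add, hc, this]

theorem hasLog_glue {A B : Set ℂ} (hA : IsClosed A) (hB : IsClosed B) {f l m : ℂ → ℂ}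
    (hl : ContinuousOn l A) (hl' : ∀ z ∈ A, Complex.exp (l z) = f z)
    (hm : ContinuousOn m B) (hm' : ∀ z ∈ B, Complex.exp (m z) = f z)
    (h : ∀ z ∈ A ∩ B, l z = m z) : HasLog (A ∪ B) f := by
  classical
  refine ⟨fun z => if z ∈ A then l z else m z, ?_, ?_⟩
  · refine ContinuousOn.union_of_isClosed ?_ ?_ hA hB
    · exact hl.congr fun z hz => by simp [hz]
    · refine hm.congr fun z hz => ?_
      by_cases hzA : z ∈ A
      · simp [hzA, h z ⟨hzA, hz⟩]
      · simp [hzA]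
  · intro z hz
    by_cases hzA : z ∈ A
    · simp [hzA, hl' z hzA]
    · have := hm' z (hz.resolve_left hzA)
      simp [hzA, this]

theorem hasLog_univ {f : ℂ → ℂ} (hf : Continuous f) (h0 : ∀ z, f z ≠ 0) : HasLog univ f := by
  have hs : IsSimplyConnected (univ : Set ℂ) := by
    have : ContractibleSpace (univ : Set ℂ) := convex_univ.contractibleSpace univ_nonempty
    exact (inferInstance : SimplyConnectedSpace (univ : Set ℂ))
  obtain ⟨l, hl, h⟩ := Complex.exists_continuousOn_eqOn_exp_comp hs isOpen_univ hf.continuousOn (by simpa using h0)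
  exact ⟨l, hl, fun z hz => h hz⟩

theorem not_hasLog_circle (x : ℂ) {R : ℝ} (hR : 0 < R) : ¬ HasLog (Metric.sphere x R) (fun z => z - x) := by
  rintro ⟨l, hl, h⟩
  have hmem : ∀ θ : ℝ, x + R * Complex.exp (θ * Complex.I) ∈ Metric.sphere x R := by
    intro θ
    simp [Complex.norm_exp_ofReal_mul_I, abs_of_pos hR]
  have hc : Continuous (fun θ : ℝ => l (x + R * Complex.exp (θ * Complex.I))) :=
    hl.comp_continuous (by fun_prop) hmem
  -- turn it into functions on ℂ via real part
  have := log_diff_const (K := univ) isPreconnected_univ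
    (l := fun z => l (x + R * Complex.exp (((z.re : ℝ) : ℂ) * Complex.I)))
    (m := fun z => Complex.log R + ((z.re : ℝ) : ℂ) * Complex.I)
    (hc.comp Complex.continuous_re).continuousOn (by fun_prop) (fun z _ => by
      rw [h _ (hmem z.re), Complex.exp_add, Complex.exp_log (by exact_mod_cast hR.ne')]; ring)
  obtain ⟨c, hc, h⟩ := this
  have h0 := h 0 trivial
  have h1 := h ((2 * Real.pi : ℝ) : ℂ) trivial
  have e1 : Complex.exp (2 * Real.pi * Complex.I) = 1 := Complex.exp_two_pi_mul_I
  simp only [Complex.zero_re, Complex.ofReal_zero, zero_mul, Complex.exp_zero, Complex.ofReal_re, add_zero] at h0 h1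
  push_cast at h1
  rw [e1, h0] at h1
  have : (2 * Real.pi * Complex.I) = 0 := by linear_combination -h1
  exact Complex.two_pi_I_ne_zero this

end MooreSphere

namespace MooreSphere
open Set Filter Topology

/-- functions on `K` generated by exponentials and linear factors with zeros outside `K` -/
inductive Good (K : Set ℂ) : (ℂ → ℂ) → Prop
  | log (f : ℂ → ℂ) (h : HasLog K f) : Good K f
  | lin (x : ℂ) (hx : x ∉ K) : Good K (fun z => z - x)
  | mul (f g : ℂ → ℂ) (hf : Good K f) (hg : Good K g) : Good K (fun z => f z * g z)
  | inv (f : ℂ → ℂ) (hf : Good K f) : Good K (fun z => (f z)⁻¹)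
  | congr (f g : ℂ → ℂ) (hf : Good K f) (h : ∀ z ∈ K, f z = g z) : Good K g

theorem Good.ne_zero {K : Set ℂ} {f : ℂ → ℂ} (h : Good K f) : ∀ z ∈ K, f z ≠ 0 := by
  induction h with
  | log f h => exact fun z hz => h.ne_zero hz
  | lin x hx => exact fun z hz h0 => hx (by rwa [← sub_eq_zero.1 h0])
  | mul f g hf hg h1 h2 => exact fun z hz => mul_ne_zero (h1 z hz) (h2 z hz)
  | inv f hf h1 => exact fun z hz => inv_ne_zero (h1 z hz)
  | congr f g hf h h1 => exact fun z hz => by rw [← h z hz]; exact h1 z hz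

theorem Good.of_quot {K : Set ℂ} {f g : ℂ → ℂ} (hg : Good K g) (h : Good K (fun z => f z * (g z)⁻¹)) :
    Good K f := by
  refine Good.congr _ _ (Good.mul _ _ h hg) fun z hz => ?_
  have := hg.ne_zero z hz
  field_simp

/-- the logarithm on the closed upper half plane -/
theorem upper_log {w : ℂ} (h : 0 ≤ w.im) (h0 : w ≠ 0) : -Complex.I * w ∈ Complex.slitPlane := by
  rw [Complex.mem_slitPlane_iff]
  simp
  rcases h.lt_or_eq with h1 | h1
  · exact Or.inl h1
  · right; intro h2; apply h0; apply Complex.ext <;> simp [h2, h1.symm]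

theorem lower_log {w : ℂ} (h : w.im ≤ 0) (h0 : w ≠ 0) : Complex.I * w ∈ Complex.slitPlane := by
  rw [Complex.mem_slitPlane_iff]
  simp
  rcases h.lt_or_eq with h1 | h1
  · exact Or.inl h1
  · right; intro h2; apply h0; apply Complex.ext <;> simp [h2, h1]

theorem hasLog_upper {K : Set ℂ} {c x : ℂ} (hc : c ≠ 0) (h : ∀ z ∈ K, (c * x).im ≤ (c * z).im) (hx : x ∉ K) :
    HasLog K (fun z => z - x) := by
  have h1 : HasLog K (fun z => -Complex.I * (c * z - c * x)) := by
    refine hasLog_of_slitPlane (by fun_prop) fun z hz => upper_log ?_ ?_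
    · rw [Complex.sub_im]; linarith [h z hz]
    · rw [← mul_sub]; exact mul_ne_zero hc (sub_ne_zero.2 fun h => hx (h ▸ hz))
  refine ((HasLog.const K (c := (-Complex.I * c)⁻¹) (by simp [hc])).mul h1).congr fun z hz => ?_
  have := Complex.I_ne_zero
  field_simp

theorem hasLog_lower {K : Set ℂ} {c x : ℂ} (hc : c ≠ 0) (h : ∀ z ∈ K, (c * z).im ≤ (c * x).im) (hx : x ∉ K) :
    HasLog K (fun z => z - x) := by
  refine hasLog_upper (c := -c) (neg_ne_zero.2 hc) (fun z hz => ?_) hx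
  rw [neg_mul, neg_mul, Complex.neg_im, Complex.neg_im]
  exact neg_le_neg (h z hz)

theorem good_upper_split {K : Set ℂ} {c : ℂ} (hc : c ≠ 0) (a : ℝ) {f : ℂ → ℂ}
    (hf : Good (K ∩ {z | a ≤ (c * z).im}) f) :
    ∃ g, Good K g ∧ HasLog (K ∩ {z | (c * z).im ≤ a}) g ∧
      HasLog (K ∩ {z | a ≤ (c * z).im}) (fun z => f z * (g z)⁻¹) := by
  induction hf with
  | log f h => exact ⟨fun _ => 1, .log _ (HasLog.one _), HasLog.one _, h.congr (by simp)⟩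
  | lin x hx =>
    by_cases hxa : a < (c * x).im
    · refine ⟨fun z => z - x, .lin x fun h => hx ⟨h, hxa.le⟩,
        hasLog_lower hc (fun z hz => hz.2.out.trans hxa.le) (fun h => not_lt.2 h.2 hxa),
        (HasLog.one _).congr fun z hz => ?_⟩
      rw [mul_inv_cancel₀]
      exact sub_ne_zero.2 fun h => hx (h ▸ hz)
    · refine ⟨fun _ => 1, .log _ (HasLog.one _), HasLog.one _, ?_⟩
      exact (hasLog_upper hc (fun z hz => (not_lt.1 hxa).trans hz.2) hx).congr (by simp)
  | mul f g hf hg h1 h2 =>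
    obtain ⟨u, hu1, hu2, hu3⟩ := h1
    obtain ⟨v, hv1, hv2, hv3⟩ := h2
    exact ⟨_, .mul _ _ hu1 hv1, hu2.mul hv2, (hu3.mul hv3).congr fun z hz => by
      rw [mul_inv]; ring⟩
  | inv f hf h1 =>
    obtain ⟨u, hu1, hu2, hu3⟩ := h1
    exact ⟨_, .inv _ hu1, hu2.inv, hu3.inv.congr fun z hz => by rw [mul_inv]⟩
  | congr f g hf h h1 =>
    obtain ⟨u, hu1, hu2, hu3⟩ := h1
    exact ⟨_, hu1, hu2, hu3.congr fun z hz => by rw [h z hz]⟩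

theorem good_lower_split {K : Set ℂ} {c : ℂ} (hc : c ≠ 0) (a : ℝ) {f : ℂ → ℂ}
    (hf : Good (K ∩ {z | (c * z).im ≤ a}) f) :
    ∃ g, Good K g ∧ HasLog (K ∩ {z | a ≤ (c * z).im}) g ∧
      HasLog (K ∩ {z | (c * z).im ≤ a}) (fun z => f z * (g z)⁻¹) := by
  have e1 : {z : ℂ | (c * z).im ≤ a} = {z | -a ≤ (-c * z).im} := by ext z; simp
  have e2 : {z : ℂ | a ≤ (c * z).im} = {z | (-c * z).im ≤ -a} := by ext z; simp
  rw [e1] at hf ⊢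
  rw [e2]
  exact good_upper_split (neg_ne_zero.2 hc) (-a) hf

/-- Integer functions on the line that are differences of logs of a good function. -/
def Jump (K : Set ℂ) (c : ℂ) (a : ℝ) (d : ℂ → ℤ) : Prop :=
  ∃ g l m : ℂ → ℂ, Good K g ∧ ContinuousOn l (K ∩ {z | a ≤ (c * z).im}) ∧
    (∀ z ∈ K ∩ {z | a ≤ (c * z).im}, Complex.exp (l z) = g z) ∧
    ContinuousOn m (K ∩ {z | (c * z).im ≤ a}) ∧
    (∀ z ∈ K ∩ {z | (c * z).im ≤ a}, Complex.exp (m z) = g z) ∧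
    ∀ z ∈ K, (c * z).im = a → l z - m z = d z * (2 * Real.pi * Complex.I)

theorem Jump.add {K : Set ℂ} {c : ℂ} {a : ℝ} {d e : ℂ → ℤ} (h : Jump K c a d) (h' : Jump K c a e) :
    Jump K c a (fun z => d z + e z) := by
  obtain ⟨g, l, m, h1, h2, h3, h4, h5, h6⟩ := h
  obtain ⟨g', l', m', h1', h2', h3', h4', h5', h6'⟩ := h'
  refine ⟨_, fun z => l z + l' z, fun z => m z + m' z, .mul _ _ h1 h1', h2.add h2', ?_, h4.add h4', ?_, ?_⟩
  · intro z hz; rw [Complex.exp_add, h3 z hz, h3' z hz]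
  · intro z hz; rw [Complex.exp_add, h5 z hz, h5' z hz]
  · intro z hz hza; push_cast; linear_combination h6 z hz hza + h6' z hz hza

theorem Jump.neg {K : Set ℂ} {c : ℂ} {a : ℝ} {d : ℂ → ℤ} (h : Jump K c a d) :
    Jump K c a (fun z => - d z) := by
  obtain ⟨g, l, m, h1, h2, h3, h4, h5, h6⟩ := h
  refine ⟨_, fun z => -l z, fun z => -m z, .inv _ h1, h2.neg, ?_, h4.neg, ?_, ?_⟩
  · intro z hz; rw [Complex.exp_neg, h3 z hz]
  · intro z hz; rw [Complex.exp_neg, h5 z hz]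
  · intro z hz hza; push_cast; linear_combination -h6 z hz hza

theorem Jump.const {K : Set ℂ} {c : ℂ} {a : ℝ} (n : ℤ) : Jump K c a (fun _ => n) := by
  refine ⟨fun _ => 1, fun z => n * (2 * Real.pi * Complex.I), fun z => 0, .log _ (HasLog.one _),
    continuousOn_const, ?_, continuousOn_const, by simp, by simp⟩
  intro z hz; exact Complex.exp_int_mul_two_pi_mul_I _

theorem Jump.mul {K : Set ℂ} {c : ℂ} {a : ℝ} {d : ℂ → ℤ} (h : Jump K c a d) (n : ℤ) :
    Jump K c a (fun z => n * d z) := by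
  induction n with
  | zero => simpa using Jump.const 0
  | succ i ih =>
    have := ih.add h
    convert this using 2
    ring
  | pred i ih =>
    have := ih.add h.neg
    convert this using 2
    ring

theorem Jump.congr {K : Set ℂ} {c : ℂ} {a : ℝ} {d e : ℂ → ℤ} (h : Jump K c a d)
    (hde : ∀ z ∈ K, (c * z).im = a → d z = e z) : Jump K c a e := by
  obtain ⟨g, l, m, h1, h2, h3, h4, h5, h6⟩ := h
  exact ⟨g, l, m, h1, h2, h3, h4, h5, fun z hz hza => by rw [h6 z hz hza, hde z hz hza]⟩

open Classical in
theorem Jump.step {K : Set ℂ} {c : ℂ} (hc : c ≠ 0) {a : ℝ} {x : ℂ} (hxa : (c * x).im = a) (hx : x ∉ K) :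
    Jump K c a (fun z => if (c * z).re < (c * x).re then 1 else 0) := by
  have hne : ∀ z ∈ K, c * z - c * x ≠ 0 := fun z hz => by
    rw [← mul_sub]; exact mul_ne_zero hc (sub_ne_zero.2 fun h => hx (h ▸ hz))
  have hI : Complex.exp (Real.pi / 2 * Complex.I) = Complex.I := by
    rw [Complex.exp_mul_I]; simp
  refine ⟨fun z => c * (z - x), fun z => Complex.log (-Complex.I * (c * z - c * x)) + Real.pi / 2 * Complex.I,
    fun z => Complex.log (Complex.I * (c * z - c * x)) - Real.pi / 2 * Complex.I,
    .mul _ _ (.log _ (HasLog.const _ hc)) (.lin _ hx), ?_, ?_, ?_, ?_, ?_⟩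
  · refine ContinuousOn.add (ContinuousOn.clog (by fun_prop) fun z hz => upper_log ?_ (hne z hz.1)) continuousOn_const
    rw [Complex.sub_im, hxa]; linarith [hz.2.out]
  · intro z hz
    have := hne z hz.1
    rw [Complex.exp_add, Complex.exp_log (by simp [this]), hI]
    linear_combination (-(c * z - c * x)) * Complex.I_sq
  · refine ContinuousOn.sub (ContinuousOn.clog (by fun_prop) fun z hz => lower_log ?_ (hne z hz.1)) continuousOn_const
    rw [Complex.sub_im, hxa]; linarith [hz.2.out]
  · intro z hz
    have := hne z hz.1
    rw [Complex.exp_sub, Complex.exp_log (by simp [this]), hI]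
    have := Complex.I_ne_zero
    field_simp
  · intro z hz hza
    have h1 := hne z hz
    obtain ⟨t, ht⟩ : ∃ t : ℝ, c * z - c * x = t :=
      ⟨(c * z - c * x).re, Complex.ext (by simp) (by
        rw [Complex.sub_im, hza, hxa]; simp)⟩
    have htre : t = (c * z).re - (c * x).re := by
      have := congrArg Complex.re ht
      simpa using this.symm
    have ht0 : t ≠ 0 := by
      rintro rfl; exact h1 (by simpa using ht)
    simp only []
    rw [ht]
    rcases lt_or_gt_of_ne ht0 with h | h
    · rw [if_pos (by linarith)]
      have e1 : -Complex.I * (t : ℂ) = ((-t : ℝ) : ℂ) * Complex.I := by push_cast; ring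
      have e2 : Complex.I * (t : ℂ) = ((-t : ℝ) : ℂ) * (-Complex.I) := by push_cast; ring
      rw [e1, e2, Complex.log_ofReal_mul (by linarith) (by simp), Complex.log_ofReal_mul (by linarith) (by simp),
        Complex.log_I, Complex.log_neg_I]
      push_cast; ring
    · rw [if_neg (by linarith)]
      have e1 : -Complex.I * (t : ℂ) = ((t : ℝ) : ℂ) * (-Complex.I) := by push_cast; ring
      have e2 : Complex.I * (t : ℂ) = ((t : ℝ) : ℂ) * (Complex.I) := by push_cast; ring
      rw [e1, e2, Complex.log_ofReal_mul (by linarith) (by simp), Complex.log_ofReal_mul (by linarith) (by simp),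
        Complex.log_I, Complex.log_neg_I]
      push_cast; ring

theorem jump_all {K : Set ℂ} (hK : IsCompact K) {c : ℂ} (hc : c ≠ 0) {a : ℝ} {d : ℂ → ℤ}
    (hd : ContinuousOn d (K ∩ {z | (c * z).im = a})) : Jump K c a d := by
  classical
  have hT : IsCompact (K ∩ {z | (c * z).im = a}) :=
    hK.inter_right (isClosed_eq (by fun_prop) continuous_const)
  -- uniform continuity
  obtain ⟨δ, hδ, hu⟩ : ∃ δ > 0, ∀ z ∈ K ∩ {z | (c * z).im = a}, ∀ w ∈ K ∩ {z | (c * z).im = a},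
      |(c * z).re - (c * w).re| < δ → d z = d w := by
    have h1 := hT.uniformContinuousOn_of_continuous hd
    rw [Metric.uniformContinuousOn_iff] at h1
    obtain ⟨δ, hδ, h2⟩ := h1 1 one_pos
    have hcn : 0 < ‖c‖ := norm_pos_iff.2 hc
    refine ⟨‖c‖ * δ, by positivity, fun z hz w hw hzw => ?_⟩
    have h3 : dist z w < δ := by
      have h4 : c * (z - w) = (((c * z).re - (c * w).re : ℝ) : ℂ) := by
        apply Complex.ext
        · simp [mul_sub]
        · have e1 := hz.2.out; have e2 := hw.2.out
          rw [mul_sub, Complex.sub_im, e1, e2]; simp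
      have h5 : ‖c‖ * ‖z - w‖ < ‖c‖ * δ := by
        rw [← norm_mul, h4, Complex.norm_real]; exact hzw
      rw [dist_eq_norm]
      exact lt_of_mul_lt_mul_left h5 hcn.le
    have h6 := h2 z hz w hw h3
    have : (d z - d w : ℤ) = 0 := by
      rw [Int.dist_eq] at h6
      have : |(d z - d w : ℤ)| < 1 := by exact_mod_cast h6
      exact Int.abs_lt_one_iff.1 this
    omega
  obtain ⟨M, hM⟩ : ∃ M : ℝ, ∀ z ∈ K, |(c * z).re| ≤ M := by
    obtain ⟨M, hM⟩ := hK.exists_bound_of_continuousOn (f := fun z => (c * z).re) (by fun_prop)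
    exact ⟨M, fun z hz => by simpa using hM z hz⟩
  have main : ∀ k : ℕ, ∃ e : ℂ → ℤ, Jump K c a e ∧
      (∀ z ∈ K, (c * z).im = a → (c * z).re ≤ -M - δ + k * (δ / 2) → e z = d z) ∧
      ∃ n, ∀ z ∈ K, (c * z).im = a → -M - δ + k * (δ / 2) ≤ (c * z).re → e z = n := by
    intro k
    induction k with
    | zero =>
      refine ⟨fun _ => 0, Jump.const 0, fun z hz _ h => ?_, 0, fun _ _ _ _ => rfl⟩
      have := (abs_le.1 (hM z hz)).1
      rw [Nat.cast_zero, zero_mul] at h; linarith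
    | succ k ih =>
      obtain ⟨e, he, h1, n, h2⟩ := ih
      set t : ℝ := -M - δ + k * (δ / 2) with ht
      have ht' : -M - δ + ((k + 1 : ℕ) : ℝ) * (δ / 2) = t + δ / 2 := by rw [ht]; push_cast; ring
      rw [ht']
      set x : ℂ := (t + a * Complex.I) / c with hx
      have hcx : c * x = t + a * Complex.I := by rw [hx]; field_simp
      have hxa : (c * x).im = a := by rw [hcx]; simp
      have hxt : (c * x).re = t := by rw [hcx]; simp
      by_cases hxK : x ∈ K
      · refine ⟨e, he, fun z hz hza hzt => ?_, n, fun z hz hza hzt => h2 z hz hza (by linarith)⟩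
        by_cases hz' : (c * z).re ≤ t
        · exact h1 z hz hza hz'
        · rw [h2 z hz hza (by linarith), ← h2 x hxK hxa hxt.ge, h1 x hxK hxa hxt.le]
          apply hu x ⟨hxK, hxa⟩ z ⟨hz, hza⟩
          rw [hxt, abs_lt]; constructor <;> linarith
      · by_cases hex : ∃ w ∈ K, (c * w).im = a ∧ t < (c * w).re ∧ (c * w).re ≤ t + δ / 2
        · obtain ⟨w, hw, hwa, hw1, hw2⟩ := hex
          refine ⟨_, (he.add (((Jump.const 1).add (Jump.step hc hxa hxK).neg).mul (d w - n))), ?_, d w, ?_⟩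
          · intro z hz hza hzt
            by_cases hz' : (c * z).re < t
            · simp only [hxt, hz', if_true]; rw [h1 z hz hza hz'.le]; ring
            · have hzt' : t < (c * z).re := by
                refine lt_of_le_of_ne (not_lt.1 hz') fun h => hxK ?_
                have : c * z = c * x := Complex.ext (by rw [hxt, h]) (by rw [hza, hxa])
                rwa [← mul_left_cancel₀ hc this]
              simp only [hxt, hz', if_false]
              rw [h2 z hz hza hzt'.le, hu z ⟨hz, hza⟩ w ⟨hw, hwa⟩ (by rw [abs_lt]; constructor <;> linarith)]
              ring
          · intro z hz hza hzt
            have hz' : ¬ (c * z).re < t := by linarith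
            simp only [hxt, hz', if_false]
            rw [h2 z hz hza (by linarith)]; ring
        · push Not at hex
          refine ⟨e, he, fun z hz hza hzt => ?_, n, fun z hz hza hzt => h2 z hz hza (by linarith)⟩
          by_cases hz' : (c * z).re ≤ t
          · exact h1 z hz hza hz'
          · have := hex z hz hza (by linarith)
            linarith
  obtain ⟨k, hk⟩ := exists_nat_gt ((2 * M + δ) / (δ / 2))
  obtain ⟨e, he, h1, -⟩ := main k
  refine he.congr fun z hz hza => h1 z hz hza ?_
  rw [div_lt_iff₀ (by positivity)] at hk
  have := (abs_le.1 (hM z hz)).2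
  linarith

theorem good_glue {K : Set ℂ} (hK : IsCompact K) {c : ℂ} (hc : c ≠ 0) (a : ℝ) {f : ℂ → ℂ}
    (h1 : Good (K ∩ {z | a ≤ (c * z).im}) f) (h2 : Good (K ∩ {z | (c * z).im ≤ a}) f) : Good K f := by
  obtain ⟨g1, hg1, hg1', hf1⟩ := good_upper_split hc a h1
  obtain ⟨g2, hg2, hg2', hf2⟩ := good_lower_split hc a h2
  refine Good.of_quot (Good.mul _ _ hg1 hg2) ?_
  obtain ⟨l1, hl1, hl1'⟩ : HasLog (K ∩ {z | a ≤ (c * z).im}) (fun z => f z * (g1 z * g2 z)⁻¹) :=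
    (hf1.mul hg2'.inv).congr fun z hz => by rw [mul_inv]; ring
  obtain ⟨l2, hl2, hl2'⟩ : HasLog (K ∩ {z | (c * z).im ≤ a}) (fun z => f z * (g1 z * g2 z)⁻¹) :=
    (hf2.mul hg1'.inv).congr fun z hz => by rw [mul_inv]; ring
  have key : ∀ z ∈ K ∩ {z | (c * z).im = a}, ∃ n : ℤ, l1 z - l2 z = n * (2 * Real.pi * Complex.I) := by
    intro z hz
    have : Complex.exp (l1 z) = Complex.exp (l2 z) := by
      rw [hl1' z ⟨hz.1, hz.2.out.ge⟩, hl2' z ⟨hz.1, hz.2.out.le⟩]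
    obtain ⟨n, hn⟩ := Complex.exp_eq_exp_iff_exists_int.1 this
    exact ⟨n, by rw [hn]; ring⟩
  choose! n hn using key
  have hpi : (2 * Real.pi * Complex.I) ≠ 0 := Complex.two_pi_I_ne_zero
  have hcont : ContinuousOn n (K ∩ {z | (c * z).im = a}) := by
    have h1 : ContinuousOn (fun z => ((l1 z - l2 z) / (2 * Real.pi * Complex.I)).re) (K ∩ {z | (c * z).im = a}) :=
      Complex.continuous_re.comp_continuousOn (((hl1.mono fun z hz => ⟨hz.1, hz.2.out.ge⟩).sub
        (hl2.mono fun z hz => ⟨hz.1, hz.2.out.le⟩)).div_const _)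
    have h2 : ContinuousOn (fun z => ((n z : ℤ) : ℝ)) (K ∩ {z | (c * z).im = a}) := by
      refine h1.congr fun z hz => ?_
      simp only
      rw [hn z hz, mul_div_cancel_right₀ _ hpi]
      simp
    exact Int.isClosedEmbedding_coe_real.isInducing.continuousOn_iff.2 h2
  obtain ⟨g, l, m, hg, hl, hl', hm, hm', hlm⟩ := jump_all hK hc hcont
  refine Good.of_quot hg (Good.log _ ?_)
  have hKu : K = (K ∩ {z | a ≤ (c * z).im}) ∪ (K ∩ {z | (c * z).im ≤ a}) := by
    ext z
    simp only [mem_union, mem_inter_iff, mem_ofPred_eq, ← and_or_left]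
    simp [le_total]
  rw [hKu]
  refine hasLog_glue (l := fun z => l1 z - l z) (m := fun z => l2 z - m z)
    (hK.isClosed.inter (isClosed_le (by fun_prop) (by fun_prop)))
    (hK.isClosed.inter (isClosed_le (by fun_prop) (by fun_prop))) (hl1.sub hl) ?_ (hl2.sub hm) ?_ ?_
  · intro z hz; rw [Complex.exp_sub, hl1' z hz, hl' z hz]; rfl
  · intro z hz; rw [Complex.exp_sub, hl2' z hz, hm' z hz]; rfl
  · intro z hz
    have hza : (c * z).im = a := le_antisymm hz.2.2 hz.1.2
    linear_combination hn z ⟨hz.1.1, hza⟩ - hlm z hz.1.1 hza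

theorem good_strips {K : Set ℂ} (hK : IsCompact K) {c : ℂ} (hc : c ≠ 0) {η : ℝ} (hη : 0 < η) {f : ℂ → ℂ}
    (h : ∀ a : ℝ, Good (K ∩ {z | a ≤ (c * z).im ∧ (c * z).im ≤ a + η}) f) : Good K f := by
  obtain ⟨M, hM⟩ : ∃ M : ℝ, ∀ z ∈ K, |(c * z).im| ≤ M := by
    obtain ⟨M, hM⟩ := hK.exists_bound_of_continuousOn (f := fun z => (c * z).im) (by fun_prop)
    exact ⟨M, fun z hz => by simpa using hM z hz⟩
  have main : ∀ k : ℕ, Good (K ∩ {z | (c * z).im ≤ -M + k * η}) f := by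
    intro k
    induction k with
    | zero =>
      convert h (-M - η) using 1
      ext z
      simp only [mem_inter_iff, mem_ofPred_eq, and_congr_right_iff]
      intro hz
      have := (abs_le.1 (hM z hz)).1
      constructor
      · intro h; rw [Nat.cast_zero, zero_mul] at h; constructor <;> linarith
      · intro h; rw [Nat.cast_zero, zero_mul]; linarith [h.2]
    | succ k ih =>
      refine good_glue (hK.inter_right (isClosed_le (by fun_prop) (by fun_prop))) hc (-M + k * η) ?_ ?_
      · convert h (-M + k * η) using 1
        ext z
        simp only [mem_inter_iff, mem_ofPred_eq, Nat.cast_succ]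
        constructor
        · rintro ⟨⟨h1, h2⟩, h3⟩; exact ⟨h1, h3, by linarith⟩
        · rintro ⟨h1, h2, h3⟩; exact ⟨⟨h1, by linarith⟩, h2⟩
      · convert ih using 1
        ext z
        simp only [mem_inter_iff, mem_ofPred_eq, Nat.cast_succ]
        constructor
        · rintro ⟨⟨h1, h2⟩, h3⟩; exact ⟨h1, h3⟩
        · rintro ⟨h1, h2⟩; exact ⟨⟨h1, by linarith⟩, h2⟩
  obtain ⟨k, hk⟩ := exists_nat_gt (2 * M / η)
  convert main k using 1
  symm
  rw [inter_eq_left]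
  intro z hz
  rw [div_lt_iff₀ hη] at hk
  have := (abs_le.1 (hM z hz)).2
  simp only [mem_ofPred_eq]; linarith

theorem good_all {K : Set ℂ} (hK : IsCompact K) {f : ℂ → ℂ} (hf : ContinuousOn f K) (h0 : ∀ z ∈ K, f z ≠ 0) :
    Good K f := by
  obtain ⟨δ, hδ, hu⟩ : ∃ δ > 0, ∀ z ∈ K, ∀ w ∈ K, dist z w < δ → f z / f w ∈ Complex.slitPlane := by
    rcases K.eq_empty_or_nonempty with rfl | hne
    · exact ⟨1, one_pos, by simp⟩
    obtain ⟨z₀, hz₀, hmin⟩ := hK.exists_isMinOn hne hf.norm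
    have h1 := hK.uniformContinuousOn_of_continuous hf
    rw [Metric.uniformContinuousOn_iff] at h1
    obtain ⟨δ, hδ, h2⟩ := h1 ‖f z₀‖ (norm_pos_iff.2 (h0 z₀ hz₀))
    refine ⟨δ, hδ, fun z hz w hw hzw => ?_⟩
    have h3 := h2 z hz w hw hzw
    rw [dist_eq_norm] at h3
    have h4 : ‖f z / f w - 1‖ < 1 := by
      rw [div_sub_one (h0 w hw), norm_div, div_lt_one (norm_pos_iff.2 (h0 w hw))]
      exact h3.trans_le (hmin hw)
    have := Complex.mem_slitPlane_of_norm_lt_one h4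
    simpa using this
  refine good_strips hK one_ne_zero (half_pos (half_pos hδ)) fun a => ?_
  have hK' : IsCompact (K ∩ {z : ℂ | a ≤ (1 * z).im ∧ (1 * z).im ≤ a + δ / 2 / 2}) :=
    hK.inter_right (IsClosed.and (isClosed_le (by fun_prop) (by fun_prop)) (isClosed_le (by fun_prop) (by fun_prop)))
  refine good_strips hK' Complex.I_ne_zero (half_pos (half_pos hδ)) fun b => .log _ ?_
  set L := (K ∩ {z : ℂ | a ≤ (1 * z).im ∧ (1 * z).im ≤ a + δ / 2 / 2}) ∩
    {z | b ≤ (Complex.I * z).im ∧ (Complex.I * z).im ≤ b + δ / 2 / 2} with hL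
  rcases L.eq_empty_or_nonempty with hLe | ⟨w, hw⟩
  · rw [hLe]; exact ⟨fun _ => 0, continuousOn_empty _, by simp⟩
  have h1 : HasLog L (fun z => f z / f w) := by
    refine hasLog_of_slitPlane ((hf.mono fun z hz => hz.1.1).div_const _) fun z hz => hu z hz.1.1 w hw.1.1 ?_
    rw [dist_eq_norm]
    refine (Complex.norm_le_abs_re_add_abs_im _).trans_lt ?_
    obtain ⟨⟨-, z1, z2⟩, z3, z4⟩ := hz
    obtain ⟨⟨-, w1, w2⟩, w3, w4⟩ := hw
    simp at z1 z2 z3 z4 w1 w2 w3 w4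
    have e1 : |(z - w).re| ≤ δ / 2 / 2 := by
      rw [Complex.sub_re, abs_le]; constructor <;> linarith
    have e2 : |(z - w).im| ≤ δ / 2 / 2 := by
      rw [Complex.sub_im, abs_le]; constructor <;> linarith
    linarith
  have hfw := h0 w hw.1.1
  exact (h1.mul (HasLog.const L hfw)).congr fun z hz => by field_simp

end MooreSphere

namespace MooreSphere
open Set Filter Topology

section face
variable {X : Type*} [TopologicalSpace X] {U V : Set X} {x y z : X}

/-- the component of `x` in `U` -/
def face (U : Set X) (x : X) : Set X := {y | Conn U x y}

theorem mem_face : y ∈ face U x ↔ Conn U x y := Iff.rfl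

theorem face_subset : face U x ⊆ U := fun _ h => Conn.mem_right h

theorem self_mem_face (hx : x ∈ U) : x ∈ face U x := Conn.refl hx

theorem isPreconnected_face : IsPreconnected (face U x) := by
  apply isPreconnected_of_forall x
  rintro y ⟨S, h1, h2, h3, h4⟩
  exact ⟨S, fun z hz => ⟨S, h1, h2, h3, hz⟩, h3, h4, h2⟩

theorem face_subset_of_isPreconnected {S : Set X} (hS : IsPreconnected S) (hSU : S ⊆ U) (hy : y ∈ S)
    (h : y ∈ face U x) : S ⊆ face U x := fun z hz =>
  Conn.trans h ⟨S, hSU, hS, hy, hz⟩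

theorem face_eq (h : Conn U x y) : face U x = face U y := by
  ext z; exact ⟨fun h' => h.symm.trans h', fun h' => h.trans h'⟩

variable [LocallyConnectedSpace X]

theorem conn_eventually (hU : IsOpen U) (hx : x ∈ U) : ∀ᶠ y in 𝓝 x, Conn U x y := by
  have h1 : IsOpen (connectedComponentIn U x) := hU.connectedComponentIn
  filter_upwards [h1.mem_nhds (mem_connectedComponentIn hx)] with y hy
  exact conn_iff_mem_connectedComponentIn.2 ⟨hx, hy⟩

theorem isOpen_face (hU : IsOpen U) : IsOpen (face U x) := by
  rw [isOpen_iff_mem_nhds]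
  intro y hy
  filter_upwards [conn_eventually hU hy.mem_right] with z hz
  exact Conn.trans hy hz

theorem closure_face (hU : IsOpen U) (hy : y ∈ closure (face U x)) (hyU : y ∈ U) : y ∈ face U x := by
  obtain ⟨z, hz, hz'⟩ := (mem_closure_iff_nhds.1 hy) _ (conn_eventually hU hyU)
  exact Conn.trans hz' (Conn.symm hz)

theorem frontier_face (hU : IsOpen U) : frontier (face U x) ⊆ Uᶜ := by
  intro y hy hyU
  rw [(isOpen_face hU).frontier_eq] at hy
  exact hy.2 (closure_face hU hy.1 hyU)

end face

open OnePoint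

theorem conn_ray {K : Set ℂ} {R : ℝ} (hK : K ⊆ Metric.closedBall 0 R) {w : ℂ} (hw : R < ‖w‖) (hR : 0 ≤ R) :
    Conn ((↑) '' K : Set (OnePoint ℂ))ᶜ (w : OnePoint ℂ) ∞ := by
  have hw0 : 0 < ‖w‖ := hR.trans_lt hw
  set T : Set (OnePoint ℂ) := (fun t : ℝ => ((t * w : ℂ) : OnePoint ℂ)) '' Ici 1 with hT
  have hcont : Continuous (fun t : ℝ => ((t * w : ℂ) : OnePoint ℂ)) :=
    continuous_coe.comp (by fun_prop)
  have h1 : IsPreconnected T := isPreconnected_Ici.image _ hcont.continuousOn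
  have h2 : (∞ : OnePoint ℂ) ∈ closure T := by
    have h3 : Tendsto (fun t : ℝ => ((t * w : ℂ) : OnePoint ℂ)) atTop (𝓝 ∞) := by
      refine tendsto_coe_infty.comp ?_
      rw [coclosedCompact_eq_cocompact, ← Metric.cobounded_eq_cocompact, ← tendsto_norm_atTop_iff_cobounded]
      simp only [norm_mul, Complex.norm_real]
      exact (tendsto_norm_atTop_atTop).atTop_mul_const hw0
    refine mem_closure_of_tendsto h3 ?_
    filter_upwards [eventually_ge_atTop 1] with t ht
    exact mem_image_of_mem _ ht
  refine ⟨insert ∞ T, ?_, h1.subset_closure (subset_insert _ _) (insert_subset h2 subset_closure), ?_, mem_insert _ _⟩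
  · rintro p (rfl | ⟨t, ht, rfl⟩)
    · simp
    · rintro ⟨z, hz, hz'⟩
      have : z = t * w := by simpa using hz'
      have h4 := hK hz
      rw [this, mem_closedBall_zero_iff, norm_mul, Complex.norm_real] at h4
      have ht' : 1 ≤ ‖t‖ := by rw [Real.norm_eq_abs]; exact le_trans ht.out (le_abs_self t)
      nlinarith
  · right; exact ⟨1, by simp, by simp⟩

/-- linear factor associated with a point of the sphere -/
noncomputable def qf (p : OnePoint ℂ) (z : ℂ) : ℂ := p.elim 1 (fun x => z - x)

theorem qf_ne_zero {K : Set ℂ} {p : OnePoint ℂ} (hp : p ∈ ((↑) '' K : Set (OnePoint ℂ))ᶜ) {z : ℂ} (hz : z ∈ K) : qf p z ≠ 0 := by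
  induction p using OnePoint.rec with
  | infty => simp [qf]
  | coe x =>
    simp only [qf, elim_some]
    refine sub_ne_zero.2 fun h => hp ⟨z, hz, by rw [h]⟩

theorem conn_hasLog {K : Set ℂ} (hK : IsCompact K) {p p' : OnePoint ℂ}
    (h : Conn ((↑) '' K : Set (OnePoint ℂ))ᶜ p p') : HasLog K (fun z => qf p z * (qf p' z)⁻¹) := by
  obtain ⟨S, hS, hSc, hp, hp'⟩ := h
  obtain ⟨R, hR0, hR⟩ := hK.isBounded.exists_pos_norm_le
  refine hSc.induction₂ (fun p p' => HasLog K (fun z => qf p z * (qf p' z)⁻¹)) ?_ ?_ ?_ hp hp'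
  · intro p hp
    apply eventually_nhdsWithin_of_eventually_nhds
    induction p using OnePoint.rec with
    | infty =>
      rw [nhds_infty_eq, eventually_sup]
      constructor
      · rw [eventually_map, coclosedCompact_eq_cocompact, ← Metric.cobounded_eq_cocompact]
        have : ∀ᶠ x : ℂ in Bornology.cobounded ℂ, R + 1 < ‖x‖ := 
          (tendsto_norm_cobounded_atTop).eventually_gt_atTop (R + 1)
        filter_upwards [this] with x hx
        have hx0 : x ≠ 0 := by rintro rfl; simp at hx; linarith
        have h1 : HasLog K (fun z => 1 + (- z / x)) := by
          refine hasLog_of_slitPlane (by fun_prop) fun z hz => Complex.mem_slitPlane_of_norm_lt_one ?_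
          rw [norm_div, norm_neg, div_lt_one (norm_pos_iff.2 hx0)]
          linarith [hR z hz]
        refine ((HasLog.const K (c := -x) (neg_ne_zero.2 hx0)).mul h1).inv.congr fun z hz => ?_
        simp only [qf, elim_infty, elim_some, one_mul]
        congr 1
        field_simp; ring
      · rw [eventually_pure]
        exact (HasLog.one K).congr fun z hz => by simp [qf]
    | coe x =>
      rw [nhds_coe_eq, eventually_map]
      have hxK : x ∉ K := fun h => hS hp ⟨x, h, rfl⟩
      obtain ⟨ε, hε, hε'⟩ := Metric.isOpen_iff.1 hK.isClosed.isOpen_compl x hxK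
      filter_upwards [Metric.ball_mem_nhds x hε] with y hy
      have h1 : HasLog K (fun z => 1 + (x - y) / (z - x)) := by
        have hne : ∀ z ∈ K, z - x ≠ 0 := fun z hz => sub_ne_zero.2 fun h => hxK (h ▸ hz)
        refine hasLog_of_slitPlane (continuousOn_const.add (ContinuousOn.div₀ continuousOn_const (by fun_prop) hne)) fun z hz => Complex.mem_slitPlane_of_norm_lt_one ?_
        rw [norm_div, div_lt_one (norm_pos_iff.2 (hne z hz))]
        have h2 : ε ≤ ‖z - x‖ := by
          by_contra h3
          exact hε' (mem_ball_iff_norm.2 (not_le.1 h3)) hz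
        rw [← dist_eq_norm, dist_comm]
        exact lt_of_lt_of_le hy h2
      refine h1.inv.congr fun z hz => ?_
      have hne : z - x ≠ 0 := sub_ne_zero.2 fun h => hxK (h ▸ hz)
      simp only [qf, elim_some]
      rw [one_add_div hne, inv_div, div_eq_mul_inv]
      congr 2
      ring
  · intro p p' p'' h1 h2 h3 h4 h5
    refine (h4.mul h5).congr fun z hz => ?_
    have := qf_ne_zero (hS h2) hz
    field_simp
  · intro p p' h1 h2 h3
    refine h3.inv.congr fun z hz => ?_
    rw [mul_inv, inv_inv, mul_comm]

theorem exists_extension {X : Type} [TopologicalSpace X] [NormalSpace X] {K : Set X} (hK : IsClosed K) {Y : Type} [TopologicalSpace Y] [TietzeExtension.{0, 0} Y]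
    {l : X → Y} (hl : ContinuousOn l K) : ∃ L : X → Y, Continuous L ∧ ∀ z ∈ K, L z = l z := by
  obtain ⟨g, hg⟩ := ContinuousMap.exists_restrict_eq hK (⟨K.domRestrict l, hl.domRestrict⟩ : C(K, Y))
  exact ⟨g, g.continuous, fun z hz => by simpa using! congr($(hg) ⟨z, hz⟩)⟩

theorem conn_of_hasLog {K : Set ℂ} (hK : IsCompact K) {x : ℂ} (h : HasLog K (fun z => z - x)) :
    Conn ((↑) '' K : Set (OnePoint ℂ))ᶜ (x : OnePoint ℂ) ∞ := by
  classical
  by_contra hcon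
  have hx : x ∉ K := fun hx => h.ne_zero hx (sub_self x)
  obtain ⟨R, hR0, hR⟩ := hK.isBounded.exists_pos_norm_le
  have hR' : K ⊆ Metric.closedBall 0 R := fun z hz => mem_closedBall_zero_iff.2 (hR z hz)
  set D := face Kᶜ x with hD
  have hKo := hK.isClosed.isOpen_compl
  have hDb : ∀ z ∈ D, ‖z‖ ≤ R := by
    intro z hz
    by_contra hzR
    apply hcon
    refine Conn.trans (y := (z : OnePoint ℂ)) ?_ (conn_ray hR' (not_le.1 hzR) hR0.le)
    have := Conn.image (f := ((↑) : ℂ → OnePoint ℂ)) continuous_coe.continuousOn hz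
    refine this.mono ?_
    rintro _ ⟨w, hw, rfl⟩ ⟨w', hw', h2⟩
    exact hw (coe_injective h2 ▸ hw')
  obtain ⟨l, hl, hl'⟩ := h
  obtain ⟨L, hL, hL'⟩ := exists_extension hK.isClosed hl
  set G : ℂ → ℂ := fun z => if z ∈ D then Complex.exp (L z) else z - x with hG
  have hGc : Continuous G := by
    refine Continuous.if (fun a ha => ?_) (by fun_prop) (by fun_prop)
    have haK : a ∈ K := by
      by_contra h; exact frontier_face hKo ha h
    rw [hL' a haK, hl' a haK]
  have hG0 : ∀ z, G z ≠ 0 := by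
    intro z
    by_cases hz : z ∈ D
    · simp [hG, hz]
    · simp only [hG, hz, if_false]
      exact sub_ne_zero.2 fun h => hz (h ▸ self_mem_face hx)
  have h1 := (hasLog_univ hGc hG0).mono (subset_univ (Metric.sphere x (‖x‖ + R + 1)))
  refine not_hasLog_circle x (R := ‖x‖ + R + 1) (by positivity) (h1.congr fun z hz => ?_)
  have hzD : z ∉ D := by
    intro h2
    have h3 := hDb z h2
    rw [mem_sphere_iff_norm] at hz
    have := norm_sub_le z x
    linarith
  simp [hG, hzD]

theorem coe_image_preimage {A : Set (OnePoint ℂ)} (hA : ∞ ∉ A) : (↑) '' ((↑) ⁻¹' A : Set ℂ) = A := by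
  rw [image_preimage_eq_inter_range]
  exact inter_eq_left.2 fun p hp => ne_infty_iff_exists.1 fun h => hA (h ▸ hp)

theorem isCompact_pre {A : Set (OnePoint ℂ)} (hAc : IsClosed A) (hA : ∞ ∉ A) : IsCompact ((↑) ⁻¹' A : Set ℂ) :=
  ((isClosed_iff_of_notMem hA).1 hAc).2

theorem j1_onePoint {A B : Set (OnePoint ℂ)} (hA : IsClosed A) (hB : IsClosed B) (hAB : IsPreconnected (A ∩ B))
    {p : OnePoint ℂ} (h1 : Conn Aᶜ p ∞) (h2 : Conn Bᶜ p ∞) : Conn (A ∪ B)ᶜ p ∞ := by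
  have hA' := h1.mem_right
  have hB' := h2.mem_right
  induction p using OnePoint.rec with
  | infty => exact Conn.refl (by simp only [compl_union]; exact ⟨hA', hB'⟩)
  | coe x =>
    have key : ∀ C : Set (OnePoint ℂ), IsClosed C → Conn Cᶜ (x : OnePoint ℂ) ∞ →
        HasLog ((↑) ⁻¹' C) (fun z => z - x) := by
      intro C hC h
      have h3 := h
      rw [← coe_image_preimage h.mem_right] at h3
      exact (conn_hasLog (isCompact_pre hC h.mem_right) h3).congr fun z hz => by simp [qf]
    have h3 := key A hA h1
    have h4 := key B hB h2
    have hpre : IsPreconnected ((↑) ⁻¹' A ∩ (↑) ⁻¹' B : Set ℂ) := by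
      rw [← preimage_inter]
      refine IsPreconnected.preimage_of_isOpenMap hAB coe_injective isOpenMap_coe ?_
      exact fun p hp => ne_infty_iff_exists.1 fun h => hA' (h ▸ hp.1)
    have h5 := HasLog.union (hA.preimage continuous_coe) (hB.preimage continuous_coe) hpre h3 h4
    have h6 := conn_of_hasLog ((isCompact_pre hA hA').union (isCompact_pre hB hB')) h5
    rwa [← preimage_union, coe_image_preimage (by simp only [mem_union, not_or]; exact ⟨hA', hB'⟩)] at h6

theorem good_hasLog {K : Set ℂ} (hK : IsCompact K) (hconn : ∀ x : ℂ, x ∉ K → Conn ((↑) '' K : Set (OnePoint ℂ))ᶜ (x : OnePoint ℂ) ∞)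
    {f : ℂ → ℂ} (hf : Good K f) : HasLog K f := by
  induction hf with
  | log f h => exact h
  | lin x hx => exact (conn_hasLog hK (hconn x hx)).congr fun z hz => by simp [qf]
  | mul f g hf hg h1 h2 => exact h1.mul h2
  | inv f hf h1 => exact h1.inv
  | congr f g hf h h1 => exact h1.congr h

theorem j2_onePoint {A B C D : Set (OnePoint ℂ)} (hA : IsClosed A) (hB : IsClosed B) (hAp : IsPreconnected A) (hBp : IsPreconnected B)
    (hAi : ∞ ∉ A) (hBi : ∞ ∉ B)
    (hC : IsClosed C) (hD : IsClosed D) (hCD : Disjoint C D) (hCne : C.Nonempty) (hDne : D.Nonempty) (hABCD : A ∩ B = C ∪ D) :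
    ∃ x ∉ A ∪ B, ¬ Conn (A ∪ B)ᶜ x ∞ := by
  classical
  by_contra! hcon
  have hABi : ∞ ∉ A ∪ B := by simp only [mem_union, not_or]; exact ⟨hAi, hBi⟩
  have hAc := isCompact_pre hA hAi
  have hBc := isCompact_pre hB hBi
  set K : Set ℂ := (↑) ⁻¹' A ∪ (↑) ⁻¹' B with hK
  have hKc : IsCompact K := hAc.union hBc
  obtain ⟨v, hv0, hv1, hv⟩ := exists_continuous_zero_one_of_isClosed (hC.preimage continuous_coe) (hD.preimage continuous_coe)
    (hCD.preimage ((↑) : ℂ → OnePoint ℂ))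
  set f : ℂ → ℂ := fun z => if (z : OnePoint ℂ) ∈ A then Complex.exp (v z * (Real.pi * Complex.I)) else Complex.exp (- (v z * (Real.pi * Complex.I))) with hf
  have hfA : ∀ z : ℂ, (z : OnePoint ℂ) ∈ A → f z = Complex.exp (v z * (Real.pi * Complex.I)) := fun z hz => by simp [hf, hz]
  have hfB : ∀ z : ℂ, (z : OnePoint ℂ) ∈ B → f z = Complex.exp (- (v z * (Real.pi * Complex.I))) := by
    intro z hz
    by_cases hzA : (z : OnePoint ℂ) ∈ A
    · rw [hfA z hzA]
      have : (z : OnePoint ℂ) ∈ C ∪ D := hABCD ▸ ⟨hzA, hz⟩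
      rcases this with h | h
      · simp [hv0 h]
      · simp only [hv1 h]; simp [Complex.exp_pi_mul_I, Complex.exp_neg]
    · simp [hf, hzA]
  have hvc : Continuous (fun z => (v z : ℂ)) := Complex.continuous_ofReal.comp v.continuous
  have hfc : ContinuousOn f K := by
    refine ContinuousOn.union_of_isClosed ?_ ?_ hAc.isClosed hBc.isClosed
    · exact ContinuousOn.congr (f := fun z => Complex.exp (v z * (Real.pi * Complex.I))) (by fun_prop) hfA
    · exact ContinuousOn.congr (f := fun z => Complex.exp (- (v z * (Real.pi * Complex.I)))) (by fun_prop) hfB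
  have hf0 : ∀ z ∈ K, f z ≠ 0 := by
    intro z hz; simp only [hf]; split_ifs <;> exact Complex.exp_ne_zero _
  have himg : ((↑) '' K : Set (OnePoint ℂ)) = A ∪ B := by
    rw [hK, ← preimage_union, coe_image_preimage hABi]
  obtain ⟨l, hl, hl'⟩ : HasLog K f := by
    refine good_hasLog hKc (fun x hx => ?_) (good_all hKc hfc hf0)
    rw [himg]
    exact hcon x hx
  have hpA : IsPreconnected ((↑) ⁻¹' A : Set ℂ) := 
    IsPreconnected.preimage_of_isOpenMap hAp coe_injective isOpenMap_coe (by
      exact fun p hp => ne_infty_iff_exists.1 fun h => hAi (h ▸ hp))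
  have hpB : IsPreconnected ((↑) ⁻¹' B : Set ℂ) := 
    IsPreconnected.preimage_of_isOpenMap hBp coe_injective isOpenMap_coe (by
      exact fun p hp => ne_infty_iff_exists.1 fun h => hBi (h ▸ hp))
  obtain ⟨c, hc, hca⟩ := log_diff_const hpA (l := l) (m := fun z => v z * (Real.pi * Complex.I)) (hl.mono subset_union_left) (by fun_prop)
    (fun z hz => by rw [hl' z (Or.inl hz), hfA z hz])
  obtain ⟨d, hd, hda⟩ := log_diff_const hpB (l := l) (m := fun z => -(v z * (Real.pi * Complex.I))) (hl.mono subset_union_right) (by fun_prop)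
    (fun z hz => by rw [hl' z (Or.inr hz), hfB z hz])
  obtain ⟨p, hp⟩ := hCne
  obtain ⟨q, hq⟩ := hDne
  have hpAB : p ∈ A ∩ B := hABCD ▸ Or.inl hp
  have hqAB : q ∈ A ∩ B := hABCD ▸ Or.inr hq
  obtain ⟨a, rfl⟩ := ne_infty_iff_exists.1 (fun h => hAi (h ▸ hpAB.1) : p ≠ ∞)
  obtain ⟨b, rfl⟩ := ne_infty_iff_exists.1 (fun h => hAi (h ▸ hqAB.1) : q ≠ ∞)
  have e1 := hca a hpAB.1
  have e2 := hda a hpAB.2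
  have e3 := hca b hqAB.1
  have e4 := hda b hqAB.2
  have va : v a = 0 := hv0 hp
  have vb : v b = 1 := hv1 hq
  rw [va] at e1 e2
  rw [vb] at e3 e4
  simp only [Complex.ofReal_zero, Complex.ofReal_one] at e1 e2 e3 e4
  exact Complex.two_pi_I_ne_zero (by linear_combination e4 - e3 - e2 + e1)

end MooreSphere

namespace MooreSphere
open Set Filter Topology

open OnePoint

/-- the unit sphere, as a type -/
abbrev SS : Type := ↥(Metric.sphere (0 : EuclideanSpace ℝ (Fin 3)) 1)

theorem exists_chart (v : SS) : ∃ e : OnePoint ℂ ≃ₜ SS, e ∞ = v := by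
  have hv : ‖(v : EuclideanSpace ℝ (Fin 3))‖ = 1 := by simp
  have : Fact (Module.finrank ℝ (EuclideanSpace ℝ (Fin 3)) = 2 + 1) := ⟨by simp⟩
  have hv0 : (v : EuclideanSpace ℝ (Fin 3)) ≠ 0 := by
    intro h; rw [h] at hv; simp at hv
  have h2 : Module.finrank ℝ ℂ = Module.finrank ℝ (Submodule.span ℝ {(v : EuclideanSpace ℝ (Fin 3))})ᗮ := by
    rw [Submodule.finrank_orthogonal_span_singleton (n := 2) hv0, Complex.finrank_real_complex]
  obtain ⟨f⟩ := FiniteDimensional.nonempty_continuousLinearEquiv_of_finrank_eq h2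
  refine ⟨f.toHomeomorph.onePointCongr.trans (onePointHyperplaneHomeoUnitSphere hv), ?_⟩
  rfl

theorem Conn.of_homeo {X Y : Type*} [TopologicalSpace X] [TopologicalSpace Y] (e : X ≃ₜ Y) {U : Set Y} {x y : X}
    (h : Conn (e ⁻¹' U) x y) : Conn U (e x) (e y) := by
  obtain ⟨S, h1, h2, h3, h4⟩ := h
  exact ⟨e '' S, by rintro _ ⟨s, hs, rfl⟩; exact h1 hs, h2.image _ e.continuous.continuousOn,
    mem_image_of_mem _ h3, mem_image_of_mem _ h4⟩

theorem Conn.to_homeo {X Y : Type*} [TopologicalSpace X] [TopologicalSpace Y] (e : X ≃ₜ Y) {U : Set Y} {x y : X}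
    (h : Conn U (e x) (e y)) : Conn (e ⁻¹' U) x y := by
  have h' : Conn (e.symm ⁻¹' (e ⁻¹' U)) (e x) (e y) := by
    convert h; ext z; simp
  simpa using Conn.of_homeo e.symm h'

theorem j1_sphere {A B : Set SS} (hA : IsClosed A) (hB : IsClosed B) (hAB : IsPreconnected (A ∩ B))
    {x y : SS} (h1 : Conn Aᶜ x y) (h2 : Conn Bᶜ x y) : Conn (A ∪ B)ᶜ x y := by
  obtain ⟨e, rfl⟩ := exists_chart y
  obtain ⟨p, rfl⟩ := e.surjective x
  apply Conn.of_homeo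
  exact j1_onePoint (hA.preimage e.continuous) (hB.preimage e.continuous)
    (e.isPreconnected_preimage.2 hAB) (Conn.to_homeo e h1) (Conn.to_homeo e h2)

theorem j2_sphere {A B C D : Set SS} (hA : IsClosed A) (hB : IsClosed B) (hAp : IsPreconnected A) (hBp : IsPreconnected B)
    (hne : A ∪ B ≠ univ)
    (hC : IsClosed C) (hD : IsClosed D) (hCD : Disjoint C D) (hCne : C.Nonempty) (hDne : D.Nonempty) (hABCD : A ∩ B = C ∪ D) :
    ∃ x y, x ∉ A ∪ B ∧ y ∉ A ∪ B ∧ ¬ Conn (A ∪ B)ᶜ x y := by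
  obtain ⟨y, hy⟩ := (ne_univ_iff_exists_notMem _).1 hne
  obtain ⟨e, rfl⟩ := exists_chart y
  obtain ⟨p, hp, hp'⟩ := j2_onePoint (hA.preimage e.continuous) (hB.preimage e.continuous)
    (e.isPreconnected_preimage.2 hAp) (e.isPreconnected_preimage.2 hBp) (fun h => hy (Or.inl h)) (fun h => hy (Or.inr h))
    (hC.preimage e.continuous) (hD.preimage e.continuous) (hCD.preimage e) (hCne.preimage e.surjective) (hDne.preimage e.surjective)
    (by rw [← preimage_inter, hABCD, preimage_union])
  refine ⟨e p, _, hp, hy, fun h => hp' (Conn.to_homeo e h)⟩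

theorem isPreconnected_preimage {X Y : Type*} [TopologicalSpace X] [TopologicalSpace Y] {f : X → Y} (hf : IsClosedMap f)
    (hs : f.Surjective) (hfib : ∀ y, IsPreconnected (f ⁻¹' {y})) {S : Set Y} (hS : IsPreconnected S) :
    IsPreconnected (f ⁻¹' S) := by
  rw [isPreconnected_closed_iff] at *
  intro u v hu hv huv ⟨x, hxS, hxu⟩ ⟨x', hxS', hxv⟩
  obtain ⟨y, hyS, ⟨a, ha, rfl⟩, ⟨b, hb, hab⟩⟩ := hS (f '' u) (f '' v) (hf _ hu) (hf _ hv) (by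
    intro y hy
    obtain ⟨x, rfl⟩ := hs y
    exact (huv hy).imp (mem_image_of_mem f) (mem_image_of_mem f)) ⟨f x, hxS, mem_image_of_mem _ hxu⟩ ⟨f x', hxS', mem_image_of_mem _ hxv⟩
  have := isPreconnected_closed_iff.1 (hfib (f a)) u v hu hv (by
    rintro z hz
    exact huv (show f z ∈ S by rw [show f z = f a from hz]; exact hyS)) ⟨a, rfl, ha⟩ ⟨b, hab, hb⟩
  obtain ⟨z, hz, hz'⟩ := this
  exact ⟨z, show f z ∈ S by rw [show f z = f a from hz]; exact hyS, hz'⟩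

/-- spaces sharing the separation properties of the sphere -/
class Jan (X : Type) [MetricSpace X] : Prop extends CompactSpace X, LocallyPathConnectedSpace X where
  nontriv : Nontrivial X
  conn : ∀ x y : X, Conn univ x y
  pt : ∀ p x y : X, x ≠ p → y ≠ p → Conn {p}ᶜ x y
  j1 : ∀ A B : Set X, IsClosed A → IsClosed B → IsPreconnected (A ∩ B) → ∀ x y, Conn Aᶜ x y → Conn Bᶜ x y → Conn (A ∪ B)ᶜ x y
  j2 : ∀ A B : Set X, IsClosed A → IsClosed B → IsPreconnected A → IsPreconnected B → ∀ a b : X, a ≠ b → A ∩ B = {a, b} →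
    A ∪ B ≠ univ → ∃ x y, x ∉ A ∪ B ∧ y ∉ A ∪ B ∧ ¬ Conn (A ∪ B)ᶜ x y

theorem Conn.preimage {X Y : Type*} [TopologicalSpace X] [TopologicalSpace Y] {f : X → Y} (hf : IsClosedMap f)
    (hs : f.Surjective) (hfib : ∀ y, IsPreconnected (f ⁻¹' {y})) {U : Set Y} {x y : X} (h : Conn U (f x) (f y)) :
    Conn (f ⁻¹' U) x y := by
  obtain ⟨S, h1, h2, h3, h4⟩ := h
  exact ⟨f ⁻¹' S, preimage_mono h1, isPreconnected_preimage hf hs hfib h2, h3, h4⟩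

theorem Conn.of_preimage {X Y : Type*} [TopologicalSpace X] [TopologicalSpace Y] {f : X → Y} (hf : Continuous f)
    {U : Set Y} {x y : X} (h : Conn (f ⁻¹' U) x y) : Conn U (f x) (f y) := by
  obtain ⟨S, h1, h2, h3, h4⟩ := h
  exact ⟨f '' S, by rintro _ ⟨s, hs, rfl⟩; exact h1 hs, h2.image _ hf.continuousOn,
    mem_image_of_mem _ h3, mem_image_of_mem _ h4⟩

theorem isPreconnected_SS : IsPreconnected (univ : Set SS) := by
  have h : IsPreconnected (Metric.sphere (0 : EuclideanSpace ℝ (Fin 3)) 1) :=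
    isPreconnected_sphere (by simp [← Module.finrank_eq_rank]) _ _
  exact (isPreconnected_iff_preconnectedSpace.1 h).isPreconnected_univ

theorem isPreconnected_SS_compl (p : SS) : IsPreconnected ({p}ᶜ : Set SS) := by
  obtain ⟨e, rfl⟩ := exists_chart p
  have h : ({e ∞}ᶜ : Set SS) = (fun z : ℂ => e z) '' univ := by
    ext x
    obtain ⟨q, rfl⟩ := e.surjective x
    induction q using OnePoint.rec with
    | infty => simp
    | coe x => simp
  rw [h]
  exact isPreconnected_univ.image _ (e.continuous.comp continuous_coe).continuousOn

theorem jan_of_map {X : Type} [MetricSpace X] (f : SS → X) (hf : Continuous f) (hs : f.Surjective)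
    (hfib : ∀ y, IsPreconnected (f ⁻¹' {y})) (hfib' : ∀ y, IsPreconnected (f ⁻¹' {y})ᶜ) (hnt : Nontrivial X) : Jan X := by
  have hcl : IsClosedMap f := hf.isClosedMap
  have : LocallyPathConnectedSpace SS := by
    have : Fact (Module.finrank ℝ (EuclideanSpace ℝ (Fin 3)) = 2 + 1) := ⟨by simp⟩
    exact ChartedSpace.locallyPathConnectedSpace (EuclideanSpace ℝ (Fin 2)) SS
  have : CompactSpace X := hs.compactSpace hf
  have : LocallyPathConnectedSpace X := (hcl.isQuotientMap hf hs).locallyPathConnectedSpace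
  refine { nontriv := hnt, conn := ?_, pt := ?_, j1 := ?_, j2 := ?_ }
  · intro x y
    obtain ⟨x, rfl⟩ := hs x
    obtain ⟨y, rfl⟩ := hs y
    exact Conn.of_preimage hf ⟨univ, by simp, isPreconnected_SS, trivial, trivial⟩
  · intro p x y hx hy
    obtain ⟨x, rfl⟩ := hs x
    obtain ⟨y, rfl⟩ := hs y
    exact Conn.of_preimage hf ⟨_, subset_rfl, hfib' p, hx, hy⟩
  · intro A B hA hB hAB x y h1 h2
    obtain ⟨x, rfl⟩ := hs x
    obtain ⟨y, rfl⟩ := hs y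
    apply Conn.of_preimage hf
    exact j1_sphere (hA.preimage hf) (hB.preimage hf) (isPreconnected_preimage hcl hs hfib hAB) (h1.preimage hcl hs hfib) (h2.preimage hcl hs hfib)
  · intro A B hA hB hAp hBp a b hab hAB hne
    obtain ⟨x, y, hx, hy, h⟩ := j2_sphere (hA.preimage hf) (hB.preimage hf) (isPreconnected_preimage hcl hs hfib hAp)
      (isPreconnected_preimage hcl hs hfib hBp) (by
        rw [← preimage_union]; intro h; apply hne
        rw [eq_univ_iff_forall]; intro y; obtain ⟨x, rfl⟩ := hs y
        exact (h ▸ mem_univ x : x ∈ f ⁻¹' (A ∪ B))) (C := f ⁻¹' {a}) (D := f ⁻¹' {b})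
      (isClosed_singleton.preimage hf) (isClosed_singleton.preimage hf) ((disjoint_singleton.2 hab).preimage f)
      ((singleton_nonempty a).preimage hs) ((singleton_nonempty b).preimage hs) (by rw [← preimage_inter, hAB]; rfl)
    exact ⟨f x, f y, hx, hy, fun h' => h (h'.preimage hcl hs hfib)⟩

theorem jan_SS : Jan SS := by
  refine jan_of_map id continuous_id Function.surjective_id (fun y => ?_) (fun y => ?_) ?_
  · exact isPreconnected_singleton
  · exact isPreconnected_SS_compl y
  · obtain ⟨e⟩ : Nonempty (OnePoint ℂ ≃ₜ SS) := by
      obtain ⟨v⟩ : Nonempty SS := (NormedSpace.sphere_nonempty (x := (0 : EuclideanSpace ℝ (Fin 3))).2 zero_le_one).to_subtype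
      exact ⟨(exists_chart v).choose⟩
    exact ⟨e ∞, e (0 : ℂ), by simp⟩

section quot
variable {r : SS → SS → Prop} (hr : Equivalence r)

/-- the quotient -/
abbrev QQ : Type := Quotient (⟨r, hr⟩ : Setoid SS)

theorem quot_isClosedMap (hclosed : IsClosed {p : SS × SS | r p.1 p.2}) :
    IsClosedMap (Quotient.mk (⟨r, hr⟩ : Setoid SS)) := by
  intro C hC
  rw [← (isQuotientMap_quotient_mk' (s := (⟨r, hr⟩ : Setoid SS))).isClosed_preimage]
  have h : Quotient.mk (⟨r, hr⟩ : Setoid SS) ⁻¹' (Quotient.mk (⟨r, hr⟩ : Setoid SS) '' C)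
      = Prod.snd '' ({p : SS × SS | r p.1 p.2} ∩ Prod.fst ⁻¹' C) := by
    ext y
    constructor
    · rintro ⟨x, hx, hxy⟩
      exact ⟨(x, y), ⟨Quotient.exact hxy, hx⟩, rfl⟩
    · rintro ⟨⟨x, y⟩, ⟨h1, h2⟩, rfl⟩
      exact ⟨x, h2, Quotient.sound h1⟩
  exact h ▸ isClosedMap_snd_of_compactSpace _ (hclosed.inter (hC.preimage continuous_fst))

theorem quot_fiber (x : SS) : Quotient.mk (⟨r, hr⟩ : Setoid SS) ⁻¹' {Quotient.mk (⟨r, hr⟩ : Setoid SS) x} = {y | r x y} := by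
  ext y
  exact ⟨fun h => hr.symm (Quotient.exact h), fun h => Quotient.sound (hr.symm h)⟩

theorem closedMap_t2 {X Y : Type*} [TopologicalSpace X] [TopologicalSpace Y] [T2Space X] {f : X → Y}
    (hcl : IsClosedMap f) (hs : f.Surjective)
    (hfib : ∀ y, IsCompact (f ⁻¹' {y})) : T2Space Y := by
  refine ⟨fun y z hyz => ?_⟩
  obtain ⟨U, V, hU, hV, h1, h2, h3⟩ := SeparatedNhds.of_isCompact_isCompact (hfib y) (hfib z) ((disjoint_singleton.2 hyz).preimage f)
  refine ⟨(f '' Uᶜ)ᶜ, (f '' Vᶜ)ᶜ, (hcl _ hU.isClosed_compl).isOpen_compl, (hcl _ hV.isClosed_compl).isOpen_compl, ?_, ?_, ?_⟩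
  · rintro ⟨x, hx, rfl⟩; exact hx (h1 rfl)
  · rintro ⟨x, hx, rfl⟩; exact hx (h2 rfl)
  · rw [disjoint_left]
    intro w hw hw'
    obtain ⟨x, rfl⟩ := hs w
    have hxU : x ∈ U := by by_contra h; exact hw ⟨x, h, rfl⟩
    have hxV : x ∈ V := by by_contra h; exact hw' ⟨x, h, rfl⟩
    exact disjoint_left.1 h3 hxU hxV

theorem closedMap_sc {X Y : Type*} [TopologicalSpace X] [TopologicalSpace Y] [SecondCountableTopology X] {f : X → Y}
    (hf : Continuous f) (hcl : IsClosedMap f) (hs : f.Surjective)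
    (hfib : ∀ y, IsCompact (f ⁻¹' {y})) : SecondCountableTopology Y := by
  let B := TopologicalSpace.countableBasis X
  have hB : TopologicalSpace.IsTopologicalBasis B := TopologicalSpace.isBasis_countableBasis X
  let W : Set (Set X) → Set Y := fun F => (f '' (⋃₀ F)ᶜ)ᶜ
  have hb : TopologicalSpace.IsTopologicalBasis (W '' {F | F.Finite ∧ F ⊆ B}) := by
    apply TopologicalSpace.isTopologicalBasis_of_isOpen_of_nhds
    · rintro _ ⟨F, ⟨h1, h2⟩, rfl⟩
      exact (hcl _ (isOpen_sUnion fun s hs => hB.isOpen (h2 hs)).isClosed_compl).isOpen_compl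
    · intro y V hy hV
      have : ∃ F : Set (Set X), (F.Finite ∧ F ⊆ B) ∧ f ⁻¹' {y} ⊆ ⋃₀ F ∧ ⋃₀ F ⊆ f ⁻¹' V := by
        refine (hfib y).induction_on (p := fun s => ∃ F : Set (Set X), (F.Finite ∧ F ⊆ B) ∧ s ⊆ ⋃₀ F ∧ ⋃₀ F ⊆ f ⁻¹' V) ?_ ?_ ?_ ?_
        · exact ⟨∅, ⟨finite_empty, empty_subset _⟩, by simp, by simp⟩
        · rintro s t hst ⟨F, h1, h2, h3⟩
          exact ⟨F, h1, hst.trans h2, h3⟩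
        · rintro s t ⟨F, h1, h2, h3⟩ ⟨F', h1', h2', h3'⟩
          refine ⟨F ∪ F', ⟨h1.1.union h1'.1, union_subset h1.2 h1'.2⟩, ?_, ?_⟩
          · rw [sUnion_union]; exact union_subset_union h2 h2'
          · rw [sUnion_union]; exact union_subset h3 h3'
        · intro x hx
          obtain ⟨s, hs, hxs, hsV⟩ := hB.exists_subset_of_mem_open (show x ∈ f ⁻¹' V by rw [mem_preimage, show f x = y from hx]; exact hy) (hV.preimage hf)
          exact ⟨s, mem_nhdsWithin_of_mem_nhds ((hB.isOpen hs).mem_nhds hxs), {s}, ⟨finite_singleton _, by simpa using hs⟩, by simp, by simpa using hsV⟩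
      obtain ⟨F, h1, h2, h3⟩ := this
      refine ⟨W F, mem_image_of_mem _ h1, ?_, ?_⟩
      · rintro ⟨x, hx, hxy⟩; exact hx (h2 hxy)
      · intro w hw
        obtain ⟨x, rfl⟩ := hs w
        apply h3
        by_contra h
        exact hw ⟨x, h, rfl⟩
  exact hb.secondCountableTopology ((Set.countable_ofPred_finite_subset (TopologicalSpace.countable_countableBasis X)).image _)

theorem quot_metrizable (hclosed : IsClosed {p : SS × SS | r p.1 p.2}) : TopologicalSpace.MetrizableSpace (QQ hr) := by
  have hcl := quot_isClosedMap hr hclosed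
  have hfib : ∀ y, IsCompact (Quotient.mk (⟨r, hr⟩ : Setoid SS) ⁻¹' {y}) := by
    intro y
    obtain ⟨x, rfl⟩ := Quotient.exists_rep y
    rw [quot_fiber]
    exact (hclosed.preimage (Continuous.prodMk_right x)).isCompact
  have h1 : T2Space (QQ hr) := closedMap_t2 hcl Quotient.mk_surjective hfib
  have h2 : SecondCountableTopology (QQ hr) := closedMap_sc continuous_quotient_mk' hcl Quotient.mk_surjective hfib
  infer_instance

end quot
end MooreSphere

namespace MooreSphere
open Set Filter Topology

section arcs
variable {X : Type*} [MetricSpace X] {A B : Set X} {a b c : X}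

/-- `A` is an arc from `a` to `b` -/
def IsArc (A : Set X) (a b : X) : Prop :=
  ∃ γ : ℝ → X, Continuous γ ∧ InjOn γ (Icc 0 1) ∧ γ 0 = a ∧ γ 1 = b ∧ γ '' Icc 0 1 = A

theorem isArc_of_interval {s t : ℝ} (hst : s < t) {ψ : ℝ → X} (hc : ContinuousOn ψ (Icc s t)) (hi : InjOn ψ (Icc s t)) :
    IsArc (ψ '' Icc s t) (ψ s) (ψ t) := by
  have hd : 0 < t - s := sub_pos.2 hst
  set c : ℝ → ℝ := fun u => s + max 0 (min 1 u) * (t - s) with hcdef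
  have hcm : ∀ u, c u ∈ Icc s t := by
    intro u
    have h1 : 0 ≤ max 0 (min 1 u) := le_max_left _ _
    have h2 : max 0 (min 1 u) ≤ 1 := max_le zero_le_one (min_le_left _ _)
    exact ⟨by simp only [hcdef]; nlinarith, by simp only [hcdef]; nlinarith⟩
  have hcu : ∀ u ∈ Icc (0 : ℝ) 1, c u = s + u * (t - s) := by
    intro u hu
    simp only [hcdef]
    rw [min_eq_right hu.2, max_eq_right hu.1]
  refine ⟨fun u => ψ (c u), hc.comp_continuous (by fun_prop) hcm, ?_, ?_, ?_, ?_⟩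
  · intro u hu v hv huv
    have h := hi (hcm u) (hcm v) huv
    rw [hcu u hu, hcu v hv] at h
    exact mul_right_cancel₀ hd.ne' (by linarith)
  · simp only []; rw [hcu 0 (by simp)]; simp
  · simp only []; rw [hcu 1 (by simp)]; simp
  · apply Subset.antisymm
    · rintro _ ⟨u, hu, rfl⟩
      exact mem_image_of_mem _ (hcm u)
    · rintro _ ⟨v, hv, rfl⟩
      have hu : (v - s) / (t - s) ∈ Icc (0 : ℝ) 1 :=
        ⟨div_nonneg (by linarith [hv.1]) hd.le, (div_le_one hd).2 (by linarith [hv.2])⟩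
      refine ⟨_, hu, ?_⟩
      simp only []
      rw [hcu _ hu, div_mul_cancel₀ _ hd.ne']
      congr 1; ring

theorem IsArc.isCompact (h : IsArc A a b) : IsCompact A := by
  obtain ⟨γ, h1, -, -, -, rfl⟩ := h
  exact isCompact_Icc.image h1

theorem IsArc.isClosed (h : IsArc A a b) : IsClosed A := h.isCompact.isClosed

theorem IsArc.isPreconnected (h : IsArc A a b) : IsPreconnected A := by
  obtain ⟨γ, h1, -, -, -, rfl⟩ := h
  exact isPreconnected_Icc.image _ h1.continuousOn

theorem IsArc.left_mem (h : IsArc A a b) : a ∈ A := by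
  obtain ⟨γ, h1, -, rfl, -, rfl⟩ := h
  exact mem_image_of_mem _ (by simp)

theorem IsArc.right_mem (h : IsArc A a b) : b ∈ A := by
  obtain ⟨γ, h1, -, -, rfl, rfl⟩ := h
  exact mem_image_of_mem _ (by simp)

theorem IsArc.ne (h : IsArc A a b) : a ≠ b := by
  obtain ⟨γ, h1, hi, rfl, rfl, rfl⟩ := h
  intro h
  simpa using hi (by simp) (by simp) h

theorem IsArc.symm (h : IsArc A a b) : IsArc A b a := by
  obtain ⟨γ, h1, hi, rfl, rfl, rfl⟩ := h
  refine ⟨fun u => γ (1 - u), by fun_prop, ?_, by simp, by simp, ?_⟩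
  · intro u hu v hv huv
    have := hi (by simpa using hu.symm) (by simpa using hv.symm) huv
    linarith
  · apply Subset.antisymm
    · rintro _ ⟨u, hu, rfl⟩
      exact mem_image_of_mem _ (by simpa using hu.symm)
    · rintro _ ⟨u, hu, rfl⟩
      exact ⟨1 - u, by simpa using hu.symm, by simp⟩

theorem IsArc.image {Y : Type*} [MetricSpace Y] {f : X → Y} (h : IsArc A a b) (hc : ContinuousOn f A) (hi : InjOn f A) :
    IsArc (f '' A) (f a) (f b) := by
  obtain ⟨γ, h1, hi', rfl, rfl, rfl⟩ := h
  rw [image_image]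
  exact isArc_of_interval zero_lt_one (ψ := fun u => f (γ u)) (hc.comp h1.continuousOn (mapsTo_image _ _))
    (fun u hu v hv huv => hi' hu hv (hi (mem_image_of_mem _ hu) (mem_image_of_mem _ hv) huv))

/-- splitting at an interior point -/
theorem IsArc.split (h : IsArc A a b) (hc : c ∈ A) (hca : c ≠ a) (hcb : c ≠ b) :
    ∃ A1 A2, IsArc A1 a c ∧ IsArc A2 c b ∧ A1 ∪ A2 = A ∧ A1 ∩ A2 = {c} := by
  obtain ⟨γ, h1, hi, rfl, rfl, rfl⟩ := h
  obtain ⟨t, ht, rfl⟩ := hc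
  have ht0 : 0 < t := lt_of_le_of_ne ht.1 (by rintro rfl; exact hca rfl)
  have ht1 : t < 1 := lt_of_le_of_ne ht.2 (by rintro rfl; exact hcb rfl)
  have s1 : Icc 0 t ⊆ Icc (0 : ℝ) 1 := Icc_subset_Icc_right ht.2
  have s2 : Icc t 1 ⊆ Icc (0 : ℝ) 1 := Icc_subset_Icc_left ht.1
  refine ⟨γ '' Icc 0 t, γ '' Icc t 1, isArc_of_interval ht0 h1.continuousOn (hi.mono s1),
    isArc_of_interval ht1 h1.continuousOn (hi.mono s2), ?_, ?_⟩
  · rw [← image_union, Icc_union_Icc_eq_Icc ht.1 ht.2]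
  · rw [← hi.image_inter s1 s2, Icc_inter_Icc_eq_singleton ht.1 ht.2, image_singleton]

theorem IsArc.concat {A1 A2 : Set X} (h1 : IsArc A1 a c) (h2 : IsArc A2 c b) (h : A1 ∩ A2 ⊆ {c}) : IsArc (A1 ∪ A2) a b := by
  obtain ⟨γ, hγ, hi, rfl, hc, rfl⟩ := h1
  obtain ⟨δ, hδ, hj, hc', rfl, rfl⟩ := h2
  set ψ : ℝ → X := fun u => if u ≤ 1 then γ u else δ (u - 1) with hψ
  have e1 : EqOn ψ γ (Icc 0 1) := fun u hu => if_pos hu.2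
  have e2 : EqOn ψ (fun u => δ (u - 1)) (Icc 1 2) := by
    intro u hu
    rcases eq_or_lt_of_le hu.1 with rfl | h'
    · simp [hψ, hc, hc']
    · exact if_neg (not_le.2 h')
  have i2 : ψ '' Icc 1 2 = δ '' Icc 0 1 := by
    rw [e2.image_eq]
    have : (fun u : ℝ => u - 1) '' Icc 1 2 = Icc 0 1 := by rw [image_sub_const_Icc]; norm_num
    rw [← this, image_image]
  have i1 : ψ '' Icc 0 1 = γ '' Icc 0 1 := e1.image_eq
  have hu : ψ '' Icc 0 2 = γ '' Icc 0 1 ∪ δ '' Icc 0 1 := by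
    rw [← i1, ← i2, ← image_union, Icc_union_Icc_eq_Icc (by norm_num) (by norm_num)]
  have hcont : Continuous ψ := by
    apply Continuous.if_le hγ (by fun_prop) continuous_id continuous_const
    rintro x rfl; simp [hc, hc']
  have key : ∀ u ∈ Icc (0:ℝ) 1, ∀ v ∈ Icc (1:ℝ) 2, ψ u = ψ v → u = v := by
    intro u hu v hv huv
    have m1 : ψ u ∈ γ '' Icc 0 1 := i1 ▸ mem_image_of_mem _ hu
    have m2 : ψ u ∈ δ '' Icc 0 1 := by rw [huv, ← i2]; exact mem_image_of_mem _ hv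
    have m3 : ψ u = c := h ⟨m1, m2⟩
    have q1 : u = 1 := hi hu (by simp) (by rw [← e1 hu, m3, hc])
    have q2 : v - 1 = 0 := hj ⟨by linarith [hv.1], by linarith [hv.2]⟩ (by simp) (by rw [hc', ← m3, huv, e2 hv])
    linarith
  have hinj : InjOn ψ (Icc 0 2) := by
    intro u hu v hv huv
    rcases le_total u 1 with h3 | h3 <;> rcases le_total v 1 with h4 | h4
    · exact hi ⟨hu.1, h3⟩ ⟨hv.1, h4⟩ (by rw [← e1 ⟨hu.1, h3⟩, ← e1 ⟨hv.1, h4⟩, huv])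
    · exact key u ⟨hu.1, h3⟩ v ⟨h4, hv.2⟩ huv
    · exact (key v ⟨hv.1, h4⟩ u ⟨h3, hu.2⟩ huv.symm).symm
    · have q1 : ψ u = δ (u - 1) := e2 ⟨h3, hu.2⟩
      have q2 : ψ v = δ (v - 1) := e2 ⟨h4, hv.2⟩
      have q3 : u - 1 ∈ Icc (0:ℝ) 1 := ⟨by linarith, by linarith [hu.2]⟩
      have q4 : v - 1 ∈ Icc (0:ℝ) 1 := ⟨by linarith, by linarith [hv.2]⟩
      have := hj q3 q4 (by rw [← q1, ← q2, huv])
      linarith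
  have := isArc_of_interval (by norm_num) hcont.continuousOn hinj
  rw [hu] at this
  convert this using 1
  · exact (e1 (by simp)).symm
  · have := e2 (x := 2) (by norm_num)
    rw [this]; norm_num

/-- homeomorphism between arcs -/
theorem IsArc.homeo {Y : Type*} [MetricSpace Y] {B : Set Y} {a' b' : Y} (hA : IsArc A a b) (hB : IsArc B a' b') :
    ∃ (h : X → Y), ContinuousOn h A ∧ InjOn h A ∧ h '' A = B ∧ h a = a' ∧ h b = b' := by
  obtain ⟨γ, hγ, hi, rfl, rfl, rfl⟩ := hA
  obtain ⟨δ, hδ, hj, rfl, rfl, rfl⟩ := hB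
  set g : X → ℝ := Function.invFunOn γ (Icc 0 1)
  have hg : LeftInvOn g γ (Icc 0 1) := hi.leftInvOn_invFunOn
  have hgc : ContinuousOn g (γ '' Icc 0 1) := by
    have he : IsEmbedding ((Icc (0:ℝ) 1).domRestrict γ) :=
      ((hγ.comp continuous_subtype_val).isClosedEmbedding (injOn_iff_injective.1 hi)).isEmbedding
    rw [continuousOn_iff_isClosed]
    intro t ht
    refine ⟨γ '' (Icc 0 1 ∩ t), ((isCompact_Icc.inter_right ht).image hγ).isClosed, ?_⟩
    ext x
    constructor
    · rintro ⟨hx, ⟨u, hu, rfl⟩⟩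
      rw [mem_preimage, hg hu] at hx
      exact ⟨⟨u, ⟨hu, hx⟩, rfl⟩, ⟨u, hu, rfl⟩⟩
    · rintro ⟨⟨u, ⟨hu, hx⟩, rfl⟩, _⟩
      refine ⟨?_, ⟨u, hu, rfl⟩⟩
      rw [mem_preimage, hg hu]
      exact hx
  refine ⟨fun x => δ (g x), hδ.comp_continuousOn hgc, ?_, ?_, ?_, ?_⟩
  · rintro _ ⟨u, hu, rfl⟩ _ ⟨v, hv, rfl⟩ huv
    simp only [hg hu, hg hv] at huv
    rw [hj hu hv huv]
  · rw [image_image]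
    exact image_congr fun u hu => by rw [hg hu]
  · simp only []; rw [hg (by simp)]
  · simp only []; rw [hg (by simp)]

/-- first hitting subarc -/
theorem IsArc.first (h : IsArc A a b) {K : Set X} (hK : IsClosed K) (ha : a ∉ K) (hm : (A ∩ K).Nonempty) :
    ∃ c A1, c ∈ K ∧ A1 ⊆ A ∧ IsArc A1 a c ∧ A1 ∩ K = {c} := by
  obtain ⟨γ, hγ, hi, rfl, rfl, rfl⟩ := h
  have hcomp : IsCompact (Icc (0:ℝ) 1 ∩ γ ⁻¹' K) := isCompact_Icc.inter_right (hK.preimage hγ)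
  have hne : (Icc (0:ℝ) 1 ∩ γ ⁻¹' K).Nonempty := by
    obtain ⟨_, ⟨u, hu, rfl⟩, hx⟩ := hm
    exact ⟨u, hu, hx⟩
  obtain ⟨t, ⟨ht, htK⟩, hmin⟩ := hcomp.exists_isLeast hne
  have ht0 : 0 < t := lt_of_le_of_ne ht.1 (by rintro rfl; exact ha htK)
  have s1 : Icc 0 t ⊆ Icc (0 : ℝ) 1 := Icc_subset_Icc_right ht.2
  refine ⟨γ t, γ '' Icc 0 t, htK, image_mono s1, isArc_of_interval ht0 hγ.continuousOn (hi.mono s1), ?_⟩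
  apply Subset.antisymm
  · rintro _ ⟨⟨u, hu, rfl⟩, hx⟩
    have := hmin ⟨s1 hu, hx⟩
    rw [le_antisymm hu.2 this]; rfl
  · rintro _ rfl
    exact ⟨mem_image_of_mem _ ⟨ht.1, le_rfl⟩, htK⟩

end arcs
end MooreSphere

namespace MooreSphere
open Set Filter Topology

section
variable {X : Type*} [MetricSpace X]

/-- a running infimum -/
theorem running_inf {f : ℝ → ℝ} (hf : Continuous f) : ∃ D : ℝ → ℝ, Continuous D ∧
    (∀ t, 0 ≤ t → ∃ u ∈ Icc 0 t, D t = f u) ∧ (∀ t, 0 ≤ t → ∀ u ∈ Icc 0 t, D t ≤ f u) := by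
  refine ⟨fun t => sInf ((fun s => f (s * t)) '' Icc 0 1), ?_, ?_, ?_⟩
  · exact isCompact_Icc.continuous_sInf (f := fun (t s : ℝ) => f (s * t)) (by fun_prop)
  · intro t ht
    obtain ⟨s, hs, h⟩ := (isCompact_Icc (a := (0:ℝ)) (b := 1)).exists_sInf_image_eq (by simp) (f := fun s => f (s * t)) (by fun_prop)
    exact ⟨s * t, ⟨mul_nonneg hs.1 ht, by nlinarith [hs.2]⟩, h⟩
  · intro t ht u hu
    apply csInf_le
    · exact (isCompact_Icc.image (by fun_prop)).bddBelow
    · rcases ht.eq_or_lt with rfl | ht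
      · have : u = 0 := le_antisymm hu.2 hu.1
        exact ⟨0, by simp, by simp [this]⟩
      · exact ⟨u / t, ⟨div_nonneg hu.1 ht.le, (div_le_one ht).2 hu.2⟩, by simp only []; rw [div_mul_cancel₀ _ ht.ne']⟩

theorem isArc_of_monotone_path [CompactSpace X] {γ : ℝ → X} (hγ : Continuous γ) (hne : γ 0 ≠ γ 1)
    (hm : ∀ u ∈ Icc (0:ℝ) 1, ∀ v ∈ Icc (0:ℝ) 1, ∀ w, u < w → w < v → γ u = γ v → γ w = γ u) :
    IsArc (γ '' Icc 0 1) (γ 0) (γ 1) := by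
  have : Nonempty X := ⟨γ 0⟩
  set x := TopologicalSpace.denseSeq X
  set f : ℕ → ℝ → ℝ := fun n u => min 1 (dist (x n) (γ u)) with hf
  have hfc : ∀ n, Continuous (f n) := fun n => by simp only [hf]; fun_prop
  choose D hDc hD1 hD2 using fun n => running_inf (hfc n)
  have hanti : ∀ n s t, 0 ≤ s → s ≤ t → D n t ≤ D n s := by
    intro n s t hs hst
    obtain ⟨u, hu, h⟩ := hD1 n s hs
    rw [h]
    exact hD2 n t (hs.trans hst) u ⟨hu.1, hu.2.trans hst⟩
  have hD0 : ∀ n t, 0 ≤ t → 0 ≤ D n t ∧ D n t ≤ 1 := by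
    intro n t ht
    obtain ⟨u, hu, h⟩ := hD1 n t ht
    rw [h]
    exact ⟨le_min zero_le_one dist_nonneg, min_le_left _ _⟩
  -- the parametrisation
  set g : ℝ → ℝ := fun t => ∑' n, (1 / 2 : ℝ) ^ n * (- D n t) with hg
  have hbound : ∀ n, ∀ t, 0 ≤ t → ‖(1 / 2 : ℝ) ^ n * (- D n t)‖ ≤ (1 / 2 : ℝ) ^ n := by
    intro n t ht
    rw [norm_mul, norm_neg, Real.norm_of_nonneg (by positivity), Real.norm_of_nonneg (hD0 n t ht).1]
    exact mul_le_of_le_one_right (by positivity) (hD0 n t ht).2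
  have hsum : ∀ t, 0 ≤ t → Summable fun n => (1 / 2 : ℝ) ^ n * (- D n t) := fun t ht =>
    Summable.of_norm_bounded summable_geometric_two (fun n => hbound n t ht)
  have hgc : ContinuousOn g (Icc 0 1) := by
    refine continuousOn_tsum (fun n => (by fun_prop)) summable_geometric_two (fun n t ht => hbound n t ht.1)
  have hmono : ∀ s t, 0 ≤ s → s ≤ t → g s ≤ g t := by
    intro s t hs hst
    refine (hsum s hs).tsum_le_tsum (fun n => ?_) (hsum t (hs.trans hst))
    have := hanti n s t hs hst
    gcongr
  have hlt : ∀ s t, 0 ≤ s → s ≤ t → t ≤ 1 → γ s ≠ γ t → g s < g t := by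
    intro s t hs hst ht1 hne
    have hK : IsCompact (γ '' Icc 0 s) := isCompact_Icc.image hγ
    have hnot : γ t ∉ γ '' Icc 0 s := by
      rintro ⟨r, hr, hrt⟩
      rcases hr.2.eq_or_lt with rfl | h1
      · exact hne hrt
      rcases hst.eq_or_lt with rfl | h2
      · exact hne rfl
      exact hne ((hm r ⟨hr.1, by linarith⟩ t ⟨by linarith, ht1⟩ s h1 h2 hrt).trans hrt)
    obtain ⟨ε, hε, hball⟩ := Metric.isOpen_iff.1 hK.isClosed.isOpen_compl _ hnot
    set η := min ε 1 with hη
    have hη0 : 0 < η := lt_min hε one_pos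
    obtain ⟨n, hn⟩ := (TopologicalSpace.denseRange_denseSeq X).exists_dist_lt (γ t) (half_pos hη0)
    have h1 : D n t < η / 2 := by
      refine (hD2 n t (hs.trans hst) t ⟨hs.trans hst, le_rfl⟩).trans_lt ?_
      refine (min_le_right _ _).trans_lt ?_
      rw [dist_comm]; exact hn
    have h2 : η / 2 ≤ D n s := by
      obtain ⟨u, hu, h⟩ := hD1 n s hs
      rw [h]
      refine le_min (by have := min_le_right ε 1; linarith) ?_
      by_contra! hcon
      have : γ u ∈ Metric.ball (γ t) ε := by
        rw [Metric.mem_ball]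
        have h3 := dist_triangle_left (γ u) (γ t) (x n)
        have hn' : dist (x n) (γ t) < η / 2 := by rw [dist_comm]; exact hn
        have := min_le_left ε 1
        linarith
      exact hball this (mem_image_of_mem _ hu)
    refine Summable.tsum_lt_tsum (i := n) (fun n => ?_) ?_ (hsum s hs) (hsum t (hs.trans hst))
    · have := hanti n s t hs hst
      gcongr
    · have : D n t < D n s := by linarith
      gcongr
  have heq : ∀ s t, 0 ≤ s → s ≤ t → t ≤ 1 → γ s = γ t → g s = g t := by
    intro s t hs hst ht1 he
    apply le_antisymm (hmono s t hs hst)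
    refine (hsum t (hs.trans hst)).tsum_le_tsum (fun n => ?_) (hsum s hs)
    have : D n s ≤ D n t := by
      obtain ⟨u, hu, h⟩ := hD1 n t (hs.trans hst)
      rw [h]
      rcases le_or_gt u s with h1 | h1
      · exact hD2 n s hs u ⟨hu.1, h1⟩
      · have : γ u = γ s := by
          rcases hu.2.eq_or_lt with rfl | h2
          · exact he.symm
          · exact hm s ⟨hs, by linarith⟩ t ⟨by linarith, ht1⟩ u h1 h2 he
        have h3 : f n u = f n s := by simp only [hf, this]
        rw [h3]
        exact hD2 n s hs s ⟨hs, le_rfl⟩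
    gcongr
  have hiff : ∀ s ∈ Icc (0:ℝ) 1, ∀ t ∈ Icc (0:ℝ) 1, g s = g t ↔ γ s = γ t := by
    intro s hs t ht
    rcases le_total s t with h | h
    · exact ⟨fun e => by_contra fun e' => (hlt s t hs.1 h ht.2 e').ne e, heq s t hs.1 h ht.2⟩
    · exact ⟨fun e => by_contra fun e' => (hlt t s ht.1 h hs.2 (Ne.symm e')).ne e.symm, fun e => (heq t s ht.1 h hs.2 e.symm).symm⟩
  have hg01 : g 0 < g 1 := hlt 0 1 le_rfl zero_le_one le_rfl hne
  have himg : g '' Icc 0 1 = Icc (g 0) (g 1) := by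
    apply Subset.antisymm
    · rintro _ ⟨t, ht, rfl⟩
      exact ⟨hmono 0 t le_rfl ht.1, hmono t 1 ht.1 ht.2⟩
    · exact intermediate_value_Icc zero_le_one hgc
  set τ : ℝ → ℝ := Function.invFunOn g (Icc 0 1)
  have hτ : ∀ t ∈ Icc (0:ℝ) 1, γ (τ (g t)) = γ t := by
    intro t ht
    have h1 : τ (g t) ∈ Icc (0:ℝ) 1 := Function.invFunOn_mem ⟨t, ht, rfl⟩
    have h2 : g (τ (g t)) = g t := Function.invFunOn_eq ⟨t, ht, rfl⟩
    exact (hiff _ h1 t ht).1 h2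
  have hc : ContinuousOn (fun y => γ (τ y)) (Icc (g 0) (g 1)) := by
    rw [← himg, continuousOn_iff_isClosed]
    intro C hC
    refine ⟨g '' (Icc 0 1 ∩ γ ⁻¹' C), ((isCompact_Icc.inter_right (hC.preimage hγ)).image_of_continuousOn (hgc.mono inter_subset_left)).isClosed, ?_⟩
    ext y
    constructor
    · rintro ⟨hx, ⟨u, hu, rfl⟩⟩
      simp only [mem_preimage] at hx
      rw [hτ u hu] at hx
      exact ⟨⟨u, ⟨hu, hx⟩, rfl⟩, ⟨u, hu, rfl⟩⟩
    · rintro ⟨⟨u, ⟨hu, hx⟩, rfl⟩, _⟩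
      refine ⟨?_, ⟨u, hu, rfl⟩⟩
      simp only [mem_preimage]
      rw [hτ u hu]
      exact hx
  have hinj : InjOn (fun y => γ (τ y)) (Icc (g 0) (g 1)) := by
    rw [← himg]
    rintro _ ⟨u, hu, rfl⟩ _ ⟨v, hv, rfl⟩ huv
    simp only [hτ u hu, hτ v hv] at huv
    exact (hiff u hu v hv).2 huv
  have := isArc_of_interval hg01 hc hinj
  simp only [hτ 0 (by simp), hτ 1 (by simp)] at this
  convert this using 1
  rw [← himg, image_image]
  exact (image_congr fun u hu => hτ u hu).symm

/-- closed parameter sets on whose gaps the path takes the same value at both ends -/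
def GapSet (γ : ℝ → X) (C : Set ℝ) : Prop :=
  IsClosed C ∧ C ⊆ Icc 0 1 ∧ 0 ∈ C ∧ 1 ∈ C ∧ ∀ s ∈ C, ∀ t ∈ C, s < t → Disjoint C (Ioo s t) → γ s = γ t

theorem GapSet.exists_le {γ : ℝ → X} {C : Set ℝ} (h : GapSet γ C) {x : ℝ} (hx : 0 ≤ x) :
    ∃ p ∈ C, p ≤ x ∧ ∀ q ∈ C, q ≤ x → q ≤ p := by
  obtain ⟨p, hp, hmax⟩ := ((isCompact_Icc.of_isClosed_subset h.1 h.2.1).inter_right (isClosed_Iic (a := x))).exists_isGreatest ⟨0, h.2.2.1, hx⟩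
  exact ⟨p, hp.1, hp.2, fun q hq hqx => hmax ⟨hq, hqx⟩⟩

theorem GapSet.exists_ge {γ : ℝ → X} {C : Set ℝ} (h : GapSet γ C) {x : ℝ} (hx : x ≤ 1) :
    ∃ p ∈ C, x ≤ p ∧ ∀ q ∈ C, x ≤ q → p ≤ q := by
  obtain ⟨p, hp, hmax⟩ := ((isCompact_Icc.of_isClosed_subset h.1 h.2.1).inter_right (isClosed_Ici (a := x))).exists_isLeast ⟨1, h.2.2.2.1, hx⟩
  exact ⟨p, hp.1, hp.2, fun q hq hqx => hmax ⟨hq, hqx⟩⟩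

theorem exists_minimal_gapSet {γ : ℝ → X} (hγ : Continuous γ) : ∃ C, Minimal (GapSet γ) C := by
  have h0 : GapSet γ (Icc 0 1) := by
    refine ⟨isClosed_Icc, subset_rfl, by simp, by simp, fun s hs t ht hst hd => ?_⟩
    exact (disjoint_left.1 hd (show (s + t) / 2 ∈ Icc (0:ℝ) 1 from ⟨by linarith [hs.1, ht.1], by linarith [hs.2, ht.2]⟩) ⟨by linarith, by linarith⟩).elim
  obtain ⟨C, -, hC⟩ := zorn_superset_nonempty {C | GapSet γ C} (fun c hc hchain hne => by
    refine ⟨⋂₀ c, ⟨isClosed_sInter fun s hs => (hc hs).1, ?_, ?_, ?_, ?_⟩, fun s hs => sInter_subset_of_mem hs⟩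
    · obtain ⟨s, hs⟩ := hne
      exact (sInter_subset_of_mem hs).trans (hc hs).2.1
    · exact fun s hs => (hc hs).2.2.1
    · exact fun s hs => (hc hs).2.2.2.1
    · intro s hs t ht hst hd
      by_contra hcon
      -- continuity
      have hpos : 0 < dist (γ s) (γ t) := dist_pos.2 hcon
      obtain ⟨δ1, hδ1, h1⟩ := Metric.continuousAt_iff.1 (hγ.continuousAt (x := s)) _ (half_pos hpos)
      obtain ⟨δ2, hδ2, h2⟩ := Metric.continuousAt_iff.1 (hγ.continuousAt (x := t)) _ (half_pos hpos)
      set e := min (min δ1 δ2) (t - s) / 3 with he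
      have he0 : 0 < e := by have : 0 < t - s := sub_pos.2 hst
                             positivity
      have he1 : e < δ1 := by
        have : min (min δ1 δ2) (t - s) ≤ δ1 := (min_le_left _ _).trans (min_le_left _ _)
        linarith
      have he2 : e < δ2 := by
        have : min (min δ1 δ2) (t - s) ≤ δ2 := (min_le_left _ _).trans (min_le_right _ _)
        linarith
      have he3 : 3 * e ≤ t - s := by
        have : min (min δ1 δ2) (t - s) ≤ t - s := (min_le_right _ _)
        linarith
      have hne' : c.Nonempty := hne
      obtain ⟨C, hCc, hCd⟩ : ∃ C ∈ c, Disjoint C (Icc (s + e) (t - e)) := by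
        by_contra! hall
        have : (⋂ C : c, (C : Set ℝ) ∩ Icc (s + e) (t - e)).Nonempty := by
          have : Nonempty c := hne.to_subtype
          refine IsCompact.nonempty_iInter_of_directed_nonempty_isCompact_isClosed _ ?_ (fun C => ?_) (fun C => ?_) (fun C => ?_)
          · intro C D
            rcases hchain.total C.2 D.2 with h | h
            · exact ⟨C, subset_rfl, inter_subset_inter_left _ h⟩
            · exact ⟨D, inter_subset_inter_left _ h, subset_rfl⟩
          · exact not_disjoint_iff_nonempty_inter.1 (hall C C.2)
          · exact isCompact_Icc.inter_left (hc C.2).1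
          · exact (hc C.2).1.inter isClosed_Icc
        obtain ⟨z, hz⟩ := this
        rw [mem_iInter] at hz
        obtain ⟨C0, hC0⟩ := hne'
        have hz1 := (hz ⟨C0, hC0⟩).2
        exact disjoint_left.1 hd (fun C hC => (hz ⟨C, hC⟩).1) ⟨by linarith [hz1.1], by linarith [hz1.2]⟩
      have hG := hc hCc
      have hs' := hs C hCc
      have ht' := ht C hCc
      obtain ⟨p, hpC, hp1, hp2⟩ := GapSet.exists_le hG (x := s + e) (by linarith [(hG.2.1 hs').1])
      obtain ⟨q, hqC, hq1, hq2⟩ := GapSet.exists_ge hG (x := t - e) (by linarith [(hG.2.1 ht').2])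
      have hps : s ≤ p := hp2 s hs' (by linarith)
      have hqt : q ≤ t := hq2 t ht' (by linarith)
      have hpq : γ p = γ q := by
        refine hG.2.2.2.2 p hpC q hqC (by linarith) ?_
        rw [disjoint_left]
        intro z hz hz'
        rcases le_or_gt z (s + e) with h | h
        · exact absurd (hp2 z hz h) (not_le.2 hz'.1)
        rcases le_or_gt (t - e) z with h' | h'
        · exact absurd (hq2 z hz h') (not_le.2 hz'.2)
        exact disjoint_left.1 hCd hz ⟨h.le, h'.le⟩
      have k1 := h1 (x := p) (by rw [Real.dist_eq, abs_of_nonneg (by linarith)]; linarith)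
      have k2 := h2 (x := q) (by rw [Real.dist_eq, abs_of_nonpos (by linarith)]; linarith)
      have := dist_triangle_left (γ s) (γ t) (γ p)
      rw [← hpq] at k2
      linarith) _ h0
  exact ⟨C, hC⟩

/-- every path between distinct points contains an arc -/
theorem exists_arc_of_path [CompactSpace X] {γ : ℝ → X} (hγ : Continuous γ) (hne : γ 0 ≠ γ 1) :
    ∃ A ⊆ γ '' Icc 0 1, IsArc A (γ 0) (γ 1) := by
  obtain ⟨C, hC, hmin⟩ := exists_minimal_gapSet hγ
  have hCsub := hC.2.1
  have key : ∀ u ∈ C, ∀ v ∈ C, u < v → γ u = γ v → Disjoint C (Ioo u v) := by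
    intro u hu v hv huv he
    have h1 : GapSet γ (C \ Ioo u v) := by
      refine ⟨hC.1.inter isOpen_Ioo.isClosed_compl, sdiff_subset.trans hCsub, ⟨hC.2.2.1, fun h => ?_⟩, ⟨hC.2.2.2.1, fun h => ?_⟩, ?_⟩
      · exact absurd (hCsub hu).1 (not_le.2 h.1)
      · exact absurd (hCsub hv).2 (not_le.2 h.2)
      · rintro s ⟨hs, hs'⟩ t ⟨ht, ht'⟩ hst hd
        have hdu : u ∉ Ioo s t := disjoint_left.1 hd ⟨hu, fun h => lt_irrefl _ h.1⟩
        have hdv : v ∉ Ioo s t := disjoint_left.1 hd ⟨hv, fun h => lt_irrefl _ h.2⟩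
        by_cases hcase : Disjoint (Ioo s t) (Ioo u v)
        · refine hC.2.2.2.2 s hs t ht hst ?_
          rw [disjoint_left] at hd hcase ⊢
          exact fun z hz hz' => hd ⟨hz, fun hz'' => hcase hz' hz''⟩ hz'
        · obtain ⟨z, hz1, hz2⟩ := not_disjoint_iff.1 hcase
          have e1 : s = u := by
            apply le_antisymm
            · by_contra! h; exact hs' ⟨h, hz1.1.trans hz2.2⟩
            · by_contra! h; exact hdu ⟨h, hz2.1.trans hz1.2⟩
          have e2 : t = v := by
            apply le_antisymm
            · by_contra! h; exact hdv ⟨hz1.1.trans hz2.2, h⟩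
            · by_contra! h; exact ht' ⟨hz2.1.trans hz1.2, h⟩
          rw [e1, e2, he]
    have h2 := hmin h1 sdiff_subset
    rw [disjoint_left]
    exact fun z hz hz' => (h2 hz).2 hz'
  -- the collapsed path
  set c : ℝ → ℝ := fun x => max 0 (min 1 x) with hcdef
  have hc0 : ∀ x, c x ∈ Icc (0:ℝ) 1 := fun x => ⟨le_max_left _ _, max_le zero_le_one (min_le_left _ _)⟩
  have hcid : ∀ x ∈ Icc (0:ℝ) 1, c x = x := fun x hx => by simp only [hcdef]; rw [min_eq_right hx.2, max_eq_right hx.1]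
  choose p hpC hpx hpmax using fun x => hC.exists_le (hc0 x).1
  have hpC' : ∀ x ∈ C, p x = x := fun x hx => by
    have e := hcid x (hCsub hx)
    exact le_antisymm ((hpx x).trans e.le) (hpmax x x hx e.ge)
  have hlip : ∀ x y, x ≤ y → ∃ q z, γ (p x) = γ q ∧ γ (p y) = γ z ∧ q ≤ z ∧ z ≤ q + (y - x) ∧ q ∈ Icc (0:ℝ) 1 ∧ z ∈ Icc (0:ℝ) 1 := by
    intro x y hxy
    have hcxy : c x ≤ c y := max_le_max le_rfl (min_le_min le_rfl hxy)
    have hcd : c y - c x ≤ y - x := by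
      simp only [hcdef]
      rcases le_total 1 x with h1 | h1 <;> rcases le_total 1 y with h2 | h2 <;> rcases le_total 0 x with h3 | h3 <;> rcases le_total 0 y with h4 | h4 <;>
        simp [h1, h2, h3, h4] <;> linarith
    rcases le_or_gt (p y) (c x) with h | h
    · have : p y = p x := le_antisymm (hpmax x _ (hpC y) h) (hpmax y _ (hpC x) ((hpx x).trans hcxy))
      exact ⟨p x, p x, rfl, by rw [this], le_rfl, by linarith, hCsub (hpC x), hCsub (hpC x)⟩
    · obtain ⟨q, hqC, hq1, hq2⟩ := hC.exists_ge (hc0 x).2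
      refine ⟨q, p y, ?_, rfl, hq2 _ (hpC y) h.le, by linarith [hpx y], hCsub hqC, hCsub (hpC y)⟩
      rcases eq_or_lt_of_le ((hpx x).trans hq1) with e | hlt
      · rw [e]
      · refine hC.2.2.2.2 _ (hpC x) _ hqC hlt ?_
        rw [disjoint_left]
        intro z hz hz'
        rcases le_total z (c x) with h' | h'
        · exact absurd (hpmax x z hz h') (not_le.2 hz'.1)
        · exact absurd (hq2 z hz h') (not_le.2 hz'.2)
  have hcont : Continuous fun x => γ (p x) := by
    have huc := isCompact_Icc.uniformContinuousOn_of_continuous (hγ.continuousOn (s := Icc 0 1))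
    rw [Metric.uniformContinuousOn_iff] at huc
    rw [Metric.continuous_iff]
    intro x ε hε
    obtain ⟨δ, hδ, h⟩ := huc ε hε
    refine ⟨δ, hδ, fun y hy => ?_⟩
    rw [Real.dist_eq] at hy
    rcases le_total x y with hxy | hxy
    · obtain ⟨q, z, e1, e2, h1, h2, h3, h4⟩ := hlip x y hxy
      simp only [e1, e2]
      refine h z h4 q h3 ?_
      rw [abs_of_nonneg (by linarith)] at hy
      rw [Real.dist_eq, abs_of_nonneg (by linarith)]; linarith
    · obtain ⟨q, z, e1, e2, h1, h2, h3, h4⟩ := hlip y x hxy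
      simp only [e1, e2]
      refine h q h3 z h4 ?_
      rw [abs_of_nonpos (by linarith)] at hy
      rw [Real.dist_eq, abs_of_nonpos (by linarith)]; linarith
  have hp0 := hpC' 0 hC.2.2.1
  have hp1 := hpC' 1 hC.2.2.2.1
  have hpm : ∀ x y, x ≤ y → p x ≤ p y := fun x y hxy =>
    hpmax y _ (hpC x) ((hpx x).trans (max_le_max le_rfl (min_le_min le_rfl hxy)))
  have := isArc_of_monotone_path hcont (by rw [hp0, hp1]; exact hne) (by
    intro u hu v hv w huw hwv he
    rcases eq_or_lt_of_le (hpm u w huw.le) with h1 | h1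
    · rw [h1]
    rcases eq_or_lt_of_le (hpm w v hwv.le) with h2 | h2
    · rw [h2, he]
    exact (disjoint_left.1 (key _ (hpC u) _ (hpC v) (h1.trans h2) he) (hpC w) ⟨h1, h2⟩).elim)
  rw [hp0, hp1] at this
  refine ⟨_, ?_, this⟩
  rintro _ ⟨u, -, rfl⟩
  exact mem_image_of_mem _ (hCsub (hpC u))

theorem exists_arc_of_joinedIn [CompactSpace X] {F : Set X} {a b : X} (h : JoinedIn F a b) (hab : a ≠ b) :
    ∃ A ⊆ F, IsArc A a b := by
  obtain ⟨γ, hγ⟩ := h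
  have h0 : γ.extend 0 = a := by simp
  have h1 : γ.extend 1 = b := by simp
  obtain ⟨A, hA, hA'⟩ := exists_arc_of_path γ.continuous_extend (by rw [h0, h1]; exact hab)
  rw [h0, h1] at hA'
  refine ⟨A, hA.trans ?_, hA'⟩
  rintro _ ⟨u, hu, rfl⟩
  rw [γ.extend_apply hu]
  exact hγ _

theorem IsArc.joinedIn {A : Set X} {a b : X} (h : IsArc A a b) {c : X} (hc : c ∈ A) : JoinedIn A a c := by
  obtain ⟨γ, hγ, hi, rfl, rfl, rfl⟩ := h
  obtain ⟨t, ht, rfl⟩ := hc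
  have h := (convex_Icc (0:ℝ) 1).isPathConnected (by simp)
  exact (h.image hγ).joinedIn _ (mem_image_of_mem _ (by simp)) _ (mem_image_of_mem _ ht)

end
end MooreSphere

namespace MooreSphere
open Set Filter Topology

section scc
variable {X : Type*} [MetricSpace X] {J A B : Set X} {a b c : X}

/-- a closed curve presented as two arcs with common ends -/
def Pair (J A B : Set X) (a b : X) : Prop := IsArc A a b ∧ IsArc B a b ∧ A ∩ B = {a, b} ∧ A ∪ B = J

/-- simple closed curves -/
def Scc (J : Set X) : Prop := ∃ A B a b, Pair J A B a b

theorem Pair.swap (h : Pair J A B a b) : Pair J B A a b := ⟨h.2.1, h.1, by rw [inter_comm, h.2.2.1], by rw [union_comm, h.2.2.2]⟩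

theorem Pair.symm (h : Pair J A B a b) : Pair J A B b a := ⟨h.1.symm, h.2.1.symm, by rw [h.2.2.1, pair_comm], h.2.2.2⟩

theorem Pair.move_aux (h : Pair J A B a b) (hc : c ∈ A) (hcb : c ≠ b) : ∃ A' B', Pair J A' B' c b := by
  by_cases hca : c = a
  · subst hca; exact ⟨A, B, h⟩
  obtain ⟨hA, hB, hAB, hJ⟩ := h
  obtain ⟨A1, A2, h1, h2, h3, h4⟩ := hA.split hc hca hcb
  have hb1 : b ∉ A1 := fun hb => hcb ((h4.subset ⟨hb, h2.right_mem⟩ : b = c)).symm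
  have ha2 : a ∉ A2 := fun ha => hca ((h4.subset ⟨h1.left_mem, ha⟩ : a = c)).symm
  have h5 : A1 ∩ B ⊆ {a} := by
    rintro z ⟨hz, hz'⟩
    rcases hAB.subset ⟨h3 ▸ Or.inl hz, hz'⟩ with h | h
    · exact h
    · rw [mem_singleton_iff] at h; subst h; exact absurd hz hb1
  have hcB : c ∉ B := fun hcB => by
    rcases hAB.subset ⟨hc, hcB⟩ with h | h
    · exact hca h
    · exact hcb h
  refine ⟨A2, A1 ∪ B, h2, h1.symm.concat hB h5, ?_, ?_⟩
  · apply Subset.antisymm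
    · rintro z ⟨hz, hz' | hz'⟩
      · exact Or.inl (h4.subset ⟨hz', hz⟩)
      · rcases hAB.subset ⟨h3 ▸ Or.inr hz, hz'⟩ with h | h
        · rw [h] at hz; exact absurd hz ha2
        · exact Or.inr h
    · rintro z (rfl | rfl)
      · exact ⟨h2.left_mem, Or.inl h1.right_mem⟩
      · exact ⟨h2.right_mem, Or.inr hB.right_mem⟩
  · rw [← hJ, ← h3, ← union_assoc, union_comm A2]

theorem Pair.move (h : Pair J A B a b) (hc : c ∈ J) (hcb : c ≠ b) : ∃ A' B', Pair J A' B' c b := by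
  rcases h.2.2.2.symm.subset hc with h' | h'
  · exact h.move_aux h' hcb
  · exact h.swap.move_aux h' hcb

theorem Scc.pair (h : Scc J) (ha : a ∈ J) (hb : b ∈ J) (hab : a ≠ b) : ∃ A B, Pair J A B a b := by
  obtain ⟨A, B, p, q, h⟩ := h
  by_cases haq : a = q
  · subst haq
    obtain ⟨A, B, h⟩ := h.symm.symm.move hb hab.symm
    exact ⟨A, B, h.symm⟩
  · obtain ⟨A, B, h⟩ := h.move ha haq
    obtain ⟨A, B, h⟩ := h.symm.move hb hab.symm
    exact ⟨A, B, h.symm⟩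

theorem Scc.isCompact (h : Scc J) : IsCompact J := by
  obtain ⟨A, B, p, q, h⟩ := h
  rw [← h.2.2.2]; exact h.1.isCompact.union h.2.1.isCompact

theorem Scc.isClosed (h : Scc J) : IsClosed J := h.isCompact.isClosed

theorem Scc.isPreconnected (h : Scc J) : IsPreconnected J := by
  obtain ⟨A, B, p, q, h⟩ := h
  rw [← h.2.2.2]
  exact h.1.isPreconnected.union p h.1.left_mem h.2.1.left_mem h.2.1.isPreconnected

theorem Scc.exists_ne (h : Scc J) (p : X) : ∃ q ∈ J, q ≠ p := by
  obtain ⟨A, B, a, b, h⟩ := h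
  have ha : a ∈ J := h.2.2.2 ▸ Or.inl h.1.left_mem
  have hb : b ∈ J := h.2.2.2 ▸ Or.inl h.1.right_mem
  by_cases hap : a = p
  · exact ⟨b, hb, fun h' => h.1.ne (hap.trans h'.symm)⟩
  · exact ⟨a, ha, hap⟩

theorem Pair.image {Y : Type*} [MetricSpace Y] {f : X → Y} (h : Pair J A B a b) (hf : ContinuousOn f J) (hi : InjOn f J) :
    Pair (f '' J) (f '' A) (f '' B) (f a) (f b) := by
  obtain ⟨h1, h2, h3, rfl⟩ := h
  refine ⟨h1.image (hf.mono subset_union_left) (hi.mono subset_union_left),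
    h2.image (hf.mono subset_union_right) (hi.mono subset_union_right), ?_, ?_⟩
  · rw [← hi.image_inter subset_union_left subset_union_right, h3, image_pair]
  · rw [image_union]

theorem IsArc.exists_interior (h : IsArc A a b) : ∃ c ∈ A, c ≠ a ∧ c ≠ b := by
  obtain ⟨γ, hγ, hi, rfl, rfl, rfl⟩ := h
  refine ⟨γ (1/2), mem_image_of_mem _ (by norm_num), fun h => ?_, fun h => ?_⟩
  · have := hi (by norm_num) (by norm_num) h; norm_num at this
  · have := hi (by norm_num) (by norm_num) h; norm_num at this

/-- a small initial subarc -/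
theorem IsArc.small (h : IsArc A a b) {U : Set X} (hU : IsOpen U) (ha : a ∈ U) : ∃ c A1 A2,
    IsArc A1 a c ∧ IsArc A2 c b ∧ A1 ∪ A2 = A ∧ A1 ∩ A2 = {c} ∧ A1 ⊆ U := by
  obtain ⟨γ, hγ, hi, rfl, rfl, rfl⟩ := h
  obtain ⟨ε, hε, hball⟩ := Metric.isOpen_iff.1 (hU.preimage hγ) 0 ha
  set t := min (ε / 2) (1 / 2) with ht
  have h0 : 0 < t := by positivity
  have h1 : t < 1 := (min_le_right _ _).trans_lt (by norm_num)
  have h2 : t < ε := (min_le_left _ _).trans_lt (by linarith)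
  have s1 : Icc 0 t ⊆ Icc (0 : ℝ) 1 := Icc_subset_Icc_right h1.le
  have s2 : Icc t 1 ⊆ Icc (0 : ℝ) 1 := Icc_subset_Icc_left h0.le
  refine ⟨γ t, γ '' Icc 0 t, γ '' Icc t 1, isArc_of_interval h0 hγ.continuousOn (hi.mono s1),
    isArc_of_interval h1 hγ.continuousOn (hi.mono s2), ?_, ?_, ?_⟩
  · rw [← image_union, Icc_union_Icc_eq_Icc h0.le h1.le]
  · rw [← hi.image_inter s1 s2, Icc_inter_Icc_eq_singleton h0.le h1.le, image_singleton]
  · rintro _ ⟨u, hu, rfl⟩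
    apply hball
    rw [Metric.mem_ball, Real.dist_eq, sub_zero, abs_of_nonneg hu.1]
    exact hu.2.trans_lt h2

/-- a small subarc around a point of a closed curve -/
theorem Scc.small (h : Scc J) {p : X} (hp : p ∈ J) {U : Set X} (hU : IsOpen U) (hpU : p ∈ U) :
    ∃ M B a b, Pair J M B a b ∧ p ∈ M ∧ p ∉ B ∧ M ⊆ U := by
  obtain ⟨q, hq, hqp⟩ := h.exists_ne p
  obtain ⟨A, B, hA, hB, hAB, hJ⟩ := h.pair hp hq hqp.symm
  obtain ⟨a, A1, A2, ha1, ha2, ha3, ha4, ha5⟩ := hA.small hU hpU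
  obtain ⟨b, B1, B2, hb1, hb2, hb3, hb4, hb5⟩ := hB.small hU hpU
  have hpA2 : p ∉ A2 := fun h => ha1.ne (ha4.subset ⟨ha1.left_mem, h⟩)
  have hpB2 : p ∉ B2 := fun h => hb1.ne (hb4.subset ⟨hb1.left_mem, h⟩)
  have hqA1 : q ∉ A1 := fun h => ha2.ne.symm (ha4.subset ⟨h, ha2.right_mem⟩)
  have hqB1 : q ∉ B1 := fun h => hb2.ne.symm (hb4.subset ⟨h, hb2.right_mem⟩)
  have hsub : ∀ z, z ∈ A → z ∈ B → z = p ∨ z = q := fun z h1 h2 => hAB.subset ⟨h1, h2⟩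
  have iA1 : ∀ z ∈ A1, z ∈ A := fun z hz => ha3 ▸ Or.inl hz
  have iA2 : ∀ z ∈ A2, z ∈ A := fun z hz => ha3 ▸ Or.inr hz
  have iB1 : ∀ z ∈ B1, z ∈ B := fun z hz => hb3 ▸ Or.inl hz
  have iB2 : ∀ z ∈ B2, z ∈ B := fun z hz => hb3 ▸ Or.inr hz
  refine ⟨A1 ∪ B1, A2 ∪ B2, a, b, ⟨ha1.symm.concat hb1 ?_, ha2.concat hb2.symm ?_, ?_, ?_⟩, Or.inl ha1.left_mem, ?_, union_subset ha5 hb5⟩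
  · rintro z ⟨h1, h2⟩
    rcases hsub z (iA1 z h1) (iB1 z h2) with rfl | rfl
    · rfl
    · exact absurd h1 hqA1
  · rintro z ⟨h1, h2⟩
    rcases hsub z (iA2 z h1) (iB2 z h2) with rfl | rfl
    · exact absurd h1 hpA2
    · rfl
  · apply Subset.antisymm
    · rintro z ⟨h1 | h1, h2 | h2⟩
      · exact Or.inl (ha4.subset ⟨h1, h2⟩)
      · rcases hsub z (iA1 z h1) (iB2 z h2) with rfl | rfl
        · exact absurd h2 hpB2
        · exact absurd h1 hqA1
      · rcases hsub z (iA2 z h2) (iB1 z h1) with rfl | rfl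
        · exact absurd h2 hpA2
        · exact absurd h1 hqB1
      · exact Or.inr (hb4.subset ⟨h1, h2⟩)
    · rintro z (rfl | rfl)
      · exact ⟨Or.inl ha1.right_mem, Or.inl ha2.left_mem⟩
      · exact ⟨Or.inr hb1.right_mem, Or.inr hb2.left_mem⟩
  · rw [← hJ, ← ha3, ← hb3]; ext z; simp only [mem_union]; tauto
  · rintro (h | h)
    · exact hpA2 h
    · exact hpB2 h

theorem interval_glue (P : ℝ → ℝ → Prop)
    (hloc : ∀ t ∈ Icc (0:ℝ) 1, ∃ ε > 0, ∀ s s', t - ε < s → s ≤ s' → s' < t + ε → 0 ≤ s → s' ≤ 1 → P s s')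
    (hglue : ∀ s t u, 0 ≤ s → s ≤ t → t ≤ u → u ≤ 1 → P s t → P t u → P s u) : P 0 1 := by
  choose! ε hε hP using hloc
  obtain ⟨δ, hδ, hleb⟩ := lebesgue_number_lemma_of_metric (s := Icc (0:ℝ) 1) (c := fun t : Icc (0:ℝ) 1 => Metric.ball (t : ℝ) (ε t))
    isCompact_Icc (fun _ => Metric.isOpen_ball) (fun t ht => mem_iUnion.2 ⟨⟨t, ht⟩, Metric.mem_ball_self (hε t ht)⟩)
  have hsmall : ∀ s s', 0 ≤ s → s ≤ s' → s' ≤ 1 → s' < s + δ → P s s' := by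
    intro s s' h0 h1 h2 h3
    obtain ⟨⟨t, ht⟩, hb⟩ := hleb s ⟨h0, h1.trans h2⟩
    have k1 := hb (Metric.mem_ball_self hδ)
    have k2 := hb (show s' ∈ Metric.ball s δ by rw [Metric.mem_ball, Real.dist_eq, abs_of_nonneg (by linarith)]; linarith)
    rw [Metric.mem_ball, Real.dist_eq, abs_lt] at k1 k2
    exact hP t ht s s' (by linarith) h1 (by linarith) h0 h2
  obtain ⟨n, hn⟩ := exists_nat_one_div_lt hδ
  have hn0 : (0:ℝ) < n + 1 := by positivity
  have key : ∀ k : ℕ, k ≤ n + 1 → P 0 (k / (n + 1)) := by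
    intro k
    induction k with
    | zero => intro _; simpa using hsmall 0 0 le_rfl le_rfl zero_le_one (by linarith)
    | succ k ih =>
      intro hk
      have e : ((k + 1 : ℕ) : ℝ) / (n + 1) = k / (n + 1) + 1 / (n + 1) := by push_cast; ring
      have p1 : (0:ℝ) < 1 / (n + 1) := by positivity
      have h1 : ((k + 1 : ℕ) : ℝ) / (n + 1) ≤ 1 := by
        rw [div_le_one hn0]; exact_mod_cast hk
      refine hglue 0 _ _ le_rfl (by positivity) (by rw [e]; linarith) h1 (ih (by omega)) (hsmall _ _ (by positivity) (by rw [e]; linarith) h1 (by rw [e]; linarith))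
  have := key (n + 1) le_rfl
  rwa [Nat.cast_add, Nat.cast_one, div_self hn0.ne'] at this

end scc

section basic
variable {X : Type*} [TopologicalSpace X]

theorem subset_of_frontier {S F : Set X} (hS : IsPreconnected S) (hF : IsOpen F) (hd : ∀ x ∈ S, x ∉ frontier F) {x : X} (hx : x ∈ S) (hxF : x ∈ F) :
    S ⊆ F := by
  refine hS.subset_of_closure_inter_subset hF ⟨x, hx, hxF⟩ ?_
  rintro y ⟨hy, hyS⟩
  by_contra h
  exact hd y hyS (by rw [hF.frontier_eq]; exact ⟨hy, h⟩)

theorem conn_joinedIn [LocallyPathConnectedSpace X] {U : Set X} (hU : IsOpen U) {x y : X} (h : Conn U x y) : JoinedIn U x y := by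
  have h1 : IsPathConnected (face U x) :=
    ((isOpen_face hU).isConnected_iff_isPathConnected).1 ⟨⟨x, self_mem_face h.mem_left⟩, isPreconnected_face⟩
  exact (h1.joinedIn x (self_mem_face h.mem_left) y h).mono face_subset

theorem JoinedIn.conn {U : Set X} {x y : X} (h : JoinedIn U x y) : Conn U x y := by
  obtain ⟨γ, hγ⟩ := h
  exact ⟨range γ, range_subset_iff.2 hγ, isPreconnected_range γ.continuous, ⟨0, by simp⟩, ⟨1, by simp⟩⟩

theorem conn_compact [LocallyPathConnectedSpace X] {U : Set X} (hU : IsOpen U) {x y : X} (h : Conn U x y) :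
    ∃ S ⊆ U, IsCompact S ∧ IsPreconnected S ∧ x ∈ S ∧ y ∈ S := by
  obtain ⟨γ, hγ⟩ := conn_joinedIn hU h
  exact ⟨range γ, range_subset_iff.2 hγ, isCompact_range γ.continuous, isPreconnected_range γ.continuous, ⟨0, by simp⟩, ⟨1, by simp⟩⟩

theorem conn_of_subset_closure {S U : Set X} (hS : IsPreconnected S) {T : Set X} (hST : S ⊆ T) (hT : T ⊆ closure S) (hTU : T ⊆ U) {x y : X} (hx : x ∈ T)
    (hy : y ∈ T) : Conn U x y := ⟨T, hTU, hS.subset_closure hST hT, hx, hy⟩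

end basic

section jan
variable {X : Type} [MetricSpace X] [Jan X] {J A B K : Set X} {a b c p x y : X}

/-- arcs do not separate -/
theorem IsArc.conn_compl (h : IsArc A a b) (hx : x ∉ A) (hy : y ∉ A) : Conn Aᶜ x y := by
  obtain ⟨γ, hγ, hi, rfl, rfl, rfl⟩ := h
  refine interval_glue (fun s t => Conn (γ '' Icc s t)ᶜ x y) ?_ ?_
  · intro t ht
    obtain ⟨S, h1, h2, h3, h4, h5⟩ := conn_compact isOpen_compl_singleton (Jan.pt (γ t) x y (fun h => hx (h ▸ mem_image_of_mem _ ht)) (fun h => hy (h ▸ mem_image_of_mem _ ht)))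
    obtain ⟨ε, hε, hb⟩ := Metric.isOpen_iff.1 (h2.isClosed.isOpen_compl.preimage hγ) t (fun h => h1 h rfl)
    refine ⟨ε, hε, fun s s' k1 k2 k3 k4 k5 => ⟨S, ?_, h3, h4, h5⟩⟩
    rintro _ hz ⟨u, hu, rfl⟩
    refine hb ?_ hz
    rw [Metric.mem_ball, Real.dist_eq, abs_lt]
    exact ⟨by linarith [hu.1], by linarith [hu.2]⟩
  · intro s t u h0 h1 h2 h3 k1 k2
    have := Jan.j1 _ _ (isCompact_Icc.image hγ).isClosed (isCompact_Icc.image hγ).isClosed (by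
      rw [← hi.image_inter (Icc_subset_Icc h0 (h2.trans h3)) (Icc_subset_Icc (h0.trans h1) h3), Icc_inter_Icc_eq_singleton h1 h2, image_singleton]
      exact isPreconnected_singleton) x y k1 k2
    rwa [← image_union, Icc_union_Icc_eq_Icc h1 h2] at this

theorem isPreconnected_diff_singleton {V : Set X} (hV : IsOpen V) (hVc : IsPreconnected V) (p : X) : IsPreconnected (V \ {p}) := by
  apply isPreconnected_of_conn
  rintro x ⟨hx, hxp⟩ y ⟨hy, hyp⟩
  by_cases hp : p ∈ V
  · have := Jan.j1 Vᶜ {p} hV.isClosed_compl isClosed_singleton (by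
      rw [show Vᶜ ∩ {p} = ∅ by ext z; simp only [mem_inter_iff, mem_compl_iff, mem_singleton_iff, mem_empty_iff_false, iff_false]; rintro ⟨h, rfl⟩; exact h hp]
      exact isPreconnected_empty) x y (by rw [compl_compl]; exact hVc.conn hx hy) (Jan.pt p x y hxp hyp)
    rwa [compl_union, compl_compl] at this
  · rw [sdiff_singleton_eq_self hp]; exact hVc.conn hx hy

theorem not_isOpen_singleton (p : X) : ¬ IsOpen ({p} : Set X) := by
  intro h
  have := Jan.nontriv (X := X)
  obtain ⟨q, hq⟩ := _root_.exists_ne p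
  obtain ⟨S, -, hS, h1, h2⟩ := Jan.conn p q
  obtain ⟨z, hz, hz', hz''⟩ := hS {p} {p}ᶜ h isOpen_compl_singleton (by simp) ⟨p, h1, rfl⟩ ⟨q, h2, hq⟩
  exact hz'' hz'

theorem IsArc.interior_eq (h : IsArc A a b) : interior A = ∅ := by
  by_contra hne
  obtain ⟨v, hv⟩ := nonempty_iff_ne_empty.2 hne
  set V := face (interior A) v
  have hVo : IsOpen V := isOpen_face isOpen_interior
  have hVA : V ⊆ A := face_subset.trans interior_subset
  have hvV : v ∈ V := self_mem_face hv
  obtain ⟨w, hw, hwv⟩ : ∃ w ∈ V, w ≠ v := by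
    by_contra! hcon
    exact not_isOpen_singleton v ((Subset.antisymm (fun z hz => hcon z hz) (singleton_subset_iff.2 hvV) : V = {v}) ▸ hVo)
  obtain ⟨γ, hγ, hi, rfl, rfl, rfl⟩ := h
  have key : ∀ s ∈ Icc (0:ℝ) 1, ∀ t ∈ Icc (0:ℝ) 1, s < t → γ s ∈ V → γ t ∈ V → False := by
    intro s hs t ht hst hsV htV
    set r := (s + t) / 2
    have hsr : s < r := by simp only [r]; linarith
    have hrt : r < t := by simp only [r]; linarith
    have hr : r ∈ Icc (0:ℝ) 1 := ⟨by linarith [hs.1], by linarith [ht.2]⟩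
    obtain ⟨z, hz, ⟨u, hu, hu'⟩, ⟨w, hw, hw'⟩⟩ := isPreconnected_closed_iff.1 (isPreconnected_diff_singleton hVo isPreconnected_face (γ r)) (γ '' Icc 0 r) (γ '' Icc r 1)
      (isCompact_Icc.image hγ).isClosed (isCompact_Icc.image hγ).isClosed (by
        rw [← image_union, Icc_union_Icc_eq_Icc hr.1 hr.2]
        exact sdiff_subset.trans hVA)
      ⟨γ s, ⟨hsV, fun h => hsr.ne (hi hs hr h)⟩, mem_image_of_mem _ ⟨hs.1, hsr.le⟩⟩
      ⟨γ t, ⟨htV, fun h => hrt.ne' (hi ht hr h)⟩, mem_image_of_mem _ ⟨hrt.le, ht.2⟩⟩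
    have e : u = w := hi ⟨hu.1, hu.2.trans hr.2⟩ ⟨hr.1.trans hw.1, hw.2⟩ (hu'.trans hw'.symm)
    have : u = r := le_antisymm hu.2 (e ▸ hw.1)
    exact hz.2 (by rw [← hu', this]; rfl)
  obtain ⟨s, hs, rfl⟩ := hVA hvV
  obtain ⟨t, ht, rfl⟩ := hVA hw
  rcases lt_trichotomy s t with h | h | h
  · exact key s hs t ht h hvV hw
  · exact hwv (h ▸ rfl)
  · exact key t ht s hs h hw hvV

end jan
end MooreSphere

namespace MooreSphere
open Set Filter Topology
section
variable {X : Type} [MetricSpace X] {J A B K L U : Set X} {a b c p x y w : X}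

/-- local nonseparation condition -/
def LN (K : Set X) (p : X) : Prop := ∀ U, IsOpen U → p ∈ U → ∃ B, IsClosed B ∧ IsPreconnected B ∧ B ⊆ K ∧ p ∉ B ∧ K \ B ⊆ U

theorem IsArc.ln (h : IsArc A a b) : LN A a := by
  intro U hU ha
  obtain ⟨c, A1, A2, h1, h2, h3, h4, h5⟩ := h.small hU ha
  refine ⟨A2, h2.isClosed, h2.isPreconnected, h3 ▸ subset_union_right, fun hm => ?_, ?_⟩
  · have : a ∈ A1 ∩ A2 := ⟨h1.left_mem, hm⟩
    rw [h4] at this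
    exact h1.ne this
  · rintro z ⟨hz, hz'⟩
    rw [← h3] at hz
    exact hz.elim (fun h => h5 h) (fun h => absurd h hz')

theorem Scc.ln (h : Scc J) (hp : p ∈ J) : LN J p := by
  intro U hU hpU
  obtain ⟨M, B, a, b, h1, h2, h3, h4⟩ := h.small hp hU hpU
  refine ⟨B, h1.2.1.isClosed, h1.2.1.isPreconnected, h1.2.2.2 ▸ subset_union_right, h3, ?_⟩
  rintro z ⟨hz, hz'⟩
  rw [← h1.2.2.2] at hz
  exact hz.elim (fun h => h4 h) (fun h => absurd h hz')

theorem LN.union (h : LN K p) (hL : IsClosed L) (hLp : IsPreconnected L) (hKL : (K ∩ L).Nonempty) (hp : p ∉ L) : LN (K ∪ L) p := by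
  intro U hU hpU
  obtain ⟨z, hzK, hzL⟩ := hKL
  obtain ⟨B, h1, h2, h3, h4, h5⟩ := h (U \ L) (hU.sdiff hL) ⟨hpU, hp⟩
  have hz : z ∈ B := by
    by_contra hz
    exact (h5 ⟨hzK, hz⟩).2 hzL
  refine ⟨B ∪ L, h1.union hL, h2.union z hz hzL hLp, union_subset_union_left _ h3, fun h => h.elim h4 hp, ?_⟩
  rintro y ⟨hy | hy, hy'⟩
  · exact (h5 ⟨hy, fun h => hy' (Or.inl h)⟩).1
  · exact absurd (Or.inr hy) hy'

theorem infinite_concat (w : ℕ → X) (S : ℕ → Set X) (T : Set X) (hS : ∀ n, JoinedIn (S n) (w n) (w (n+1))) (hST : ∀ n, S n ⊆ T)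
    (hp : ∀ U, IsOpen U → p ∈ U → ∃ N, ∀ n ≥ N, S n ⊆ U) : JoinedIn (insert p T) (w 0) p := by
  choose γ hγ using hS
  set F : ℝ → X := fun t => (γ ⌊t⌋₊).extend (t - ⌊t⌋₊) with hF
  have hFS : ∀ t, F t ∈ S ⌊t⌋₊ := by
    intro t
    simp only [hF]
    have : (γ ⌊t⌋₊).extend (t - ⌊t⌋₊) ∈ range (γ ⌊t⌋₊).extend := mem_range_self _
    rw [Path.extend_range] at this
    obtain ⟨s, hs⟩ := this
    rw [← hs]; exact hγ _ s
  have hFn : ∀ (t : ℝ) (n : ℕ), ⌊t⌋₊ = n → F t = (γ n).extend (t - n) := by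
    rintro t n rfl; rfl
  have hFe : ∀ (n:ℕ), ∀ t ∈ Icc (n:ℝ) (n+1), F t = (γ n).extend (t - n) := by
    intro n t ht
    rcases eq_or_lt_of_le ht.2 with h | h
    · have : ⌊t⌋₊ = n + 1 := by rw [h]; exact_mod_cast Nat.floor_natCast (n+1)
      rw [hFn t _ this, h]; push_cast; simp
    · have : ⌊t⌋₊ = n := (Nat.floor_eq_iff (le_trans (Nat.cast_nonneg n) ht.1)).2 ⟨ht.1, h⟩
      exact hFn t _ this
  have hFc : ∀ n:ℕ, ContinuousOn F (Iic (n:ℝ)) := by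
    intro n
    induction n with
    | zero =>
      refine (continuousOn_const (c := w 0)).congr ?_
      intro t ht
      have ht' : t ≤ 0 := by simpa using ht
      have : ⌊t⌋₊ = 0 := Nat.floor_of_nonpos ht'
      rw [hFn t _ this, Path.extend_of_le_zero]
      simpa using ht'
    | succ n ih =>
      have e : Iic ((n+1:ℕ):ℝ) = Iic (n:ℝ) ∪ Icc (n:ℝ) (n+1) := by
        rw [Iic_union_Icc_eq_Iic (by linarith)]; push_cast; rfl
      rw [e]
      refine ih.union_of_isClosed ?_ isClosed_Iic isClosed_Icc
      refine ContinuousOn.congr ?_ (hFe n)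
      exact ((γ n).continuous_extend.comp (by fun_prop)).continuousOn
  have hFC : Continuous F := by
    rw [continuous_iff_continuousAt]
    intro t
    obtain ⟨n, hn⟩ := exists_nat_gt t
    exact (hFc n).continuousAt (Iic_mem_nhds hn)
  set g : ℝ → X := fun s => if s < 1 then F (s / (1 - s)) else p with hg
  have hgc : ContinuousOn g (Icc 0 1) := by
    intro s hs
    rcases eq_or_lt_of_le hs.2 with h | h
    · subst h
      rw [ContinuousWithinAt]
      have : g 1 = p := by simp [hg]
      rw [this, tendsto_nhds]
      intro U hU hpU
      obtain ⟨N, hN⟩ := hp U hU hpU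
      have hnear : ∀ᶠ s : ℝ in 𝓝 1, (N:ℝ) * (1 - s) < s := by
        refine ContinuousAt.eventually_lt (by fun_prop) (by fun_prop) (by simp)
      refine (hnear.filter_mono nhdsWithin_le_nhds).mono fun s hs => ?_
      simp only [mem_preimage, hg]
      split_ifs with h1
      · refine hN _ ?_ (hFS _)
        apply Nat.le_floor
        rw [le_div_iff₀ (by linarith)]
        exact hs.le
      · exact hpU
    · apply ContinuousAt.continuousWithinAt
      have : ContinuousAt (fun s => F (s / (1 - s))) s := by
        apply hFC.continuousAt.comp
        exact ContinuousAt.div continuousAt_id (by fun_prop) (by linarith)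
      refine this.congr ?_
      filter_upwards [Iio_mem_nhds h] with u hu
      simp only [hg, if_pos (show u < 1 from hu)]
  refine JoinedIn.ofLine hgc ?_ (by simp [hg]) ?_
  · simp [hg, hF]
  · rintro _ ⟨s, hs, rfl⟩
    simp only [hg]
    split_ifs
    · exact Or.inr (hST _ (hFS _))
    · exact Or.inl rfl

variable [Jan X]

theorem LN.ulc (h : LN K p) (hK : IsClosed K) (hU : IsOpen U) (hpU : p ∈ U) : ∃ V, IsOpen V ∧ p ∈ V ∧ V ⊆ U ∧
    ∀ x ∈ V \ K, ∀ y ∈ V \ K, Conn Kᶜ x y → Conn (U \ K) x y := by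
  obtain ⟨B, h1, h2, h3, h4, h5⟩ := h U hU hpU
  have hN : IsClosed (Uᶜ ∪ B) := hU.isClosed_compl.union h1
  have hp : p ∈ (Uᶜ ∪ B)ᶜ := fun h => h.elim (fun h => h hpU) h4
  refine ⟨face (Uᶜ ∪ B)ᶜ p, isOpen_face hN.isOpen_compl, self_mem_face hp, fun z hz => ?_, ?_⟩
  · by_contra hzU
    exact face_subset hz (Or.inl hzU)
  · rintro x ⟨hx, hxK⟩ y ⟨hy, hyK⟩ hxy
    have := Jan.j1 (Uᶜ ∪ B) K hN hK (by
      have e : (Uᶜ ∪ B) ∩ K = B := by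
        ext z
        constructor
        · rintro ⟨hz | hz, hzK⟩
          · by_contra hzB
            exact hz (h5 ⟨hzK, hzB⟩)
          · exact hz
        · exact fun hz => ⟨Or.inr hz, h3 hz⟩
      rw [e]; exact h2) x y ((Conn.symm hx).trans hy) hxy
    refine this.mono fun z hz => ⟨?_, fun h => hz (Or.inr h)⟩
    by_contra hzU
    exact hz (Or.inl (Or.inl hzU))

theorem LN.accessible (h : LN K p) (hK : IsClosed K) (hp : p ∈ closure (face Kᶜ w)) (hw : w ∉ K) :
    JoinedIn (insert p (face Kᶜ w)) w p := by
  have hpos : ∀ n : ℕ, (0:ℝ) < 1 / ((n:ℝ) + 1) := fun n => by positivity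
  choose V hV using fun n : ℕ => h.ulc hK (Metric.isOpen_ball (x := p) (ε := 1 / ((n:ℝ) + 1))) (Metric.mem_ball_self (hpos n))
  have hfin : ∀ n, ∃ z, z ∈ face Kᶜ w ∧ ∀ m ≤ n, z ∈ V m := by
    intro n
    have ho : IsOpen (⋂ m ∈ Finset.range (n+1), V m) := isOpen_biInter_finset fun m _ => (hV m).1
    obtain ⟨z, hz, hz'⟩ := mem_closure_iff.1 hp _ ho (by simp only [mem_iInter]; exact fun m _ => (hV m).2.1)
    refine ⟨z, hz', fun m hm => ?_⟩
    simp only [mem_iInter] at hz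
    exact hz m (Finset.mem_range.2 (by omega))
  choose z hz hz' using hfin
  have hzK : ∀ n, z n ∉ K := fun n => face_subset (hz n)
  have hsub : ∀ n : ℕ, Conn (Metric.ball p (1 / ((n:ℝ) + 1)) \ K) (z n) (z (n+1)) := fun n =>
    (hV n).2.2.2 _ ⟨hz' n n le_rfl, hzK n⟩ _ ⟨hz' (n+1) n (by omega), hzK _⟩ ((Conn.symm (hz n)).trans (hz (n+1)))
  have hsub' : ∀ n : ℕ, Conn (Metric.ball p (1 / ((n:ℝ) + 1)) ∩ face Kᶜ w) (z n) (z (n+1)) := by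
    intro n
    obtain ⟨S, h1, h2, h3, h4⟩ := hsub n
    refine ⟨S, fun s hs => ⟨(h1 hs).1, ?_⟩, h2, h3, h4⟩
    exact Conn.trans (hz n) ⟨S, fun u hu => (h1 hu).2, h2, h3, hs⟩
  have hfo : IsOpen (face Kᶜ w) := isOpen_face hK.isOpen_compl
  have key := infinite_concat (p := p) z (fun n : ℕ => Metric.ball p (1 / ((n:ℝ) + 1)) ∩ face Kᶜ w) (face Kᶜ w)
    (fun n => conn_joinedIn (Metric.isOpen_ball.inter hfo) (hsub' n)) (fun n => inter_subset_right) (by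
      intro U hU hpU
      obtain ⟨ε, hε, hb⟩ := Metric.isOpen_iff.1 hU p hpU
      obtain ⟨N, hN⟩ := exists_nat_one_div_lt hε
      refine ⟨N, fun n hn => inter_subset_left.trans ((Metric.ball_subset_ball ?_).trans hb)⟩
      refine le_trans ?_ hN.le
      exact one_div_le_one_div_of_le (by positivity) (by exact_mod_cast Nat.succ_le_succ hn))
  refine JoinedIn.trans (y := z 0) ?_ key
  refine (conn_joinedIn hfo ?_).mono (subset_insert _ _)
  exact isPreconnected_face.conn (self_mem_face hw) (hz 0)

end
end MooreSphere

namespace MooreSphere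
open Set Filter Topology
section
variable {X : Type} [MetricSpace X] {J A B K L U F : Set X} {a b c p x y w u v : X}

/-- Jordan domain -/
def JDom (F : Set X) : Prop := IsOpen F ∧ IsPreconnected F ∧ F.Nonempty ∧ Scc (frontier F) ∧ (closure F)ᶜ.Nonempty

theorem JDom.isOpen (h : JDom F) : IsOpen F := h.1
theorem JDom.conn (h : JDom F) : IsPreconnected F := h.2.1
theorem JDom.scc (h : JDom F) : Scc (frontier F) := h.2.2.2.1

theorem not_mem_frontier (hF : IsOpen F) (hx : x ∈ F) : x ∉ frontier F := fun h => by
  rw [hF.frontier_eq] at h; exact h.2 hx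

theorem JDom.face_eq (h : JDom F) (hx : x ∈ F) : face (frontier F)ᶜ x = F := by
  apply Subset.antisymm
  · exact subset_of_frontier isPreconnected_face h.1 (fun z hz => face_subset hz) (self_mem_face (not_mem_frontier h.1 hx)) hx
  · exact face_subset_of_isPreconnected h.2.1 (fun z hz => not_mem_frontier h.1 hz) hx (Conn.refl (not_mem_frontier h.1 hx))

theorem JDom.closure_eq (_h : JDom F) : closure F = F ∪ frontier F := closure_eq_self_union_frontier F

/-- crosscuts -/
def Cross (F α : Set X) (a b : X) : Prop := IsArc α a b ∧ α ⊆ F ∪ {a, b} ∧ a ∈ frontier F ∧ b ∈ frontier F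

theorem Cross.inter (hF : IsOpen F) (h : Cross F A a b) : A ∩ frontier F = {a, b} := by
  apply Subset.antisymm
  · rintro z ⟨h1, h2⟩
    exact (h.2.1 h1).elim (fun h => absurd h2 (not_mem_frontier hF h)) id
  · rintro z (rfl | rfl)
    · exact ⟨h.1.left_mem, h.2.2.1⟩
    · exact ⟨h.1.right_mem, h.2.2.2⟩

theorem Cross.pair (hF : IsOpen F) {J1 J2 : Set X} (h : Cross F A a b) (hp : Pair (frontier F) J1 J2 a b) : Pair (J1 ∪ A) J1 A a b := by
  refine ⟨hp.1, h.1, ?_, rfl⟩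
  have := h.inter hF
  apply Subset.antisymm
  · rintro z ⟨h1, h2⟩
    rw [← this]
    exact ⟨h2, hp.2.2.2 ▸ Or.inl h1⟩
  · rintro z (rfl | rfl)
    · exact ⟨hp.1.left_mem, h.1.left_mem⟩
    · exact ⟨hp.1.right_mem, h.1.right_mem⟩

theorem Pair.left_not (h : Pair J A B a b) (hx : x ∈ A) (ha : x ≠ a) (hb : x ≠ b) : x ∉ B := fun hB => by
  have : x ∈ A ∩ B := ⟨hx, hB⟩
  rw [h.2.2.1] at this
  exact this.elim ha hb

variable [Jan X]

theorem Scc.subset_closure_face (hJ : Scc J) (hx : x ∉ J) (hy : y ∉ J) (h : ¬ Conn Jᶜ x y) : J ⊆ closure (face Jᶜ x) := by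
  intro p hp
  rw [mem_closure_iff]
  intro U hU hpU
  obtain ⟨M, B, a, b, h1, h2, h3, h4⟩ := hJ.small hp hU hpU
  have hBJ : B ⊆ J := h1.2.2.2 ▸ subset_union_right
  obtain ⟨S, hS, hSc, hxS, hyS⟩ := h1.2.1.conn_compl (fun h => hx (hBJ h)) (fun h => hy (hBJ h))
  by_contra hcon
  apply h
  refine subset_of_frontier hSc (isOpen_face hJ.isClosed.isOpen_compl) ?_ hxS (self_mem_face hx) hyS
  intro z hz hzf
  have hzJ : z ∈ J := by simpa using frontier_face hJ.isClosed.isOpen_compl hzf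
  have hzM : z ∈ M := by
    rw [← h1.2.2.2] at hzJ
    exact hzJ.elim id fun h => absurd h (hS hz)
  exact hcon (mem_closure_iff.1 (frontier_subset_closure hzf) U hU (h4 hzM))

theorem Scc.jdom (hJ : Scc J) (hx : x ∉ J) (hy : y ∉ J) (h : ¬ Conn Jᶜ x y) : JDom (face Jᶜ x) ∧ frontier (face Jᶜ x) = J := by
  have ho : IsOpen (face Jᶜ x) := isOpen_face hJ.isClosed.isOpen_compl
  have hf : frontier (face Jᶜ x) = J := by
    apply Subset.antisymm
    · simpa using frontier_face (x := x) hJ.isClosed.isOpen_compl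
    · rw [ho.frontier_eq]
      exact fun z hz => ⟨hJ.subset_closure_face hx hy h hz, fun h => face_subset h hz⟩
  refine ⟨⟨ho, isPreconnected_face, ⟨x, self_mem_face hx⟩, by rwa [hf], ⟨y, fun hy' => h ?_⟩⟩, hf⟩
  exact closure_face hJ.isClosed.isOpen_compl hy' hy

theorem subset_closure_diff_arc (hF : IsOpen F) (hA : IsArc A a b) : F ⊆ closure (F \ A) := by
  intro z hz
  rw [mem_closure_iff]
  intro U hU hzU
  by_contra hcon
  have : U ∩ F ⊆ A := fun y hy => by
    by_contra hyA
    exact hcon ⟨y, hy.1, hy.2, hyA⟩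
  have := interior_maximal this (hU.inter hF) ⟨hzU, hz⟩
  rw [hA.interior_eq] at this
  exact this

theorem JDom.crosscut (h : JDom F) (ha : a ∈ frontier F) (hb : b ∈ frontier F) (hab : a ≠ b) (hu : u ∈ F) :
    ∃ α, Cross F α a b ∧ u ∈ α := by
  have hJ := h.scc
  have haF : a ∉ F := fun h' => not_mem_frontier h.1 h' ha
  have hbF : b ∉ F := fun h' => not_mem_frontier h.1 h' hb
  have huJ := not_mem_frontier h.1 hu
  have h1 := (hJ.ln ha).accessible (w := u) hJ.isClosed (by rw [h.face_eq hu]; exact frontier_subset_closure ha) huJ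
  rw [h.face_eq hu] at h1
  obtain ⟨β, hβF, hβ⟩ := exists_arc_of_joinedIn h1 (fun e => haF (e ▸ hu))
  obtain ⟨w, hwF, hwβ⟩ : (F \ β).Nonempty := by
    rw [← closure_nonempty_iff]
    exact ⟨u, subset_closure_diff_arc h.1 hβ hu⟩
  have hwJ := not_mem_frontier h.1 hwF
  have hJβ : frontier F ∩ β = {a} := by
    apply Subset.antisymm
    · rintro z ⟨h1, h2⟩
      exact (hβF h2).elim id fun h' => absurd h1 (not_mem_frontier h.1 h')
    · rintro z rfl
      exact ⟨ha, hβ.right_mem⟩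
  have hW : face (frontier F ∪ β)ᶜ w = F \ β := by
    apply Subset.antisymm
    · intro z hz
      refine ⟨?_, fun h' => face_subset hz (Or.inr h')⟩
      have := Conn.mono hz (compl_subset_compl.2 (subset_union_left (s := frontier F) (t := β)))
      rw [← h.face_eq hwF]
      exact this
    · rintro z ⟨hz, hzβ⟩
      refine Jan.j1 _ _ hJ.isClosed hβ.isClosed (hJβ ▸ isPreconnected_singleton) w z ?_ (hβ.conn_compl hwβ hzβ)
      have := h.face_eq hwF
      rw [← this] at hz
      exact hz
  have hKc : IsClosed (frontier F ∪ β) := hJ.isClosed.union hβ.isClosed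
  have hcl : closure F ⊆ closure (F \ β) := by
    have := closure_mono (subset_closure_diff_arc h.1 hβ)
    rwa [closure_closure] at this
  have hwK : w ∉ frontier F ∪ β := fun h' => h'.elim hwJ hwβ
  have hbβ : b ∉ β := fun h' => (hβF h').elim (fun e => hab e.symm) hbF
  have lb : LN (frontier F ∪ β) b := (hJ.ln hb).union hβ.isClosed hβ.isPreconnected ⟨a, ha, hβ.right_mem⟩ hbβ
  have lu : LN (frontier F ∪ β) u := by
    rw [union_comm]
    exact hβ.ln.union hJ.isClosed hJ.isPreconnected ⟨a, hβ.right_mem, ha⟩ huJ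
  have j1 := lb.accessible (w := w) hKc (by rw [hW]; exact hcl (frontier_subset_closure hb)) hwK
  have j2 := lu.accessible (w := w) hKc (by rw [hW]; exact hcl (subset_closure hu)) hwK
  rw [hW] at j1 j2
  have j3 : JoinedIn (insert b (insert u (F \ β))) u b :=
    (j2.mono (subset_insert _ _)).symm.trans (j1.mono (insert_subset_insert (subset_insert _ _)))
  obtain ⟨β', hβF', hβ'⟩ := exists_arc_of_joinedIn j3 (fun e => hbF (e ▸ hu))
  refine ⟨β ∪ β', ⟨hβ.symm.concat hβ' ?_, ?_, ha, hb⟩, Or.inl hβ.left_mem⟩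
  · rintro z ⟨h1, h2⟩
    rcases hβF' h2 with rfl | rfl | h3
    · exact absurd h1 hbβ
    · rfl
    · exact absurd h1 h3.2
  · rintro z (hz | hz)
    · rcases hβF hz with rfl | hz
      · right; left; rfl
      · left; exact hz
    · rcases hβF' hz with rfl | rfl | hz
      · right; right; rfl
      · left; exact hu
      · left; exact hz.1

theorem JDom.compl (h : JDom F) : JDom (closure F)ᶜ ∧ frontier (closure F)ᶜ = frontier F := by
  have hJ := h.scc
  obtain ⟨f, hf⟩ := h.2.2.1
  obtain ⟨J1, J2, a, b, hP⟩ := id hJ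
  have haJ : a ∈ frontier F := hP.2.2.2 ▸ Or.inl hP.1.left_mem
  have hbJ : b ∈ frontier F := hP.2.2.2 ▸ Or.inl hP.1.right_mem
  obtain ⟨α, hα, -⟩ := h.crosscut haJ hbJ hP.1.ne hf
  have hfJ := not_mem_frontier h.1 hf
  have hnc : ∀ x, x ∉ closure F → ¬ Conn (frontier F)ᶜ x f := by
    intro x hx hc
    apply hx
    apply subset_closure
    rw [← h.face_eq hf]
    exact hc.symm
  have hxJ : ∀ x, x ∉ closure F → x ∉ frontier F := fun x hx h => hx (frontier_subset_closure h)
  have hface : ∀ x, x ∉ closure F → face (frontier F)ᶜ x ⊆ (closure F)ᶜ := by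
    intro x hx z hz hz'
    rw [h.closure_eq] at hz'
    rcases hz' with hz' | hz'
    · rw [← h.face_eq hf] at hz'
      exact hnc x hx (Conn.trans hz (Conn.symm hz'))
    · exact face_subset hz hz'
  have hαJ := hα.inter h.1
  have key : ∀ J1 J2, Pair (frontier F) J1 J2 a b → ∃ p, ∀ x, x ∉ closure F → Conn (J1 ∪ α)ᶜ x p := by
    intro J1 J2 hP
    obtain ⟨p, hp, hpa, hpb⟩ := hP.2.1.exists_interior
    have hpJ : p ∈ frontier F := hP.2.2.2 ▸ Or.inr hp
    refine ⟨p, fun x hx => ?_⟩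
    have hJs : J1 ∪ α ⊆ closure F := by
      rw [h.closure_eq]
      rintro z (hz | hz)
      · exact Or.inr (hP.2.2.2 ▸ Or.inl hz)
      · rcases hα.2.1 hz with hz | rfl | rfl
        · exact Or.inl hz
        · exact Or.inr haJ
        · exact Or.inr hbJ
    refine conn_of_subset_closure isPreconnected_face (T := insert p (face (frontier F)ᶜ x)) (subset_insert _ _) ?_ ?_ (Or.inr (self_mem_face (hxJ x hx))) (Or.inl rfl)
    · rintro z (rfl | hz)
      · exact hJ.subset_closure_face (hxJ x hx) hfJ (hnc x hx) hpJ
      · exact subset_closure hz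
    · rintro z (rfl | hz)
      · rintro (hz | hz)
        · exact hP.swap.left_not hp hpa hpb hz
        · have : z ∈ α ∩ frontier F := ⟨hz, hpJ⟩
          rw [hαJ] at this
          exact this.elim hpa hpb
      · exact fun h => hface x hx hz (hJs h)
  have hconn : ∀ x, x ∉ closure F → ∀ y, y ∉ closure F → Conn (frontier F)ᶜ x y := by
    intro x hx y hy
    obtain ⟨p, hp⟩ := key J1 J2 hP
    obtain ⟨q, hq⟩ := key J2 J1 hP.swap
    have := Jan.j1 (J1 ∪ α) (J2 ∪ α) (hP.1.isClosed.union hα.1.isClosed) (hP.2.1.isClosed.union hα.1.isClosed) (by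
      have e : (J1 ∪ α) ∩ (J2 ∪ α) = α := by
        rw [← inter_union_distrib_right, hP.2.2.1]
        exact union_eq_self_of_subset_left (by rintro z (rfl | rfl); exacts [hα.1.left_mem, hα.1.right_mem])
      rw [e]; exact hα.1.isPreconnected) x y ((hp x hx).trans (hp y hy).symm) ((hq x hx).trans (hq y hy).symm)
    refine this.mono (compl_subset_compl.2 ?_)
    rw [← hP.2.2.2]
    exact union_subset_union subset_union_left subset_union_left
  obtain ⟨g, hg⟩ := h.2.2.2.2
  have e : (closure F)ᶜ = face (frontier F)ᶜ g := Subset.antisymm (fun z hz => hconn g hg z hz) (hface g hg)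
  rw [e]
  exact hJ.jdom (hxJ g hg) hfJ (hnc g hg)

theorem JDom.eq_of_frontier {F' : Set X} (h : JDom F) (h' : JDom F') (hz : (F ∩ F').Nonempty) (h1 : Disjoint F (frontier F')) (h2 : Disjoint F' (frontier F)) : F = F' := by
  obtain ⟨z, hz, hz'⟩ := hz
  exact Subset.antisymm (subset_of_frontier h.2.1 h'.1 (fun x hx => disjoint_left.1 h1 hx) hz hz') (subset_of_frontier h'.2.1 h.1 (fun x hx => disjoint_left.1 h2 hx) hz' hz)

theorem JDom.theta {J1 J2 α : Set X} (h : JDom F) (hP : Pair (frontier F) J1 J2 a b) (hα : Cross F α a b) :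
    ∃ F1 F2, JDom F1 ∧ JDom F2 ∧ frontier F1 = J1 ∪ α ∧ frontier F2 = J2 ∪ α ∧ F1 ∪ F2 = F \ α ∧ Disjoint F1 F2 := by
  obtain ⟨hG, hGf⟩ := h.compl
  obtain ⟨g, hg⟩ := hG.2.2.1
  have hαJ := hα.inter h.1
  have haJ := hα.2.2.1
  have hbJ := hα.2.2.2
  have hgJ : g ∉ frontier F := fun h => hg (frontier_subset_closure h)
  have hJsub : ∀ J1 J2, Pair (frontier F) J1 J2 a b → J1 ∪ α ⊆ closure F := by
    intro J1 J2 hP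
    rw [h.closure_eq]
    rintro z (hz | hz)
    · exact Or.inr (hP.2.2.2 ▸ Or.inl hz)
    · rcases hα.2.1 hz with hz | rfl | rfl
      · exact Or.inl hz
      · exact Or.inr haJ
      · exact Or.inr hbJ
  have hclosed : ∀ J1 J2, Pair (frontier F) J1 J2 a b → IsClosed (J1 ∪ α) := fun J1 J2 hP => hP.1.isClosed.union hα.1.isClosed
  have hnα : ∀ p ∈ frontier F, p ≠ a → p ≠ b → p ∉ α := by
    intro p hpJ hpa hpb hz
    have : p ∈ α ∩ frontier F := ⟨hz, hpJ⟩
    rw [hαJ] at this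
    exact this.elim hpa hpb
  have hGE : ∀ J1 J2, Pair (frontier F) J1 J2 a b → (closure F)ᶜ ⊆ face (J1 ∪ α)ᶜ g := by
    intro J1 J2 hP
    exact face_subset_of_isPreconnected hG.2.1 (compl_subset_compl.2 (hJsub J1 J2 hP)) hg (Conn.refl (fun h => hg (hJsub J1 J2 hP h)))
  have hJE : ∀ J1 J2, Pair (frontier F) J1 J2 a b → ∀ p ∈ J2, p ≠ a → p ≠ b → p ∈ face (J1 ∪ α)ᶜ g := by
    intro J1 J2 hP p hp hpa hpb
    have hpJ : p ∈ frontier F := hP.2.2.2 ▸ Or.inr hp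
    refine conn_of_subset_closure hG.2.1 (T := insert p (closure F)ᶜ) (subset_insert _ _) ?_ ?_ (Or.inr hg) (Or.inl rfl)
    · rintro z (rfl | hz)
      · rw [← hGf] at hpJ
        exact frontier_subset_closure hpJ
      · exact subset_closure hz
    · rintro z (rfl | hz)
      · rintro (hz | hz)
        · exact hP.swap.left_not hp hpa hpb hz
        · exact hnα z hpJ hpa hpb hz
      · exact fun h => hz (hJsub J1 J2 hP h)
  have hboth : ∀ J1 J2, Pair (frontier F) J1 J2 a b → ∀ x ∈ F, x ∈ face (J1 ∪ α)ᶜ g → x ∈ face (J2 ∪ α)ᶜ g → False := by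
    intro J1 J2 hP x hx h1 h2
    have := Jan.j1 (J1 ∪ α) (J2 ∪ α) (hclosed _ _ hP) (hclosed _ _ hP.swap) (by
      have e : (J1 ∪ α) ∩ (J2 ∪ α) = α := by
        rw [← inter_union_distrib_right, hP.2.2.1]
        exact union_eq_self_of_subset_left (by rintro z (rfl | rfl); exacts [hα.1.left_mem, hα.1.right_mem])
      rw [e]; exact hα.1.isPreconnected) g x h1 h2
    have h3 : Conn (frontier F)ᶜ g x := by
      refine this.mono (compl_subset_compl.2 ?_)
      rw [← hP.2.2.2]
      exact union_subset_union subset_union_left subset_union_left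
    have h4 : g ∈ face (frontier F)ᶜ x := h3.symm
    rw [h.face_eq hx] at h4
    exact hg (subset_closure h4)
  have hdom : ∀ J1 J2, Pair (frontier F) J1 J2 a b → JDom (face (J1 ∪ α)ᶜ g) ∧ frontier (face (J1 ∪ α)ᶜ g) = J1 ∪ α := by
    intro J1 J2 hP
    obtain ⟨q, hq, hqa, hqb⟩ := hP.1.exists_interior
    have hqJ : q ∈ frontier F := hP.2.2.2 ▸ Or.inl hq
    have hqE := hJE J2 J1 hP.swap q hq hqa hqb
    obtain ⟨x, ⟨hxE, hxα⟩, hxF⟩ := mem_closure_iff.1 (frontier_subset_closure hqJ) (face (J2 ∪ α)ᶜ g \ α) ((isOpen_face (hclosed _ _ hP.swap).isOpen_compl).sdiff hα.1.isClosed)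
      ⟨hqE, hnα q hqJ hqa hqb⟩
    have hsc : Scc (J1 ∪ α) := ⟨_, _, _, _, hα.pair h.1 hP⟩
    refine hsc.jdom (fun h => hg (hJsub _ _ hP h)) (y := x) ?_ (fun hc => hboth J1 J2 hP x hxF hc hxE)
    rintro (hx | hx)
    · exact not_mem_frontier h.1 hxF (hP.2.2.2 ▸ Or.inl hx)
    · exact hxα hx
  have hsub : ∀ J1 J2, Pair (frontier F) J1 J2 a b → (closure (face (J1 ∪ α)ᶜ g))ᶜ ⊆ F \ α := by
    intro J1 J2 hP z hz
    obtain ⟨h1, h2⟩ := hdom J1 J2 hP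
    rw [h1.closure_eq, h2] at hz
    have hzα : z ∉ α := fun h => hz (Or.inr (Or.inr h))
    refine ⟨?_, hzα⟩
    by_contra hzF
    have hzJ : z ∉ frontier F := by
      intro hzJ
      rw [← hP.2.2.2] at hzJ
      rcases hzJ with hzJ | hzJ
      · exact hz (Or.inr (Or.inl hzJ))
      · exact hz (Or.inl (hJE _ _ hP z hzJ (fun e => hzα (e ▸ hα.1.left_mem)) (fun e => hzα (e ▸ hα.1.right_mem))))
    exact hz (Or.inl (hGE _ _ hP (by rw [h.closure_eq]; exact fun h => h.elim hzF hzJ)))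
  obtain ⟨d1, e1⟩ := hdom J1 J2 hP
  obtain ⟨d2, e2⟩ := hdom J2 J1 hP.swap
  obtain ⟨k1, f1⟩ := d1.compl
  obtain ⟨k2, f2⟩ := d2.compl
  have s1 := hsub _ _ hP
  have s2 := hsub _ _ hP.swap
  have hdJ : ∀ z ∈ F \ α, ∀ J1 J2, Pair (frontier F) J1 J2 a b → z ∉ J1 ∪ α := by
    rintro z ⟨hz, hzα⟩ J1 J2 hP (h1 | h1)
    · exact not_mem_frontier h.1 hz (hP.2.2.2 ▸ Or.inl h1)
    · exact hzα h1
  refine ⟨_, _, k1, k2, f1.trans e1, f2.trans e2, Subset.antisymm (union_subset s1 s2) ?_, ?_⟩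
  · intro z hz
    rw [d1.closure_eq, d2.closure_eq, e1, e2]
    by_contra hcon
    have h1 := hdJ z hz _ _ hP
    have h2 := hdJ z hz _ _ hP.swap
    simp only [mem_union, mem_compl_iff, not_or, not_and, not_not] at hcon h1 h2
    have h3 : z ∈ face (J1 ∪ α)ᶜ g := by
      by_contra h3
      exact h1.2 (hcon.1 h3 h1.1)
    have h4 : z ∈ face (J2 ∪ α)ᶜ g := by
      by_contra h3
      exact h2.2 (hcon.2 h3 h2.1)
    exact hboth _ _ hP z hz.1 h3 h4
  · rw [Set.disjoint_iff_inter_eq_empty]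
    by_contra hne
    have := k1.eq_of_frontier k2 (nonempty_iff_ne_empty.2 hne)
      (disjoint_left.2 fun z hz => by rw [f2, e2]; exact hdJ z (s1 hz) _ _ hP.swap)
      (disjoint_left.2 fun z hz => by rw [f1, e1]; exact hdJ z (s2 hz) _ _ hP)
    have h2 : J1 ∪ α = J2 ∪ α := by rw [← e1, ← f1, this, f2, e2]
    obtain ⟨q, hq, hqa, hqb⟩ := hP.1.exists_interior
    have hq2 : q ∈ J2 ∪ α := h2 ▸ Or.inl hq
    exact hq2.elim (hP.left_not hq hqa hqb) (hnα q (hP.2.2.2 ▸ Or.inl hq) hqa hqb)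

end
end MooreSphere

namespace MooreSphere
open Set Filter Topology
section
variable {X : Type} [MetricSpace X] [Jan X] {J A B K L U F M : Set X} {a b c p x y w u v : X}

variable (X) in
theorem exists_jdom : ∃ F : Set X, JDom F := by
  have := Jan.nontriv (X := X)
  obtain ⟨a, b, hab⟩ := exists_pair_ne X
  obtain ⟨β, -, hβ⟩ := exists_arc_of_joinedIn (conn_joinedIn isOpen_univ (Jan.conn a b)) hab
  have hcl : ∀ z, z ∈ closure βᶜ := by
    intro z
    have := subset_closure_diff_arc isOpen_univ hβ (mem_univ z)
    rwa [← compl_eq_univ_sdiff] at this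
  obtain ⟨w, hw⟩ : (βᶜ).Nonempty := closure_nonempty_iff.1 ⟨a, hcl a⟩
  have hW : face βᶜ w = βᶜ := Subset.antisymm face_subset fun z hz => hβ.conn_compl hw hz
  have j1 := hβ.ln.accessible hβ.isClosed (w := w) (by rw [hW]; exact hcl a) hw
  have j2 := hβ.symm.ln.accessible hβ.isClosed (w := w) (by rw [hW]; exact hcl b) hw
  rw [hW] at j1 j2
  have j3 : JoinedIn (insert b (insert a βᶜ)) a b :=
    (j1.mono (subset_insert _ _)).symm.trans (j2.mono (insert_subset_insert (subset_insert _ _)))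
  obtain ⟨β', hβ'F, hβ'⟩ := exists_arc_of_joinedIn j3 hab
  have hi : β ∩ β' = {a, b} := by
    apply Subset.antisymm
    · rintro z ⟨h1, h2⟩
      rcases hβ'F h2 with rfl | rfl | h
      · right; rfl
      · left; rfl
      · exact absurd h1 h
    · rintro z (rfl | rfl)
      · exact ⟨hβ.left_mem, hβ'.left_mem⟩
      · exact ⟨hβ.right_mem, hβ'.right_mem⟩
  obtain ⟨x, y, hx, hy, hxy⟩ := Jan.j2 β β' hβ.isClosed hβ'.isClosed hβ.isPreconnected hβ'.isPreconnected a b hab hi (by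
    intro hu
    have h1 := subset_closure_diff_arc hβ.isClosed.isOpen_compl hβ' hw
    obtain ⟨z, hz, hz'⟩ := closure_nonempty_iff.1 ⟨w, h1⟩
    have : z ∈ β ∪ β' := hu ▸ mem_univ z
    exact this.elim hz hz')
  have hs : Scc (β ∪ β') := ⟨β, β', a, b, hβ, hβ', hi, rfl⟩
  exact ⟨_, (hs.jdom hx hy hxy).1⟩

theorem JDom.mem_cases (h : JDom F) (z : X) : z ∈ F ∨ z ∈ frontier F ∨ z ∈ (closure F)ᶜ := by
  rw [h.closure_eq]
  by_cases h1 : z ∈ F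
  · exact Or.inl h1
  · by_cases h2 : z ∈ frontier F
    · exact Or.inr (Or.inl h2)
    · exact Or.inr (Or.inr fun h => h.elim h1 h2)

theorem JDom.through (h : JDom F) (hu : u ∈ F) : ∃ F' : Set X, JDom F' ∧ u ∈ frontier F' := by
  obtain ⟨J1, J2, a, b, hP⟩ := id h.scc
  obtain ⟨α, hα, huα⟩ := h.crosscut (hP.2.2.2 ▸ Or.inl hP.1.left_mem) (hP.2.2.2 ▸ Or.inl hP.1.right_mem) hP.1.ne hu
  obtain ⟨F1, F2, h1, h2, h3, -⟩ := h.theta hP hα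
  exact ⟨F1, h1, h3 ▸ Or.inr huα⟩

theorem exists_jdom_through (u : X) : ∃ F : Set X, JDom F ∧ u ∈ frontier F := by
  obtain ⟨F, h⟩ := exists_jdom X
  rcases h.mem_cases u with h1 | h1 | h1
  · exact h.through h1
  · exact ⟨F, h, h1⟩
  · exact h.compl.1.through h1

theorem JDom.avoid (h : JDom F) (hP : Pair (frontier F) M B a b) (hv : v ∉ M) :
    ∃ α F1 F2, Cross F α a b ∧ JDom F1 ∧ JDom F2 ∧ frontier F1 = M ∪ α ∧ frontier F2 = B ∪ α ∧ F1 ∪ F2 = F \ α ∧ Disjoint F1 F2 ∧ v ∉ closure F1 := by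
  have haJ : a ∈ frontier F := hP.2.2.2 ▸ Or.inl hP.1.left_mem
  have hbJ : b ∈ frontier F := hP.2.2.2 ▸ Or.inl hP.1.right_mem
  by_cases hvF : v ∈ F
  · obtain ⟨α0, hα0, hvα⟩ := h.crosscut haJ hbJ hP.1.ne hvF
    obtain ⟨E1, E2, k1, k2, k3, k4, k5, k6⟩ := h.theta hP hα0
    have hP1 : Pair (frontier E1) M α0 a b := k3 ▸ hα0.pair h.1 hP
    obtain ⟨e, he⟩ := k1.2.2.1
    obtain ⟨α, hα, -⟩ := k1.crosscut (k3 ▸ Or.inl hP.1.left_mem) (k3 ▸ Or.inl hP.1.right_mem) hP.1.ne he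
    have hEF : E1 ⊆ F \ α0 := k5 ▸ subset_union_left
    have hα' : Cross F α a b := ⟨hα.1, hα.2.1.trans (union_subset_union_left _ (hEF.trans sdiff_subset)), haJ, hbJ⟩
    obtain ⟨D1, D2, d1, d2, d3, d4, d5, d6⟩ := k1.theta hP1 hα
    obtain ⟨F1, F2, f1, f2, f3, f4, f5, f6⟩ := h.theta hP hα'
    have hD : D1 ⊆ E1 \ α := d5 ▸ subset_union_left
    have hDF : D1 ⊆ F1 ∪ F2 := by
      rw [f5]
      exact hD.trans (sdiff_subset_sdiff_left (hEF.trans sdiff_subset))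
    have hD1 : (D1 ∩ F1).Nonempty := by
      by_contra hne
      have hsub : D1 ⊆ F2 := fun z hz => (hDF hz).elim (fun h => absurd ⟨z, hz, h⟩ hne) id
      obtain ⟨q, hq, hqa, hqb⟩ := hP.1.exists_interior
      have hqJ : q ∈ frontier F := hP.2.2.2 ▸ Or.inl hq
      have h1 : q ∈ closure F2 := closure_mono hsub (frontier_subset_closure (d3 ▸ Or.inl hq))
      rw [f2.closure_eq, f4] at h1
      rcases h1 with h1 | h1 | h1
      · have : q ∈ F \ α := f5 ▸ Or.inr h1
        exact not_mem_frontier h.1 this.1 hqJ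
      · exact hP.left_not hq hqa hqb h1
      · have : q ∈ α ∩ frontier F := ⟨h1, hqJ⟩
        rw [hα'.inter h.1] at this
        exact this.elim hqa hqb
    have hF1D : F1 = D1 := by
      refine f1.eq_of_frontier d1 (by rwa [inter_comm]) ?_ ?_
      · rw [d3, ← f3, disjoint_left]; exact fun z hz => not_mem_frontier f1.1 hz
      · rw [f3, ← d3, disjoint_left]; exact fun z hz => not_mem_frontier d1.1 hz
    have hvE : v ∉ E1 := fun h => (hEF h).2 hvα
    refine ⟨α, F1, F2, hα', f1, f2, f3, f4, f5, f6, ?_⟩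
    rw [f1.closure_eq, f3]
    rintro (h1 | h1 | h1)
    · exact hvE (hD (hF1D ▸ h1)).1
    · exact hv h1
    · rcases hα.2.1 h1 with h2 | rfl | rfl
      · exact hvE h2
      · exact hv hP.1.left_mem
      · exact hv hP.1.right_mem
  · obtain ⟨f, hf⟩ := h.2.2.1
    obtain ⟨α, hα, -⟩ := h.crosscut haJ hbJ hP.1.ne hf
    obtain ⟨F1, F2, f1, f2, f3, f4, f5, f6⟩ := h.theta hP hα
    refine ⟨α, F1, F2, hα, f1, f2, f3, f4, f5, f6, ?_⟩
    rw [f1.closure_eq, f3]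
    rintro (h1 | h1 | h1)
    · have : v ∈ F \ α := f5 ▸ Or.inl h1
      exact hvF this.1
    · exact hv h1
    · rcases hα.2.1 h1 with h2 | rfl | rfl
      · exact hvF h2
      · exact hv hP.1.left_mem
      · exact hv hP.1.right_mem

theorem exists_separating (huv : u ≠ v) : ∃ C : Set X, Scc C ∧ u ∉ C ∧ v ∉ C ∧ ¬ Conn Cᶜ u v := by
  obtain ⟨F, hF, hu⟩ := exists_jdom_through u
  obtain ⟨M, B, a, b, hP, huM, huB, hMv⟩ := hF.scc.small hu (isOpen_compl_singleton (x := v)) huv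
  have hv : v ∉ M := fun h => hMv h rfl
  obtain ⟨hG, hGF⟩ := hF.compl
  have hPG : Pair (frontier (closure F)ᶜ) M B a b := by rwa [hGF]
  obtain ⟨α, F1, F2, hα, f1, f2, f3, f4, f5, f6, f7⟩ := hF.avoid hP hv
  obtain ⟨β, G1, G2, hβ, g1, g2, g3, g4, g5, g6, g7⟩ := hG.avoid hPG hv
  have hab : ∀ z, z = a ∨ z = b → z ∈ frontier F := by rintro z (rfl | rfl); exacts [hα.2.2.1, hα.2.2.2]
  have hαF : α ⊆ F ∪ {a, b} := hα.2.1
  have hβG : β ⊆ (closure F)ᶜ ∪ {a, b} := hβ.2.1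
  have hGd : ∀ z ∈ (closure F)ᶜ, z ∉ F ∧ z ∉ frontier F := fun z hz => ⟨fun h => hz (subset_closure h), fun h => hz (frontier_subset_closure h)⟩
  have hua : u ≠ a := fun e => huB (e ▸ hP.2.1.left_mem)
  have hub : u ≠ b := fun e => huB (e ▸ hP.2.1.right_mem)
  have huα : u ∉ α := fun h => (hαF h).elim (fun h => not_mem_frontier hF.1 h hu) fun h => h.elim hua hub
  have huβ : u ∉ β := fun h => (hβG h).elim (fun h => (hGd u h).2 hu) fun h => h.elim hua hub
  have hvα : v ∉ α := fun h => f7 (frontier_subset_closure (f3 ▸ Or.inr h))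
  have hvβ : v ∉ β := fun h => g7 (frontier_subset_closure (g3 ▸ Or.inr h))
  refine ⟨α ∪ β, ⟨α, β, a, b, hα.1, hβ.1, ?_, rfl⟩, fun h => h.elim huα huβ, fun h => h.elim hvα hvβ, ?_⟩
  · apply Subset.antisymm
    · rintro z ⟨h1, h2⟩
      rcases hαF h1 with h1 | h1
      · rcases hβG h2 with h2 | h2
        · exact absurd h1 (hGd z h2).1
        · exact h2
      · exact h1
    · rintro z (rfl | rfl)
      · exact ⟨hα.1.left_mem, hβ.1.left_mem⟩
      · exact ⟨hα.1.right_mem, hβ.1.right_mem⟩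
  · rintro ⟨S, hS, hSp, huS, hvS⟩
    have hcov : ∀ z, z ∈ (closure F1 ∪ closure G1) ∪ (closure F2 ∪ closure G2) := by
      intro z
      rw [f1.closure_eq, f2.closure_eq, g1.closure_eq, g2.closure_eq, f3, f4, g3, g4]
      rcases hF.mem_cases z with h | h | h
      · by_cases hz : z ∈ α
        · left; left; right; right; exact hz
        · have : z ∈ F1 ∪ F2 := f5 ▸ ⟨h, hz⟩
          exact this.elim (fun h => Or.inl (Or.inl (Or.inl h))) (fun h => Or.inr (Or.inl (Or.inl h)))
      · rw [← hP.2.2.2] at h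
        exact h.elim (fun h => Or.inl (Or.inl (Or.inr (Or.inl h)))) (fun h => Or.inr (Or.inl (Or.inr (Or.inl h))))
      · by_cases hz : z ∈ β
        · left; right; right; right; exact hz
        · have : z ∈ G1 ∪ G2 := g5 ▸ ⟨h, hz⟩
          exact this.elim (fun h => Or.inl (Or.inr (Or.inl h))) (fun h => Or.inr (Or.inr (Or.inl h)))
    have hv2 : v ∈ closure F2 ∪ closure G2 := (hcov v).elim (fun h => h.elim (fun h => absurd h f7) (fun h => absurd h g7)) id
    obtain ⟨z, hzS, hz1, hz2⟩ := isPreconnected_closed_iff.1 hSp _ _ (isClosed_closure.union isClosed_closure) (isClosed_closure.union isClosed_closure) (fun z _ => hcov z)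
      ⟨u, huS, Or.inl (frontier_subset_closure (f3 ▸ Or.inl huM))⟩ ⟨v, hvS, hv2⟩
    have hzα : z ∉ α := fun h => hS hzS (Or.inl h)
    have hzβ : z ∉ β := fun h => hS hzS (Or.inr h)
    have hF12 : ∀ y, y ∈ F1 ∪ F2 → y ∈ F := fun y hy => by rw [f5] at hy; exact hy.1
    have hG12 : ∀ y, y ∈ G1 ∪ G2 → y ∈ (closure F)ᶜ := fun y hy => by rw [g5] at hy; exact hy.1
    have hM : z ∈ M → z ∈ frontier F := fun h => hP.2.2.2 ▸ Or.inl h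
    have hB : z ∈ B → z ∈ frontier F := fun h => hP.2.2.2 ▸ Or.inr h
    rw [f1.closure_eq, g1.closure_eq, f3, g3] at hz1
    rw [f2.closure_eq, g2.closure_eq, f4, g4] at hz2
    have c1 : z ∈ F1 ∨ z ∈ G1 ∨ z ∈ M := by
      rcases hz1 with (h | h | h) | (h | h | h)
      exacts [Or.inl h, Or.inr (Or.inr h), absurd h hzα, Or.inr (Or.inl h), Or.inr (Or.inr h), absurd h hzβ]
    have c2 : z ∈ F2 ∨ z ∈ G2 ∨ z ∈ B := by
      rcases hz2 with (h | h | h) | (h | h | h)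
      exacts [Or.inl h, Or.inr (Or.inr h), absurd h hzα, Or.inr (Or.inl h), Or.inr (Or.inr h), absurd h hzβ]
    rcases c1 with h | h | h <;> rcases c2 with h' | h' | h'
    · exact disjoint_left.1 f6 h h'
    · exact (hGd z (hG12 z (Or.inr h'))).1 (hF12 z (Or.inl h))
    · exact not_mem_frontier hF.1 (hF12 z (Or.inl h)) (hB h')
    · exact (hGd z (hG12 z (Or.inl h))).1 (hF12 z (Or.inr h'))
    · exact disjoint_left.1 g6 h h'
    · exact (hGd z (hG12 z (Or.inl h))).2 (hB h')
    · exact not_mem_frontier hF.1 (hF12 z (Or.inr h')) (hM h)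
    · exact (hGd z (hG12 z (Or.inr h'))).2 (hM h)
    · exact hP.left_not h (fun e => hzα (e ▸ hα.1.left_mem)) (fun e => hzα (e ▸ hα.1.right_mem)) h'

end
end MooreSphere

namespace MooreSphere
open Set Filter Topology
section
variable {X : Type} [MetricSpace X] {ι : Type} {Γ J J1 J2 α : Set X} {a b : X} {I : Set ι} {f : ι → Set X} {c c1 c2 : ι}

structure Half (Γ : Set X) (I : Set ι) (f : ι → Set X) : Prop where
  cl : IsClosed Γ
  dom : ∀ i ∈ I, JDom (f i)
  fr : ∀ i ∈ I, frontier (f i) ⊆ Γ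
  dis : ∀ i ∈ I, ∀ x ∈ f i, x ∉ Γ
  ov : ∀ i ∈ I, ∀ j ∈ I, ∀ x ∈ f i, x ∈ f j → i = j
  cov : ∀ x, x ∉ Γ → ∃ i ∈ I, x ∈ f i
  dense : ∀ x, ∃ i ∈ I, x ∈ closure (f i)

theorem Half.step (H : Half Γ I f) (hc : c ∈ I) (hα : Cross (f c) α a b) (hP : Pair (frontier (f c)) J1 J2 a b)
    (h1 : JDom (f c1)) (h2 : JDom (f c2)) (e1 : frontier (f c1) = J1 ∪ α) (e2 : frontier (f c2) = J2 ∪ α)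
    (e3 : f c1 ∪ f c2 = f c \ α) (e4 : Disjoint (f c1) (f c2)) : Half (Γ ∪ α) ((I \ {c}) ∪ {c1, c2}) f := by
  have s1 : f c1 ⊆ f c \ α := e3 ▸ subset_union_left
  have s2 : f c2 ⊆ f c \ α := e3 ▸ subset_union_right
  have sJ : J1 ∪ J2 ⊆ Γ := hP.2.2.2 ▸ H.fr c hc
  have hαΓ : ∀ x ∈ α, x ∈ f c ∨ x ∈ Γ := by
    intro x hx
    rcases hα.2.1 hx with h | rfl | rfl
    · exact Or.inl h
    · exact Or.inr (H.fr c hc hα.2.2.1)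
    · exact Or.inr (H.fr c hc hα.2.2.2)
  have hold : ∀ i ∈ I, i ≠ c → ∀ x ∈ f i, x ∉ f c := fun i hi hne x hx hx' => hne (H.ov i hi c hc x hx hx')
  refine ⟨H.cl.union hα.1.isClosed, ?_, ?_, ?_, ?_, ?_, ?_⟩
  · rintro i (hi | rfl | rfl)
    exacts [H.dom i hi.1, h1, h2]
  · rintro i (hi | rfl | rfl)
    · exact (H.fr i hi.1).trans subset_union_left
    · rw [e1]; exact union_subset_union_left _ (subset_union_left.trans sJ)
    · rw [e2]; exact union_subset_union_left _ (subset_union_right.trans sJ)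
  · rintro i (hi | rfl | rfl) x hx (hx' | hx')
    · exact H.dis i hi.1 x hx hx'
    · exact (hαΓ x hx').elim (hold i hi.1 hi.2 x hx) (H.dis i hi.1 x hx)
    · exact H.dis c hc x (s1 hx).1 hx'
    · exact (s1 hx).2 hx'
    · exact H.dis c hc x (s2 hx).1 hx'
    · exact (s2 hx).2 hx'
  · rintro i (hi | hi | hi) j (hj | hj | hj) x hx hx'
    · exact H.ov i hi.1 j hj.1 x hx hx'
    · rw [hj] at hx'; exact absurd (s1 hx').1 (hold i hi.1 hi.2 x hx)
    · rw [hj] at hx'; exact absurd (s2 hx').1 (hold i hi.1 hi.2 x hx)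
    · rw [hi] at hx; exact absurd (s1 hx).1 (hold j hj.1 hj.2 x hx')
    · rw [hi, hj]
    · rw [hi] at hx; rw [hj] at hx'; exact absurd hx' (disjoint_left.1 e4 hx)
    · rw [hi] at hx; exact absurd (s2 hx).1 (hold j hj.1 hj.2 x hx')
    · rw [hi] at hx; rw [hj] at hx'; exact absurd hx (disjoint_left.1 e4 hx')
    · rw [hi, hj]
  · intro x hx
    obtain ⟨i, hi, hxi⟩ := H.cov x (fun h => hx (Or.inl h))
    by_cases hic : i = c
    · have : x ∈ f c1 ∪ f c2 := e3 ▸ ⟨hic ▸ hxi, fun h => hx (Or.inr h)⟩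
      rcases this with h | h
      · exact ⟨c1, Or.inr (Or.inl rfl), h⟩
      · exact ⟨c2, Or.inr (Or.inr rfl), h⟩
    · exact ⟨i, Or.inl ⟨hi, hic⟩, hxi⟩
  · intro x
    obtain ⟨i, hi, hxi⟩ := H.dense x
    by_cases hic : i = c
    · rw [hic, (H.dom c hc).closure_eq] at hxi
      rcases hxi with h | h
      · by_cases hxα : x ∈ α
        · exact ⟨c1, Or.inr (Or.inl rfl), frontier_subset_closure (e1 ▸ Or.inr hxα)⟩
        · have : x ∈ f c1 ∪ f c2 := e3 ▸ ⟨h, hxα⟩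
          rcases this with h | h
          · exact ⟨c1, Or.inr (Or.inl rfl), subset_closure h⟩
          · exact ⟨c2, Or.inr (Or.inr rfl), subset_closure h⟩
      · rw [← hP.2.2.2] at h
        rcases h with h | h
        · exact ⟨c1, Or.inr (Or.inl rfl), frontier_subset_closure (e1 ▸ Or.inl h)⟩
        · exact ⟨c2, Or.inr (Or.inr rfl), frontier_subset_closure (e2 ▸ Or.inl h)⟩
    · exact ⟨i, Or.inl ⟨hi, hic⟩, hxi⟩

end

section
variable (X Y : Type) [MetricSpace X] [MetricSpace Y]

/-- a stage of the back-and-forth construction -/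
structure St where
  Γ : Set X
  Γ' : Set Y
  h : X → Y
  I : Set (Set X × Set Y)
  H : Half Γ I Prod.fst
  H' : Half Γ' I Prod.snd
  fin : I.Finite
  hc : ContinuousOn h Γ
  hi : InjOn h Γ
  him : h '' Γ = Γ'
  fr : ∀ c ∈ I, h '' frontier c.1 = frontier c.2

variable {X Y}

/-- refinement -/
def St.le (s t : St X Y) : Prop := s.Γ ⊆ t.Γ ∧ s.Γ' ⊆ t.Γ' ∧ ∀ c ∈ t.I, ∃ d ∈ s.I, c.1 ⊆ d.1 ∧ c.2 ⊆ d.2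

theorem St.le_refl (s : St X Y) : s.le s := ⟨Subset.rfl, Subset.rfl, fun c hc => ⟨c, hc, Subset.rfl, Subset.rfl⟩⟩

theorem St.le_trans {s t u : St X Y} (h : s.le t) (h' : t.le u) : s.le u := ⟨h.1.trans h'.1, h.2.1.trans h'.2.1, fun c hc => by
  obtain ⟨d, hd, h1, h2⟩ := h'.2.2 c hc
  obtain ⟨e, he, h3, h4⟩ := h.2.2 d hd
  exact ⟨e, he, h1.trans h3, h2.trans h4⟩⟩

theorem continuousOn_invFunOn [CompactSpace X] [Nonempty X] {Γ : Set X} {h : X → Y} (hΓ : IsClosed Γ) (hc : ContinuousOn h Γ) (hi : InjOn h Γ) :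
    ContinuousOn (Function.invFunOn h Γ) (h '' Γ) := by
  rw [continuousOn_iff_isClosed]
  intro Z hZ
  refine ⟨h '' (Z ∩ Γ), ((hZ.inter hΓ).isCompact.image_of_continuousOn (hc.mono inter_subset_right)).isClosed, ?_⟩
  ext y
  constructor
  · rintro ⟨hy, x, hx, rfl⟩
    have : Function.invFunOn h Γ (h x) = x := hi.leftInvOn_invFunOn hx
    rw [mem_preimage, this] at hy
    exact ⟨⟨x, ⟨hy, hx⟩, rfl⟩, x, hx, rfl⟩
  · rintro ⟨⟨x, ⟨hxZ, hx⟩, rfl⟩, -⟩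
    have : Function.invFunOn h Γ (h x) = x := hi.leftInvOn_invFunOn hx
    exact ⟨by rwa [mem_preimage, this], x, hx, rfl⟩

/-- reversing roles -/
theorem St.exists_swap [CompactSpace X] [Nonempty X] (s : St X Y) : ∃ t : St Y X, t.Γ = s.Γ' ∧ t.Γ' = s.Γ ∧ t.I = Prod.swap '' s.I := by
  have hleft : ∀ x ∈ s.Γ, Function.invFunOn s.h s.Γ (s.h x) = x := fun x hx => s.hi.leftInvOn_invFunOn hx
  have him : Function.invFunOn s.h s.Γ '' s.Γ' = s.Γ := by
    rw [← s.him, image_image]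
    ext x
    constructor
    · rintro ⟨y, hy, rfl⟩; beta_reduce; rw [hleft y hy]; exact hy
    · exact fun hx => ⟨x, hx, hleft x hx⟩
  have half1 : Half s.Γ' (Prod.swap '' s.I) Prod.fst := by
    have H := s.H'
    refine ⟨H.cl, ?_, ?_, ?_, ?_, ?_, ?_⟩
    · rintro _ ⟨i, hi, rfl⟩; exact H.dom i hi
    · rintro _ ⟨i, hi, rfl⟩; exact H.fr i hi
    · rintro _ ⟨i, hi, rfl⟩; exact H.dis i hi
    · rintro _ ⟨i, hi, rfl⟩ _ ⟨j, hj, rfl⟩ x hx hx'; rw [H.ov i hi j hj x hx hx']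
    · intro x hx; obtain ⟨i, hi, hxi⟩ := H.cov x hx; exact ⟨_, mem_image_of_mem _ hi, hxi⟩
    · intro x; obtain ⟨i, hi, hxi⟩ := H.dense x; exact ⟨_, mem_image_of_mem _ hi, hxi⟩
  have half2 : Half s.Γ (Prod.swap '' s.I) Prod.snd := by
    have H := s.H
    refine ⟨H.cl, ?_, ?_, ?_, ?_, ?_, ?_⟩
    · rintro _ ⟨i, hi, rfl⟩; exact H.dom i hi
    · rintro _ ⟨i, hi, rfl⟩; exact H.fr i hi
    · rintro _ ⟨i, hi, rfl⟩; exact H.dis i hi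
    · rintro _ ⟨i, hi, rfl⟩ _ ⟨j, hj, rfl⟩ x hx hx'; rw [H.ov i hi j hj x hx hx']
    · intro x hx; obtain ⟨i, hi, hxi⟩ := H.cov x hx; exact ⟨_, mem_image_of_mem _ hi, hxi⟩
    · intro x; obtain ⟨i, hi, hxi⟩ := H.dense x; exact ⟨_, mem_image_of_mem _ hi, hxi⟩
  refine ⟨⟨s.Γ', s.Γ, Function.invFunOn s.h s.Γ, _, half1, half2, s.fin.image _, ?_, ?_, him, ?_⟩, rfl, rfl, rfl⟩
  · rw [← s.him]
    exact continuousOn_invFunOn s.H.cl s.hc s.hi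
  · rw [← s.him]
    rintro _ ⟨x, hx, rfl⟩ _ ⟨y, hy, rfl⟩ hxy
    rw [hleft x hx, hleft y hy] at hxy
    rw [hxy]
  · rintro _ ⟨c, hc, rfl⟩
    simp only [Prod.fst_swap, Prod.snd_swap]
    rw [← s.fr c hc, image_image]
    have hsub := s.H.fr c hc
    ext x
    constructor
    · rintro ⟨y, hy, rfl⟩; beta_reduce; rw [hleft y (hsub hy)]; exact hy
    · exact fun hx => ⟨x, hx, hleft x (hsub hx)⟩

variable [Jan X] [Jan Y]

theorem St.step (s : St X Y) {c : Set X × Set Y} (hc : c ∈ s.I) {α : Set X} {a b : X} (hα : Cross c.1 α a b) :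
    ∃ t : St X Y, s.le t ∧ t.Γ = s.Γ ∪ α := by
  classical
  have hD := s.H.dom c hc
  have hD' := s.H'.dom c hc
  have hfr : frontier c.1 ⊆ s.Γ := s.H.fr c hc
  have hfr' : frontier c.2 ⊆ s.Γ' := s.H'.fr c hc
  have hse := s.fr c hc
  have haJ := hα.2.2.1
  have hbJ := hα.2.2.2
  have haΓ := hfr haJ
  have hbΓ := hfr hbJ
  obtain ⟨J1, J2, hP⟩ := hD.scc.pair haJ hbJ hα.1.ne
  have hP' : Pair (frontier c.2) (s.h '' J1) (s.h '' J2) (s.h a) (s.h b) := hse ▸ hP.image (s.hc.mono hfr) (s.hi.mono hfr)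
  obtain ⟨u, hu⟩ := hD'.2.2.1
  obtain ⟨α', hα', -⟩ := hD'.crosscut (a := s.h a) (b := s.h b) (hse ▸ mem_image_of_mem _ haJ) (hse ▸ mem_image_of_mem _ hbJ)
    (fun e => hα.1.ne (s.hi haΓ hbΓ e)) hu
  obtain ⟨F1, F2, f1, f2, f3, f4, f5, f6⟩ := hD.theta hP hα
  obtain ⟨G1, G2, g1, g2, g3, g4, g5, g6⟩ := hD'.theta hP' hα'
  obtain ⟨g, gc, gi, gim, ga, gb⟩ := hα.1.homeo hα'.1
  have hαΓ : ∀ x ∈ α, x ∈ s.Γ → x = a ∨ x = b := by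
    intro x hx hxΓ
    exact (hα.2.1 hx).elim (fun h => absurd hxΓ (s.H.dis c hc x h)) id
  have hαΓ' : ∀ x ∈ α', x ∈ s.Γ' → x = s.h a ∨ x = s.h b := by
    intro x hx hxΓ
    exact (hα'.2.1 hx).elim (fun h => absurd hxΓ (s.H'.dis c hc x h)) id
  set k : X → Y := s.Γ.piecewise s.h g with hk
  have k1 : ∀ x ∈ s.Γ, k x = s.h x := fun x hx => piecewise_eq_of_mem _ _ _ hx
  have k2 : ∀ x ∈ α, k x = g x := by
    intro x hx
    by_cases hxΓ : x ∈ s.Γ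
    · rw [k1 x hxΓ]
      rcases hαΓ x hx hxΓ with rfl | rfl
      exacts [ga.symm, gb.symm]
    · exact piecewise_eq_of_notMem _ _ _ hxΓ
  have kim1 : ∀ S ⊆ s.Γ, k '' S = s.h '' S := fun S hS => image_congr fun x hx => k1 x (hS hx)
  have kim2 : k '' α = α' := by rw [← gim]; exact image_congr k2
  have hJ1 : J1 ⊆ s.Γ := (hP.2.2.2 ▸ subset_union_left : J1 ⊆ frontier c.1).trans hfr
  have hJ2 : J2 ⊆ s.Γ := (hP.2.2.2 ▸ subset_union_right : J2 ⊆ frontier c.1).trans hfr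
  have hmix : ∀ x ∈ s.Γ, ∀ y ∈ α, k x = k y → x = y := by
    intro x hx y hy hxy
    suffices hyΓ : y ∈ s.Γ by
      rw [k1 x hx, k1 y hyΓ] at hxy
      exact s.hi hx hyΓ hxy
    have h1 : k y ∈ s.Γ' := by rw [← hxy, k1 x hx, ← s.him]; exact mem_image_of_mem _ hx
    have h2 : k y ∈ α' := kim2 ▸ mem_image_of_mem _ hy
    rcases hαΓ' _ h2 h1 with h | h
    · rw [k2 y hy, ← ga] at h
      rw [gi hy hα.1.left_mem h]; exact haΓ
    · rw [k2 y hy, ← gb] at h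
      rw [gi hy hα.1.right_mem h]; exact hbΓ
  refine ⟨⟨s.Γ ∪ α, s.Γ' ∪ α', k, (s.I \ {c}) ∪ {(F1, G1), (F2, G2)}, s.H.step hc hα hP f1 f2 f3 f4 f5 f6, s.H'.step hc hα' hP' g1 g2 g3 g4 g5 g6,
    (s.fin.sdiff).union (by simp), ?_, ?_, ?_, ?_⟩, ⟨subset_union_left, subset_union_left, ?_⟩, rfl⟩
  · exact ContinuousOn.union_of_isClosed (s.hc.congr k1) (gc.congr k2) s.H.cl hα.1.isClosed
  · rintro x (hx | hx) y (hy | hy) hxy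
    · rw [k1 x hx, k1 y hy] at hxy; exact s.hi hx hy hxy
    · exact hmix x hx y hy hxy
    · exact (hmix y hy x hx hxy.symm).symm
    · rw [k2 x hx, k2 y hy] at hxy; exact gi hx hy hxy
  · rw [image_union, kim1 _ Subset.rfl, s.him, kim2]
  · rintro d (hd | rfl | rfl)
    · rw [kim1 _ (s.H.fr d hd.1)]; exact s.fr d hd.1
    · simp only; rw [f3, g3, image_union, kim1 _ hJ1, kim2]
    · simp only; rw [f4, g4, image_union, kim1 _ hJ2, kim2]
  · rintro d (hd | rfl | rfl)
    · exact ⟨d, hd.1, Subset.rfl, Subset.rfl⟩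
    · exact ⟨c, hc, (f5 ▸ subset_union_left : F1 ⊆ c.1 \ α).trans sdiff_subset, (g5 ▸ subset_union_left : G1 ⊆ c.2 \ α').trans sdiff_subset⟩
    · exact ⟨c, hc, (f5 ▸ subset_union_right : F2 ⊆ c.1 \ α).trans sdiff_subset, (g5 ▸ subset_union_right : G2 ⊆ c.2 \ α').trans sdiff_subset⟩

theorem half_init {ι : Type} {c1 c2 : ι} {f : ι → Set X} (h : JDom (f c1)) (h' : f c2 = (closure (f c1))ᶜ) : Half (frontier (f c1)) {c1, c2} f := by
  have h2 := h.compl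
  rw [← h'] at h2
  have hd : ∀ x ∈ f c1, x ∉ f c2 := fun x hx hx' => by rw [h'] at hx'; exact hx' (subset_closure hx)
  refine ⟨h.scc.isClosed, ?_, ?_, ?_, ?_, ?_, ?_⟩
  · rintro i (rfl | rfl); exacts [h, h2.1]
  · rintro i (rfl | rfl); exacts [Subset.rfl, h2.2.subset]
  · rintro i (rfl | rfl) x hx; exacts [not_mem_frontier h.1 hx, h2.2 ▸ not_mem_frontier h2.1.1 hx]
  · rintro i (hi | hi) j (hj | hj) x hx hx' <;> rw [hi] at hx ⊢ <;> rw [hj] at hx' ⊢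
    · exact absurd hx' (hd x hx)
    · exact absurd hx (hd x hx')
  · intro x hx
    rcases h.mem_cases x with h3 | h3 | h3
    exacts [⟨c1, Or.inl rfl, h3⟩, absurd h3 hx, ⟨c2, Or.inr rfl, h' ▸ h3⟩]
  · intro x
    rcases h.mem_cases x with h3 | h3 | h3
    exacts [⟨c1, Or.inl rfl, subset_closure h3⟩, ⟨c1, Or.inl rfl, frontier_subset_closure h3⟩, ⟨c2, Or.inr rfl, subset_closure (h' ▸ h3)⟩]

variable (X Y) in
theorem St.exists_start : Nonempty (St X Y) := by
  classical
  obtain ⟨F, hF⟩ := exists_jdom X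
  obtain ⟨G, hG⟩ := exists_jdom Y
  obtain ⟨A, B, a, b, hP⟩ := id hF.scc
  obtain ⟨A', B', a', b', hP'⟩ := id hG.scc
  obtain ⟨f, fc, fi, fim, fa, fb⟩ := hP.1.homeo hP'.1
  obtain ⟨g, gc, gi, gim, ga, gb⟩ := hP.2.1.homeo hP'.2.1
  set k : X → Y := A.piecewise f g with hk
  have k1 : ∀ x ∈ A, k x = f x := fun x hx => piecewise_eq_of_mem _ _ _ hx
  have k2 : ∀ x ∈ B, k x = g x := by
    intro x hx
    by_cases hxA : x ∈ A
    · rw [k1 x hxA]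
      have : x ∈ A ∩ B := ⟨hxA, hx⟩
      rw [hP.2.2.1] at this
      rcases this with rfl | rfl
      exacts [fa.trans ga.symm, fb.trans gb.symm]
    · exact piecewise_eq_of_notMem _ _ _ hxA
  have kim1 : k '' A = A' := by rw [← fim]; exact image_congr k1
  have kim2 : k '' B = B' := by rw [← gim]; exact image_congr k2
  have hmix : ∀ x ∈ A, ∀ y ∈ B, k x = k y → x = y := by
    intro x hx y hy hxy
    suffices hyA : y ∈ A by
      rw [k1 x hx, k1 y hyA] at hxy
      exact fi hx hyA hxy
    have : k y ∈ A' ∩ B' := ⟨hxy ▸ kim1 ▸ mem_image_of_mem _ hx, kim2 ▸ mem_image_of_mem _ hy⟩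
    rw [hP'.2.2.1] at this
    rcases this with h | h
    · rw [k2 y hy, ← ga] at h
      rw [gi hy hP.2.1.left_mem h]; exact hP.1.left_mem
    · have h : k y = b' := h
      rw [k2 y hy, ← gb] at h
      rw [gi hy hP.2.1.right_mem h]; exact hP.1.right_mem
  have him : k '' frontier F = frontier G := by
    rw [← hP.2.2.2, image_union, kim1, kim2, hP'.2.2.2]
  refine ⟨⟨frontier F, frontier G, k, {(F, G), ((closure F)ᶜ, (closure G)ᶜ)}, half_init (f := Prod.fst) (c1 := (F, G)) hF rfl,
    half_init (f := Prod.snd) (c1 := (F, G)) hG rfl, by simp, ?_, ?_, him, ?_⟩⟩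
  · rw [← hP.2.2.2]
    exact ContinuousOn.union_of_isClosed (fc.congr k1) (gc.congr k2) hP.1.isClosed hP.2.1.isClosed
  · rw [← hP.2.2.2]
    rintro x (hx | hx) y (hy | hy) hxy
    · rw [k1 x hx, k1 y hy] at hxy; exact fi hx hy hxy
    · exact hmix x hx y hy hxy
    · exact (hmix y hy x hx hxy.symm).symm
    · rw [k2 x hx, k2 y hy] at hxy; exact gi hx hy hxy
  · rintro d (rfl | rfl)
    · exact him
    · simp only; rw [hF.compl.2, hG.compl.2]; exact him

end
end MooreSphere

namespace MooreSphere
open Set Filter Topology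
section
variable {X : Type} [MetricSpace X] [Jan X] {A B C D N U Ap : Set X} {a b p q x y z z' u v : X}

theorem JDom.isPreconnected_compl (h : JDom D) : IsPreconnected Dᶜ := by
  obtain ⟨h1, h2⟩ := h.compl
  have : Dᶜ = closure (closure D)ᶜ := by
    rw [h1.closure_eq, h2]
    ext z
    constructor
    · intro hz
      rcases h.mem_cases z with h' | h' | h'
      exacts [absurd h' hz, Or.inr h', Or.inl h']
    · rintro (hz | hz) hzD
      · exact hz (subset_closure hzD)
      · exact not_mem_frontier h.1 hzD hz
  rw [this]
  exact h1.2.1.closure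

theorem JDom.arc_glue (h : JDom D) (hA : IsClosed A) (hB : IsClosed B) (hAB : A ∩ B ⊆ Dᶜ) (h1 : Conn (D \ A) x y) (h2 : Conn (D \ B) x y) :
    Conn (D \ (A ∪ B)) x y := by
  have := Jan.j1 (Dᶜ ∪ A) (Dᶜ ∪ B) (h.1.isClosed_compl.union hA) (h.1.isClosed_compl.union hB) (by
    rw [← union_inter_distrib_left, union_eq_self_of_subset_right hAB]; exact h.isPreconnected_compl) x y
    (by rwa [compl_union, compl_compl]) (by rwa [compl_union, compl_compl])
  refine this.mono ?_
  intro z hz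
  simp only [mem_compl_iff, mem_union, not_or, not_not, Set.mem_sdiff] at hz ⊢
  exact ⟨hz.1.1, hz.1.2, hz.2.2⟩

theorem JDom.arc_cross (h : JDom D) (hA : IsArc A a b) (ha : a ∉ D) (hb : b ∉ D) (hx : x ∈ D) (hy : y ∈ D)
    (hcr : ∀ α c d, Cross D α c d → α ⊆ A → Conn (D \ α) x y) : Conn (D \ A) x y := by
  obtain ⟨γ, hγ, hi, rfl, rfl, rfl⟩ := hA
  obtain ⟨S, hSD, hSc, hSp, hxS, hyS⟩ := conn_compact h.1 (h.2.1.conn hx hy)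
  set T : Set ℝ := Icc 0 1 ∩ γ ⁻¹' Dᶜ with hT
  have hTc : IsClosed T := isClosed_Icc.inter (h.1.isClosed_compl.preimage hγ)
  have h0T : (0:ℝ) ∈ T := ⟨by simp, ha⟩
  have h1T : (1:ℝ) ∈ T := ⟨by simp, hb⟩
  have hcl : ∀ s t, IsClosed (γ '' Icc s t) := fun s t => (isCompact_Icc.image hγ).isClosed
  -- gluing
  have glue : ∀ s t u, s ∈ T → t ∈ T → u ∈ T → s ≤ t → t ≤ u → Conn (D \ γ '' Icc s t) x y → Conn (D \ γ '' Icc t u) x y → Conn (D \ γ '' Icc s u) x y := by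
    intro s t u hs ht hu hst htu c1 c2
    have := h.arc_glue (hcl s t) (hcl t u) (by
      rw [← hi.image_inter (Icc_subset_Icc hs.1.1 ht.1.2) (Icc_subset_Icc ht.1.1 hu.1.2), Icc_inter_Icc_eq_singleton hst htu, image_singleton, singleton_subset_iff]
      exact ht.2) c1 c2
    rwa [← image_union, Icc_union_Icc_eq_Icc hst htu] at this
  have near : ∀ t ∈ T, ∃ ε > 0, ∀ s s', t - ε < s → s' < t + ε → Conn (D \ γ '' Icc s s') x y := by
    intro t ht
    obtain ⟨ε, hε, hb⟩ := Metric.isOpen_iff.1 (hSc.isClosed.isOpen_compl.preimage hγ) t (fun h => ht.2 (hSD h))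
    refine ⟨ε, hε, fun s s' h1 h2 => ⟨S, fun z hz => ⟨hSD hz, ?_⟩, hSp, hxS, hyS⟩⟩
    rintro ⟨r, hr, rfl⟩
    refine hb ?_ hz
    rw [Metric.mem_ball, Real.dist_eq, abs_lt]
    exact ⟨by linarith [hr.1], by linarith [hr.2]⟩
  have gap : ∀ s ∈ T, ∀ t ∈ T, s < t → (∀ r, s < r → r < t → r ∉ T) → Conn (D \ γ '' Icc s t) x y := by
    intro s hs t ht hst hg
    have hsub : Icc s t ⊆ Icc 0 1 := Icc_subset_Icc hs.1.1 ht.1.2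
    have hin : ∀ r ∈ Ioo s t, γ r ∈ D := by
      intro r hr
      by_contra hrD
      exact hg r hr.1 hr.2 ⟨hsub ⟨hr.1.le, hr.2.le⟩, hrD⟩
    have hcl : γ '' Icc s t ⊆ closure D := by
      rw [← closure_Ioo hst.ne]
      exact (image_closure_subset_closure_image hγ).trans (closure_mono (image_subset_iff.2 hin))
    have hfr : ∀ r ∈ Icc s t, γ r ∉ D → γ r ∈ frontier D := fun r hr hrD => by
      rw [h.1.frontier_eq]; exact ⟨hcl (mem_image_of_mem _ hr), hrD⟩
    refine hcr _ (γ s) (γ t) ⟨isArc_of_interval hst hγ.continuousOn (hi.mono hsub), ?_, hfr s ⟨le_rfl, hst.le⟩ hs.2, hfr t ⟨hst.le, le_rfl⟩ ht.2⟩ (image_mono hsub)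
    rintro _ ⟨r, hr, rfl⟩
    rcases eq_or_lt_of_le hr.1 with e | e
    · right; left; rw [e]
    · rcases eq_or_lt_of_le hr.2 with e' | e'
      · right; right; rw [e']; rfl
      · left; exact hin r ⟨e, e'⟩
  set Q : Set ℝ := {t | t ∈ T ∧ Conn (D \ γ '' Icc 0 t) x y} with hQ
  have h0Q : (0:ℝ) ∈ Q := by
    refine ⟨h0T, S, fun z hz => ⟨hSD hz, ?_⟩, hSp, hxS, hyS⟩
    rw [Icc_self, image_singleton]
    rintro rfl
    exact ha (hSD hz)
  have hbd : BddAbove Q := ⟨1, fun t ht => ht.1.1.2⟩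
  have hτT : sSup Q ∈ T := by
    have := csSup_mem_closure ⟨0, h0Q⟩ hbd
    have h2 := closure_mono (show Q ⊆ T from fun t ht => ht.1) this
    rwa [hTc.closure_eq] at h2
  set τ := sSup Q with hτ
  have hτQ : τ ∈ Q := by
    refine ⟨hτT, ?_⟩
    obtain ⟨ε, hε, hn⟩ := near τ hτT
    obtain ⟨t, ht, htτ⟩ := exists_lt_of_lt_csSup ⟨0, h0Q⟩ (show τ - ε < sSup Q by rw [← hτ]; linarith)
    exact glue 0 t τ h0T ht.1 hτT ht.1.1.1 (le_csSup hbd ht) ht.2 (hn t τ htτ (by linarith))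
  have hstep : ∀ t ∈ T, τ < t → ¬ Conn (D \ γ '' Icc τ t) x y := fun t ht hlt hc =>
    absurd (le_csSup hbd (show t ∈ Q from ⟨ht, glue 0 τ t h0T hτT ht hτT.1.1 hlt.le hτQ.2 hc⟩)) (not_le.2 hlt)
  rcases eq_or_lt_of_le hτT.1.2 with e | e
  · rw [e] at hτQ; exact hτQ.2
  · exfalso
    obtain ⟨ε, hε, hn⟩ := near τ hτT
    have hno : ∀ r, τ < r → r < τ + ε → r ∉ T := fun r h1 h2 h3 => hstep r h3 h1 (hn τ r (by linarith) h2)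
    have hne : (T ∩ Ici (τ + ε)).Nonempty := ⟨1, h1T, by
      by_contra hlt
      exact hno 1 e (not_le.1 hlt) h1T⟩
    have hbb : BddBelow (T ∩ Ici (τ + ε)) := ⟨τ + ε, fun r hr => hr.2⟩
    have hmem := (hTc.inter isClosed_Ici).csInf_mem hne hbb
    have hlt : τ < sInf (T ∩ Ici (τ + ε)) := lt_of_lt_of_le (by linarith) hmem.2
    refine hstep _ hmem.1 hlt (gap τ hτT _ hmem.1 hlt ?_)
    intro r h1 h2 h3
    by_cases hr : r < τ + ε
    · exact hno r h1 hr h3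
    · exact absurd (csInf_le hbb ⟨h3, not_lt.1 hr⟩) (not_le.2 h2)

theorem JDom.scc_cross (h : JDom D) (hC : Scc C) (hp : p ∈ C) (hq : q ∈ C) (hpq : p ≠ q) (hpD : p ∉ D) (hqD : q ∉ D) (hx : x ∈ D) (hy : y ∈ D)
    (hn : ¬ Conn Cᶜ x y) : ∃ α c d, Cross D α c d ∧ α ⊆ C ∧ ¬ Conn (D \ α) x y := by
  by_contra! hcon
  obtain ⟨A, B, hP⟩ := hC.pair hp hq hpq
  have hAC : A ⊆ C := hP.2.2.2 ▸ subset_union_left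
  have hBC : B ⊆ C := hP.2.2.2 ▸ subset_union_right
  have h1 := h.arc_cross hP.1 hpD hqD hx hy (fun α c d h1 h2 => hcon α c d h1 (h2.trans hAC))
  have h2 := h.arc_cross hP.2.1 hpD hqD hx hy (fun α c d h1 h2 => hcon α c d h1 (h2.trans hBC))
  have := h.arc_glue hP.1.isClosed hP.2.1.isClosed (by
    rw [hP.2.2.1]; rintro z (rfl | rfl); exacts [hpD, hqD]) h1 h2
  rw [hP.2.2.2] at this
  exact hn (this.mono fun z hz => hz.2)

theorem JDom.local_conn (h : JDom D) (hU : IsOpen U) (ha : a ∈ U) : ∃ V, IsOpen V ∧ a ∈ V ∧ ∀ x ∈ V ∩ D, ∀ y ∈ V ∩ D, Conn (U ∩ D) x y := by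
  rcases h.mem_cases a with h1 | h1 | h1
  · refine ⟨face (U ∩ D) a, isOpen_face (hU.inter h.1), self_mem_face ⟨ha, h1⟩, ?_⟩
    rintro x ⟨hx, -⟩ y ⟨hy, -⟩
    exact (Conn.symm hx).trans hy
  · obtain ⟨V, h2, h3, h4, h5⟩ := (h.scc.ln h1).ulc h.scc.isClosed hU ha
    refine ⟨V, h2, h3, ?_⟩
    rintro x ⟨hx, hxD⟩ y ⟨hy, hyD⟩
    obtain ⟨S, k1, k2, k3, k4⟩ := h5 x ⟨hx, not_mem_frontier h.1 hxD⟩ y ⟨hy, not_mem_frontier h.1 hyD⟩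
      ((h.2.1.conn hxD hyD).mono fun z hz => not_mem_frontier h.1 hz)
    have := subset_of_frontier k2 h.1 (fun z hz => (k1 hz).2) k3 hxD
    exact ⟨S, fun z hz => ⟨(k1 hz).1, this hz⟩, k2, k3, k4⟩
  · refine ⟨(closure D)ᶜ, isClosed_closure.isOpen_compl, h1, ?_⟩
    rintro x ⟨hx, hxD⟩
    exact absurd (subset_closure hxD) hx

theorem JDom.finite_net (h : JDom D) (hU : IsOpen U) (hA : IsCompact A) (hAU : A ⊆ U) :
    ∃ Z : Set X, Z.Finite ∧ Z ⊆ U ∧ ∀ x ∈ A ∩ D, ∃ z ∈ Z, Conn (U ∩ D) x z := by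
  have key : ∀ N ⊆ A, N = N → True := fun _ _ _ => trivial
  refine hA.induction_on (p := fun N => ∃ Z : Set X, Z.Finite ∧ Z ⊆ U ∧ ∀ x ∈ N ∩ D, ∃ z ∈ Z, Conn (U ∩ D) x z) ?_ ?_ ?_ ?_
  · exact ⟨∅, finite_empty, empty_subset _, by simp⟩
  · rintro s t hst ⟨Z, h1, h2, h3⟩
    exact ⟨Z, h1, h2, fun x hx => h3 x ⟨hst hx.1, hx.2⟩⟩
  · rintro s t ⟨Z, h1, h2, h3⟩ ⟨Z', h1', h2', h3'⟩
    refine ⟨Z ∪ Z', h1.union h1', union_subset h2 h2', ?_⟩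
    rintro x ⟨hx | hx, hxD⟩
    · obtain ⟨z, hz, hc⟩ := h3 x ⟨hx, hxD⟩; exact ⟨z, Or.inl hz, hc⟩
    · obtain ⟨z, hz, hc⟩ := h3' x ⟨hx, hxD⟩; exact ⟨z, Or.inr hz, hc⟩
  · intro a ha
    obtain ⟨V, h1, h2, h3⟩ := h.local_conn hU (hAU ha)
    refine ⟨V, mem_nhdsWithin_of_mem_nhds (h1.mem_nhds h2), ?_⟩
    by_cases hne : (V ∩ D ∩ U).Nonempty
    · obtain ⟨z, hz, hzU⟩ := hne
      exact ⟨{z}, finite_singleton z, by simpa using hzU, fun x hx => ⟨z, rfl, h3 x hx z hz⟩⟩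
    · refine ⟨∅, finite_empty, empty_subset _, fun x hx => absurd ⟨x, hx, ?_⟩ hne⟩
      exact (h3 x hx x hx).mem_left.1

variable {Y : Type} [MetricSpace Y] [Jan Y]

theorem St.hit (s : St X Y) (p : X) : ∃ t : St X Y, s.le t ∧ p ∈ t.Γ := by
  by_cases hp : p ∈ s.Γ
  · exact ⟨s, s.le_refl, hp⟩
  · obtain ⟨c, hc, hpc⟩ := s.H.cov p hp
    have hD := s.H.dom c hc
    obtain ⟨J1, J2, a, b, hP⟩ := id hD.scc
    obtain ⟨α, hα, hpα⟩ := hD.crosscut (hP.2.2.2 ▸ Or.inl hP.1.left_mem) (hP.2.2.2 ▸ Or.inl hP.1.right_mem) hP.1.ne hpc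
    obtain ⟨t, ht, hΓ⟩ := s.step hc hα
    exact ⟨t, ht, hΓ ▸ Or.inr hpα⟩

theorem St.separate_one (s : St X Y) (hC : Scc C) (hp : p ∈ C ∩ s.Γ) (hq : q ∈ C ∩ s.Γ) (hpq : p ≠ q) (hn : ¬ Conn Cᶜ z z') :
    ∃ t : St X Y, s.le t ∧ t.Γ ⊆ s.Γ ∪ C ∧ ∀ c ∈ t.I, ¬ (z ∈ c.1 ∧ z' ∈ c.1) := by
  by_cases hc : ∃ c ∈ s.I, z ∈ c.1 ∧ z' ∈ c.1
  · obtain ⟨c, hc, hz, hz'⟩ := hc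
    obtain ⟨α, a, b, h1, h2, h3⟩ := (s.H.dom c hc).scc_cross hC hp.1 hq.1 hpq (fun h => s.H.dis c hc _ h hp.2) (fun h => s.H.dis c hc _ h hq.2) hz hz' hn
    obtain ⟨t, ht, hΓ⟩ := s.step hc h1
    refine ⟨t, ht, hΓ ▸ union_subset_union_right _ h2, ?_⟩
    rintro e he ⟨k1, k2⟩
    obtain ⟨d, hd, k3, -⟩ := ht.2.2 e he
    obtain rfl : d = c := s.H.ov d hd c hc z (k3 k1) hz
    refine h3 ⟨e.1, fun w hw => ⟨k3 hw, fun hw' => t.H.dis e he w hw (hΓ ▸ Or.inr hw')⟩, (t.H.dom e he).2.1, k1, k2⟩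
  · push Not at hc
    exact ⟨s, s.le_refl, subset_union_left, fun c h h' => hc c h h'.1 h'.2⟩

theorem St.separate_many (hC : Scc C) (hpq : p ≠ q) (hpC : p ∈ C) (hqC : q ∈ C) (Z : Set (X × X)) (hZ : Z.Finite) : (∀ w ∈ Z, ¬ Conn Cᶜ w.1 w.2) →
    ∀ s : St X Y, p ∈ s.Γ → q ∈ s.Γ → ∃ t : St X Y, s.le t ∧ t.Γ ⊆ s.Γ ∪ C ∧ ∀ w ∈ Z, ∀ c ∈ t.I, ¬ (w.1 ∈ c.1 ∧ w.2 ∈ c.1) := by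
  induction Z, hZ using Set.Finite.induction_on with
  | empty => exact fun _ s _ _ => ⟨s, s.le_refl, subset_union_left, by simp⟩
  | @insert w Z hw hZ ih =>
    intro hn s hp hq
    obtain ⟨t, h1, h2, h3⟩ := ih (fun w hw => hn w (Or.inr hw)) s hp hq
    obtain ⟨t', h1', h2', h3'⟩ := t.separate_one hC ⟨hpC, h1.1 hp⟩ ⟨hqC, h1.1 hq⟩ hpq (hn w (Or.inl rfl))
    refine ⟨t', St.le_trans h1 h1', h2'.trans (union_subset h2 subset_union_right), ?_⟩
    rintro w' (rfl | hw') c hc ⟨k1, k2⟩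
    · exact h3' c hc ⟨k1, k2⟩
    · obtain ⟨d, hd, k3, -⟩ := h1'.2.2 c hc
      exact h3 w' hw' d hd ⟨k3 k1, k3 k2⟩

theorem St.separate_sets (hC : Scc C) (hA : IsCompact A) (hB : IsCompact B) (hAu : A ⊆ face Cᶜ u) (hBv : B ⊆ face Cᶜ v) (hn : ¬ Conn Cᶜ u v) (s0 : St X Y) :
    ∃ t : St X Y, s0.le t ∧ ∀ c ∈ t.I, ∀ x ∈ c.1, ∀ y ∈ c.1, x ∈ A → y ∈ B → False := by
  obtain ⟨p, q, hpC, hqC, hpq⟩ : ∃ p q, p ∈ C ∧ q ∈ C ∧ p ≠ q := by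
    obtain ⟨A, B, a, b, hP⟩ := hC
    exact ⟨a, b, hP.2.2.2 ▸ Or.inl hP.1.left_mem, hP.2.2.2 ▸ Or.inl hP.1.right_mem, hP.1.ne⟩
  obtain ⟨s1, l1, hp⟩ := s0.hit p
  obtain ⟨s, l2, hq⟩ := s1.hit q
  have hp := l2.1 hp
  have hoA : IsOpen (face Cᶜ u) := isOpen_face hC.isClosed.isOpen_compl
  have hoB : IsOpen (face Cᶜ v) := isOpen_face hC.isClosed.isOpen_compl
  have netA : ∀ c : s.I, ∃ Z : Set X, Z.Finite ∧ Z ⊆ face Cᶜ u ∧ ∀ x ∈ A ∩ c.1.1, ∃ z ∈ Z, Conn (face Cᶜ u ∩ c.1.1) x z := fun c => (s.H.dom c.1 c.2).finite_net hoA hA hAu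
  have netB : ∀ c : s.I, ∃ Z : Set X, Z.Finite ∧ Z ⊆ face Cᶜ v ∧ ∀ x ∈ B ∩ c.1.1, ∃ z ∈ Z, Conn (face Cᶜ v ∩ c.1.1) x z := fun c => (s.H.dom c.1 c.2).finite_net hoB hB hBv
  choose ZA a1 a2 a3 using netA
  choose ZB b1 b2 b3 using netB
  have := s.fin.to_subtype
  obtain ⟨t, l3, hΓ, ht⟩ := St.separate_many (Y := Y) hC hpq hpC hqC ((⋃ c, ZA c) ×ˢ (⋃ c, ZB c)) ((finite_iUnion a1).prod (finite_iUnion b1)) (by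
    rintro ⟨z, z'⟩ ⟨hz, hz'⟩ hc
    obtain ⟨c, hz⟩ := mem_iUnion.1 hz
    obtain ⟨c', hz'⟩ := mem_iUnion.1 hz'
    exact hn ((show Conn Cᶜ u z from a2 c hz).trans (Conn.trans hc (Conn.symm (b2 c' hz')))) ) s hp hq
  refine ⟨t, St.le_trans (St.le_trans l1 l2) l3, ?_⟩
  intro c hc x hx y hy hxA hyB
  obtain ⟨d, hd, k1, -⟩ := l3.2.2 c hc
  obtain ⟨z, hz, hxz⟩ := a3 ⟨d, hd⟩ x ⟨hxA, k1 hx⟩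
  obtain ⟨z', hz', hyz⟩ := b3 ⟨d, hd⟩ y ⟨hyB, k1 hy⟩
  have hgo : ∀ w x z, x ∈ c.1 → Conn (face Cᶜ w ∩ d.1) x z → z ∈ c.1 := by
    rintro w x z hx ⟨S, h1, h2, h3, h4⟩
    refine subset_of_frontier h2 (t.H.dom c hc).1 ?_ h3 hx h4
    intro r hr hrf
    rcases hΓ (t.H.fr c hc hrf) with h | h
    · exact s.H.dis d hd r (h1 hr).2 h
    · exact face_subset (h1 hr).1 h
  exact ht (z, z') ⟨mem_iUnion.2 ⟨_, hz⟩, mem_iUnion.2 ⟨_, hz'⟩⟩ c hc ⟨hgo u x z hx hxz, hgo v y z' hy hyz⟩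

theorem St.mesh (s : St X Y) {ε : ℝ} (hε : 0 < ε) : ∃ t : St X Y, s.le t ∧ ∀ c ∈ t.I, ∀ x ∈ c.1, ∀ y ∈ c.1, dist x y < ε := by
  have hK : IsCompact {w : X × X | ε ≤ dist w.1 w.2} := (isClosed_le continuous_const (by fun_prop)).isCompact
  have key := hK.induction_on (p := fun N => ∀ s : St X Y, ∃ t : St X Y, s.le t ∧ ∀ c ∈ t.I, ∀ x ∈ c.1, ∀ y ∈ c.1, (x, y) ∉ N) ?_ ?_ ?_ ?_
  · obtain ⟨t, h1, h2⟩ := key s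
    exact ⟨t, h1, fun c hc x hx y hy => not_le.1 (h2 c hc x hx y hy)⟩
  · exact fun s => ⟨s, s.le_refl, by simp⟩
  · intro N N' hNN h s
    obtain ⟨t, h1, h2⟩ := h s
    exact ⟨t, h1, fun c hc x hx y hy h => h2 c hc x hx y hy (hNN h)⟩
  · intro N N' h h' s
    obtain ⟨t, h1, h2⟩ := h s
    obtain ⟨t', h1', h2'⟩ := h' t
    refine ⟨t', St.le_trans h1 h1', fun c hc x hx y hy => ?_⟩
    rintro (k | k)
    · obtain ⟨d, hd, k1, -⟩ := h1'.2.2 c hc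
      exact h2 d hd x (k1 hx) y (k1 hy) k
    · exact h2' c hc x hx y hy k
  · rintro ⟨u, v⟩ huv
    have huv' : u ≠ v := by
      rintro rfl
      have : ε ≤ dist u u := huv
      rw [dist_self] at this; linarith
    obtain ⟨C, hC, hu, hv, hn⟩ := exists_separating huv'
    have hoA : IsOpen (face Cᶜ u) := isOpen_face hC.isClosed.isOpen_compl
    have hoB : IsOpen (face Cᶜ v) := isOpen_face hC.isClosed.isOpen_compl
    obtain ⟨r, hr, hrA⟩ := Metric.nhds_basis_closedBall.mem_iff.1 (hoA.mem_nhds (self_mem_face hu))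
    obtain ⟨r', hr', hrB⟩ := Metric.nhds_basis_closedBall.mem_iff.1 (hoB.mem_nhds (self_mem_face hv))
    refine ⟨Metric.closedBall u r ×ˢ Metric.closedBall v r', mem_nhdsWithin_of_mem_nhds (prod_mem_nhds (Metric.closedBall_mem_nhds u hr) (Metric.closedBall_mem_nhds v hr')), fun s => ?_⟩
    obtain ⟨t, h1, h2⟩ := s.separate_sets hC (Metric.isClosed_closedBall.isCompact) (Metric.isClosed_closedBall.isCompact) hrA hrB hn
    exact ⟨t, h1, fun c hc x hx y hy h => h2 c hc x hx y hy h.1 h.2⟩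

theorem St.mesh' (s : St X Y) {ε : ℝ} (hε : 0 < ε) : ∃ t : St X Y, s.le t ∧ (∀ c ∈ t.I, ∀ x ∈ c.1, ∀ y ∈ c.1, dist x y < ε) ∧
    (∀ c ∈ t.I, ∀ x ∈ c.2, ∀ y ∈ c.2, dist x y < ε) := by
  have n1 := (Jan.nontriv (X := X)).to_nonempty
  have n2 := (Jan.nontriv (X := Y)).to_nonempty
  obtain ⟨t, h1, h2⟩ := s.mesh hε
  obtain ⟨t', e1, e2, e3⟩ := t.exists_swap
  obtain ⟨w, k1, k2⟩ := t'.mesh hε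
  obtain ⟨w', f1, f2, f3⟩ := w.exists_swap
  have hl : t.le w' := by
    refine ⟨?_, ?_, ?_⟩
    · rw [f1, ← e2]; exact k1.2.1
    · rw [f2, ← e1]; exact k1.1
    · rw [f3]
      rintro _ ⟨c, hc, rfl⟩
      obtain ⟨d, hd, l1, l2⟩ := k1.2.2 c hc
      rw [e3] at hd
      obtain ⟨d, hd, rfl⟩ := hd
      exact ⟨d, hd, l2, l1⟩
  refine ⟨w', St.le_trans h1 hl, ?_, ?_⟩
  · intro c hc x hx y hy
    obtain ⟨d, hd, l1, l2⟩ := hl.2.2 c hc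
    exact h2 d hd x (l1 hx) y (l1 hy)
  · rw [f3]
    rintro _ ⟨c, hc, rfl⟩
    exact k2 c hc

end
end MooreSphere

namespace MooreSphere
open Set Filter Topology
section
variable {X Y : Type} [MetricSpace X] [MetricSpace Y] [CompactSpace X] [CompactSpace Y] {ι : Type}

/-- the relation at one stage -/
def RelAt (I : Set ι) (f : ι → Set X) (g : ι → Set Y) : Set (X × Y) := {p | ∃ c ∈ I, p.1 ∈ closure (f c) ∧ p.2 ∈ closure (g c)}

theorem isClosed_relAt {I : Set ι} (hI : I.Finite) (f : ι → Set X) (g : ι → Set Y) : IsClosed (RelAt I f g) := by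
  have : RelAt I f g = ⋃ c ∈ I, closure (f c) ×ˢ closure (g c) := by
    ext p; simp only [RelAt, mem_ofPred_eq, mem_iUnion, mem_prod, exists_prop]
  rw [this]
  exact hI.isClosed_biUnion fun c _ => isClosed_closure.prod isClosed_closure

theorem limit_unique (I : ℕ → Set ι) (f : ι → Set X) (g : ι → Set Y) (hfin : ∀ n, (I n).Finite)
    (hd : ∀ n x, ∃ c ∈ I n, x ∈ closure (f c)) (hg : ∀ n, ∀ c ∈ I n, (g c).Nonempty)
    (hnest : ∀ n, ∀ c ∈ I (n+1), ∃ d ∈ I n, f c ⊆ f d ∧ g c ⊆ g d)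
    (htouch : ∀ n, ∀ c ∈ I n, ∀ d ∈ I n, ∀ x ∈ closure (f c), x ∈ closure (f d) → (closure (g c) ∩ closure (g d)).Nonempty)
    (hm : ∀ n, ∀ c ∈ I (n+1), ∀ x ∈ g c, ∀ y ∈ g c, dist x y < 1 / ((n:ℝ)+1)) (x : X) :
    ∃! y, ∀ n, (x, y) ∈ RelAt (I n) f g := by
  have hcl : ∀ n, IsClosed {y | (x, y) ∈ RelAt (I n) f g} := fun n =>
    (isClosed_relAt (hfin n) f g).preimage (Continuous.prodMk_right x)
  obtain ⟨y, hy⟩ := IsCompact.nonempty_iInter_of_sequence_nonempty_isCompact_isClosed (fun n => {y | (x, y) ∈ RelAt (I n) f g})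
    (fun n y hy => by
      obtain ⟨c, hc, h1, h2⟩ := hy
      obtain ⟨d, hd, h3, h4⟩ := hnest n c hc
      exact ⟨d, hd, closure_mono h3 h1, closure_mono h4 h2⟩)
    (fun n => by
      obtain ⟨c, hc, h⟩ := hd n x
      obtain ⟨y, hy⟩ := hg n c hc
      exact ⟨y, c, hc, h, subset_closure hy⟩) (hcl 0).isCompact hcl
  refine ⟨y, fun n => mem_iInter.1 hy n, fun z hz => ?_⟩
  have hm' : ∀ n, ∀ c ∈ I (n+1), ∀ x ∈ closure (g c), ∀ y ∈ closure (g c), dist x y ≤ 1 / ((n:ℝ)+1) := by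
    intro n c hc u hu v hv
    have h : (u, v) ∈ closure (g c ×ˢ g c) := by rw [closure_prod_eq]; exact ⟨hu, hv⟩
    have hcl : IsClosed {p : Y × Y | dist p.1 p.2 ≤ 1 / ((n:ℝ)+1)} := isClosed_le (by fun_prop) continuous_const
    exact closure_minimal (fun p hp => (hm n c hc p.1 hp.1 p.2 hp.2).le) hcl h
  have key : ∀ n : ℕ, dist z y ≤ 2 * (1 / ((n:ℝ)+1)) := by
    intro n
    obtain ⟨c, hc, h1, h2⟩ := hz (n+1)
    obtain ⟨d, hd, h3, h4⟩ := mem_iInter.1 hy (n+1)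
    obtain ⟨w, hw1, hw2⟩ := htouch (n+1) c hc d hd x h1 h3
    have := hm' n c hc z h2 w hw1
    have := hm' n d hd w hw2 y h4
    linarith [dist_triangle z w y]
  have hlim : Tendsto (fun n : ℕ => 2 * (1 / ((n:ℝ)+1))) atTop (𝓝 (2 * 0)) := tendsto_one_div_add_atTop_nhds_zero_nat.const_mul 2
  have : dist z y ≤ 2 * 0 := ge_of_tendsto' hlim key
  exact dist_le_zero.1 (by simpa using this)

theorem homeo_of_relation (R : Set (X × Y)) (hR : IsClosed R) (h1 : ∀ x, ∃! y, (x, y) ∈ R) (h2 : ∀ y, ∃! x, (x, y) ∈ R) : Nonempty (X ≃ₜ Y) := by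
  choose f hf hfu using h1
  choose g hg hgu using h2
  have hcont : Continuous f := by
    rw [continuous_iff_isClosed]
    intro Z hZ
    have : f ⁻¹' Z = Prod.fst '' (R ∩ Prod.snd ⁻¹' Z) := by
      ext x
      constructor
      · intro hx
        exact ⟨(x, f x), ⟨hf x, hx⟩, rfl⟩
      · rintro ⟨⟨x, y⟩, ⟨h, hy⟩, rfl⟩
        have : y = f x := hfu x y h
        exact this ▸ hy
    rw [this]
    exact ((hR.inter (hZ.preimage continuous_snd)).isCompact.image continuous_fst).isClosed
  let e : X ≃ Y := ⟨f, g, fun x => (hgu (f x) x (hf x)).symm, fun y => (hfu (g y) y (hg y)).symm⟩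
  exact ⟨Continuous.homeoOfEquivCompactToT2 (f := e) hcont⟩

end
section
variable {X Y : Type} [MetricSpace X] [MetricSpace Y]

theorem Half.same_or {ι : Type} {Γ : Set X} {I : Set ι} {f : ι → Set X} (H : Half Γ I f) {c d : ι} (hc : c ∈ I) (hd : d ∈ I) {x : X}
    (h1 : x ∈ closure (f c)) (h2 : x ∈ closure (f d)) : c = d ∨ (x ∈ frontier (f c) ∧ x ∈ frontier (f d)) := by
  have aux : ∀ c ∈ I, ∀ d ∈ I, x ∈ f c → x ∈ closure (f d) → c = d := by
    intro c hc d hd h1 h2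
    obtain ⟨z, hz, hz'⟩ := mem_closure_iff.1 h2 _ (H.dom c hc).isOpen h1
    exact H.ov c hc d hd z hz hz'
  by_cases k1 : x ∈ f c
  · exact Or.inl (aux c hc d hd k1 h2)
  by_cases k2 : x ∈ f d
  · exact Or.inl (aux d hd c hc k2 h1).symm
  rw [(H.dom c hc).closure_eq] at h1
  rw [(H.dom d hd).closure_eq] at h2
  exact Or.inr ⟨h1.resolve_left k1, h2.resolve_left k2⟩

theorem St.touch (s : St X Y) {c d : Set X × Set Y} (hc : c ∈ s.I) (hd : d ∈ s.I) {x : X} (h1 : x ∈ closure c.1) (h2 : x ∈ closure d.1) :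
    (closure c.2 ∩ closure d.2).Nonempty := by
  rcases s.H.same_or hc hd h1 h2 with rfl | ⟨k1, k2⟩
  · obtain ⟨y, hy⟩ := (s.H'.dom c hc).2.2.1
    exact ⟨y, subset_closure hy, subset_closure hy⟩
  · refine ⟨s.h x, frontier_subset_closure ?_, frontier_subset_closure ?_⟩
    · rw [← s.fr c hc]; exact mem_image_of_mem _ k1
    · rw [← s.fr d hd]; exact mem_image_of_mem _ k2

theorem St.touch' (s : St X Y) {c d : Set X × Set Y} (hc : c ∈ s.I) (hd : d ∈ s.I) {y : Y} (h1 : y ∈ closure c.2) (h2 : y ∈ closure d.2) :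
    (closure c.1 ∩ closure d.1).Nonempty := by
  rcases s.H'.same_or hc hd h1 h2 with rfl | ⟨k1, k2⟩
  · obtain ⟨y, hy⟩ := (s.H.dom c hc).2.2.1
    exact ⟨y, subset_closure hy, subset_closure hy⟩
  · rw [← s.fr c hc] at k1
    rw [← s.fr d hd] at k2
    obtain ⟨x, hx, e⟩ := k1
    obtain ⟨x', hx', e'⟩ := k2
    have : x = x' := s.hi (s.H.fr c hc hx) (s.H.fr d hd hx') (e.trans e'.symm)
    subst this
    exact ⟨x, frontier_subset_closure hx, frontier_subset_closure hx'⟩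

variable (X Y) in
theorem jan_homeo [Jan X] [Jan Y] : Nonempty (X ≃ₜ Y) := by
  obtain ⟨s0⟩ := St.exists_start X Y
  have step : ∀ (n : ℕ) (s : St X Y), ∃ t : St X Y, s.le t ∧ (∀ c ∈ t.I, ∀ x ∈ c.1, ∀ y ∈ c.1, dist x y < 1 / ((n:ℝ)+1)) ∧
    (∀ c ∈ t.I, ∀ x ∈ c.2, ∀ y ∈ c.2, dist x y < 1 / ((n:ℝ)+1)) := fun n s => s.mesh' (by positivity)
  choose F hF1 hF2 hF3 using step
  let S : ℕ → St X Y := fun n => Nat.rec s0 (fun n s => F n s) n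
  have hS : ∀ n, S (n+1) = F n (S n) := fun n => rfl
  have u1 := limit_unique (fun n => (S n).I) Prod.fst Prod.snd (fun n => (S n).fin) (fun n => (S n).H.dense)
    (fun n c hc => ((S n).H'.dom c hc).2.2.1) (fun n => (hF1 n (S n)).2.2) (fun n c hc d hd x => (S n).touch hc hd) (fun n => hF3 n (S n))
  have u2 := limit_unique (fun n => (S n).I) Prod.snd Prod.fst (fun n => (S n).fin) (fun n => (S n).H'.dense)
    (fun n c hc => ((S n).H.dom c hc).2.2.1) (fun n c hc => by
      obtain ⟨d, hd, h1, h2⟩ := (hF1 n (S n)).2.2 c hc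
      exact ⟨d, hd, h2, h1⟩) (fun n c hc d hd x => (S n).touch' hc hd) (fun n => hF2 n (S n))
  refine homeo_of_relation (⋂ n, RelAt (S n).I Prod.fst Prod.snd) (isClosed_iInter fun n => isClosed_relAt (S n).fin _ _) ?_ ?_
  · intro x
    simpa only [mem_iInter] using u1 x
  · intro y
    obtain ⟨x, hx, hu⟩ := u2 y
    refine ⟨x, mem_iInter.2 fun n => ?_, fun x' hx' => hu x' fun n => ?_⟩
    · obtain ⟨c, hc, h1, h2⟩ := hx n
      exact ⟨c, hc, h2, h1⟩
    · obtain ⟨c, hc, h1, h2⟩ := mem_iInter.1 hx' n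
      exact ⟨c, hc, h2, h1⟩

end
end MooreSphere

namespace MooreSphere
open Set Filter Topology
open OnePoint

theorem finite_roots {m : ℤ} (hm : m ≠ 0) (a : ℂ) : {z : ℂ | z ^ m = a}.Finite := by
  have nat : ∀ n : ℕ, n ≠ 0 → ∀ a : ℂ, {z : ℂ | z ^ n = a}.Finite := by
    intro n hn a
    refine (Polynomial.nthRoots n a).toFinset.finite_toSet.subset fun z hz => ?_
    simp only [Finset.mem_coe, Multiset.mem_toFinset]
    exact (Polynomial.mem_nthRoots (Nat.pos_of_ne_zero hn)).2 hz
  obtain ⟨n, rfl | rfl⟩ := m.eq_nat_or_neg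
  · simpa using nat n (by simpa using hm) a
  · refine (nat n (by simpa using hm) a⁻¹).subset fun z hz => ?_
    have hz : z ^ (-(n:ℤ)) = a := hz
    show z ^ n = a⁻¹
    rw [← hz]; simp

theorem root_const {S : Set ℂ} (hS : IsPreconnected S) {u : ℂ → ℂ} (hu : ContinuousOn u S) {m : ℤ} (hm : m ≠ 0) {a : ℂ}
    (h : ∀ z ∈ S, u z ^ m = a) {x y : ℂ} (hx : x ∈ S) (hy : y ∈ S) : u x = u y := by
  exact hS.constant_of_mapsTo (finite_roots hm a).isDiscrete hu (T := {z : ℂ | z ^ m = a}) (fun z hz => h z hz) hx hy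

theorem good_pow {K : Set ℂ} (hK : IsCompact K) (h0 : (0:ℂ) ∉ K)
    (hconn : ∀ x : ℂ, x ∉ K → Conn ((↑) '' K : Set (OnePoint ℂ))ᶜ (x : OnePoint ℂ) ((0:ℂ) : OnePoint ℂ) ∨ Conn ((↑) '' K : Set (OnePoint ℂ))ᶜ (x : OnePoint ℂ) ∞)
    {f : ℂ → ℂ} (hf : Good K f) : ∃ n : ℤ, HasLog K (fun z => f z * z ^ n) := by
  have hz0 : ∀ z ∈ K, z ≠ 0 := fun z hz h => h0 (h ▸ hz)
  induction hf with
  | log f h => exact ⟨0, by simpa using h⟩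
  | lin x hx =>
    rcases hconn x hx with h | h
    · exact ⟨-1, (conn_hasLog hK h).congr fun z hz => by simp [qf]⟩
    · exact ⟨0, (conn_hasLog hK h).congr fun z hz => by simp [qf]⟩
  | mul f g hf hg h1 h2 =>
    obtain ⟨n, h1⟩ := h1
    obtain ⟨m, h2⟩ := h2
    exact ⟨n + m, (h1.mul h2).congr fun z hz => by rw [zpow_add₀ (hz0 z hz)]; ring⟩
  | inv f hf h1 =>
    obtain ⟨n, h1⟩ := h1
    exact ⟨-n, h1.inv.congr fun z hz => by rw [zpow_neg, mul_inv]⟩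
  | congr f g hf h h1 =>
    obtain ⟨n, h1⟩ := h1
    exact ⟨n, h1.congr fun z hz => by rw [h z hz]⟩

theorem isPreconnected_circle : IsPreconnected (Metric.sphere (0:ℂ) 1) :=
  isPreconnected_sphere (by simp [Complex.rank_real_complex]) _ _

theorem hasLog_circle_pow {m : ℤ} (h : HasLog (Metric.sphere (0:ℂ) 1) (fun z => z ^ m)) : m = 0 := by
  by_contra hm
  have hmC : (m : ℂ) ≠ 0 := by exact_mod_cast hm
  obtain ⟨l, hl, h⟩ := h
  have hz0 : ∀ z ∈ Metric.sphere (0:ℂ) 1, z ≠ 0 := by rintro z hz rfl; simp at hz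
  have hcu : ContinuousOn (fun z => z * Complex.exp (-(l z / m))) (Metric.sphere (0:ℂ) 1) :=
    continuousOn_id.mul (Complex.continuous_exp.comp_continuousOn (hl.div_const _).neg)
  have hu : ∀ z ∈ Metric.sphere (0:ℂ) 1, (z * Complex.exp (-(l z / m))) ^ m = 1 := by
    intro z hz
    have h := h z hz
    beta_reduce at h
    rw [mul_zpow, ← Complex.exp_int_mul, ← h, ← Complex.exp_add]
    rw [show l z + (m:ℂ) * -(l z / m) = 0 by field_simp; ring, Complex.exp_zero]
  have h1 : (1:ℂ) ∈ Metric.sphere (0:ℂ) 1 := by simp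
  refine not_hasLog_circle 0 one_pos (R := 1) ?_
  have hc : (1 * Complex.exp (-(l 1 / m))) ≠ 0 := by simp
  refine (HasLog.mul (HasLog.const _ hc) (f := fun _ => _) (g := fun z => Complex.exp (l z / m)) ⟨fun z => l z / m, hl.div_const _, fun z _ => rfl⟩).congr fun z hz => ?_
  have := root_const isPreconnected_circle hcu hm hu h1 hz
  rw [this, mul_assoc, ← Complex.exp_add]; simp

theorem exists_descend {K : Set ℂ} (hK : IsCompact K) {k u : ℂ → ℂ} (hk : ContinuousOn k K) (hu : ContinuousOn u K)
    (h : ∀ x ∈ K, ∀ y ∈ K, k x = k y → u x = u y) : ∃ σ : ℂ → ℂ, ContinuousOn σ (k '' K) ∧ ∀ z ∈ K, σ (k z) = u z := by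
  have hs : ∀ z ∈ K, u (Function.invFunOn k K (k z)) = u z := by
    intro z hz
    have hex : ∃ a ∈ K, k a = k z := ⟨z, hz, rfl⟩
    exact h _ (Function.invFunOn_mem hex) _ hz (Function.invFunOn_eq hex)
  refine ⟨fun w => u (Function.invFunOn k K w), ?_, hs⟩
  rw [continuousOn_iff_isClosed]
  intro Z hZ
  refine ⟨k '' (K ∩ u ⁻¹' Z), ?_, ?_⟩
  · exact ((hK.of_isClosed_subset (hu.preimage_isClosed_of_isClosed hK.isClosed hZ) inter_subset_left).image_of_continuousOn (hk.mono inter_subset_left)).isClosed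
  · ext w
    constructor
    · rintro ⟨hw, z, hz, rfl⟩
      exact ⟨⟨z, ⟨hz, by have := hs z hz; rw [mem_preimage, this] at hw; exact hw⟩, rfl⟩, z, hz, rfl⟩
    · rintro ⟨⟨z, ⟨hz, hz'⟩, rfl⟩, _⟩
      exact ⟨by rw [mem_preimage, hs z hz]; exact hz', z, hz, rfl⟩

/-- finite part -/
noncomputable def toC (p : OnePoint ℂ) : ℂ := p.elim 0 id

theorem toC_coe (z : ℂ) : toC (z : OnePoint ℂ) = z := rfl
theorem coe_toC {p : OnePoint ℂ} (h : p ≠ ∞) : (toC p : OnePoint ℂ) = p := by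
  obtain ⟨z, rfl⟩ := ne_infty_iff_exists.1 h
  rfl

theorem continuousAt_toC {p : OnePoint ℂ} (h : p ≠ ∞) : ContinuousAt toC p := by
  obtain ⟨z, rfl⟩ := ne_infty_iff_exists.1 h
  rw [← isOpenEmbedding_coe.continuousAt_iff]
  exact continuousAt_id

theorem circle_unique {K1 : Set ℂ} (hK : IsCompact K1) {k L : ℂ → ℂ} (hk : ContinuousOn k K1) (hL : ContinuousOn L K1)
    (him : k '' K1 = Metric.sphere 0 1) (hfib : ∀ w, IsPreconnected (K1 ∩ k ⁻¹' {w})) (h0 : (0:ℂ) ∉ K1) {n : ℤ}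
    (h : ∀ z ∈ K1, k z = Complex.exp (L z) * z ^ n) : n = 1 ∨ n = -1 := by
  have hz0 : ∀ z ∈ K1, z ≠ 0 := fun z hz h => h0 (h ▸ hz)
  have hw0 : ∀ z ∈ Metric.sphere (0:ℂ) 1, z ≠ 0 := by rintro z hz rfl; simp at hz
  by_cases hn : n = 0
  · exfalso
    subst hn
    obtain ⟨σ, hσ, hσ'⟩ := exists_descend hK hk hL (by
      intro x hx y hy hxy
      obtain ⟨c, hc, hc'⟩ := log_diff_const (hfib (k x)) (l := L) (m := fun _ => L x) (hL.mono inter_subset_left) continuousOn_const (by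
        rintro z ⟨hz, hz'⟩
        have e : k z = k x := hz'
        rw [h z hz, h x hx] at e
        simpa using e)
      have e1 := hc' x ⟨hx, rfl⟩
      have e2 := hc' y ⟨hy, hxy.symm⟩
      rw [e1, e2])
    rw [him] at hσ
    have := hasLog_circle_pow (m := 1) ⟨σ, hσ, fun w hw => by
      rw [← him] at hw
      obtain ⟨z, hz, rfl⟩ := hw
      rw [hσ' z hz, h z hz]; simp⟩
    omega
  · have hnC : (n : ℂ) ≠ 0 := by exact_mod_cast hn
    have hb : ContinuousOn (fun z => Complex.exp (L z / n) * z) K1 :=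
      (Complex.continuous_exp.comp_continuousOn (hL.div_const _)).mul continuousOn_id
    have hbn : ∀ z ∈ K1, (Complex.exp (L z / n) * z) ^ n = k z := by
      intro z hz
      rw [mul_zpow, ← Complex.exp_int_mul, h z hz, mul_div_cancel₀ _ hnC]
    obtain ⟨σ, hσ, hσ'⟩ := exists_descend hK hk hb (by
      intro x hx y hy hxy
      exact root_const (hfib (k x)) (hb.mono inter_subset_left) hn (a := k x) (fun z hz => (hbn z hz.1).trans hz.2) ⟨hx, rfl⟩ ⟨hy, hxy.symm⟩)
    rw [him] at hσ
    have hσn : ∀ w ∈ Metric.sphere (0:ℂ) 1, σ w ^ n = w := by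
      intro w hw
      rw [← him] at hw
      obtain ⟨z, hz, rfl⟩ := hw
      rw [hσ' z hz, hbn z hz]
    have hσ0 : ∀ w ∈ Metric.sphere (0:ℂ) 1, σ w ≠ 0 := by
      intro w hw h0
      have := hσn w hw
      rw [h0, zero_zpow _ hn] at this
      exact hw0 w hw this.symm
    have hg := good_all (isCompact_sphere (0:ℂ) 1) hσ hσ0
    obtain ⟨j, M, hM, hj⟩ := good_pow (isCompact_sphere (0:ℂ) 1) (by simp) (by
      intro x hx
      have hx : ‖x‖ ≠ 1 := by simpa using hx
      rcases lt_or_gt_of_ne hx with hx | hx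
      · left
        refine Conn.mono (U := (↑) '' Metric.ball (0:ℂ) 1) ?_ ?_
        · exact Conn.image (continuous_coe.continuousOn) ((convex_ball (0:ℂ) 1).isPreconnected.conn (by simpa using hx) (by simp))
        · rintro _ ⟨z, hz, rfl⟩ ⟨z', hz', e⟩
          rw [coe_injective e] at hz'
          simp at hz hz'
          linarith
      · right
        exact conn_ray (R := 1) Metric.sphere_subset_closedBall hx zero_le_one) hg
    have := hasLog_circle_pow (m := 1 + j * n) ⟨fun w => n * M w, continuousOn_const.mul hM, fun w hw => by
      rw [Complex.exp_int_mul, hj w hw, mul_zpow, hσn w hw, ← zpow_mul]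
      beta_reduce
      rw [zpow_add₀ (hw0 w hw), zpow_one]⟩
    have h1 : n * (-j) = 1 := by linarith
    exact Int.isUnit_iff.1 (IsUnit.of_mul_eq_one _ h1)

/-- closed annulus -/
def Ann : Set (OnePoint ℂ) := (↑) '' {w : ℂ | 1/2 ≤ ‖w‖ ∧ ‖w‖ ≤ 2}

theorem isClosed_Ann : IsClosed Ann := by
  have : IsCompact {w : ℂ | 1/2 ≤ ‖w‖ ∧ ‖w‖ ≤ 2} := by
    refine (isCompact_closedBall (0:ℂ) 2).of_isClosed_subset ?_ fun z hz => by simpa using hz.2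
    exact (isClosed_le continuous_const continuous_norm).inter (isClosed_le continuous_norm continuous_const)
  exact (this.image continuous_coe).isClosed

theorem infty_notMem_Ann : ∞ ∉ Ann := by rintro ⟨z, _, h⟩; exact coe_ne_infty z h
theorem zero_notMem_Ann : ((0:ℂ) : OnePoint ℂ) ∉ Ann := by
  rintro ⟨z, h, e⟩; rw [coe_injective e] at h; norm_num at h

theorem exists_degree {f : OnePoint ℂ → OnePoint ℂ} (hf : Continuous f) (hs : f.Surjective) (hfib : ∀ y, IsPreconnected (f ⁻¹' {y}))
    (f0 : f ((0:ℂ) : OnePoint ℂ) = ((0:ℂ) : OnePoint ℂ)) (f1 : f ∞ = ∞) :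
    ∃ L : ℂ → ℂ, Continuous L ∧ ((∀ z : ℂ, f z ∈ Ann → toC (f z) = Complex.exp (L z) * z) ∨
      (∀ z : ℂ, f z ∈ Ann → toC (f z) = Complex.exp (L z) * z⁻¹)) := by
  have hcl : IsClosedMap f := hf.isClosedMap
  set K : Set ℂ := (↑) ⁻¹' (f ⁻¹' Ann) with hKdef
  have hinf : ∞ ∉ f ⁻¹' Ann := by rw [mem_preimage, f1]; exact infty_notMem_Ann
  have hK : IsCompact K := isCompact_pre (isClosed_Ann.preimage hf) hinf
  have hKim : (↑) '' K = f ⁻¹' Ann := coe_image_preimage hinf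
  have h0 : (0:ℂ) ∉ K := by
    rw [hKdef, mem_preimage, mem_preimage, f0]; exact zero_notMem_Ann
  have hfin : ∀ z ∈ K, f z ≠ ∞ := fun z hz h => infty_notMem_Ann (h ▸ hz)
  have hk : ContinuousOn (fun z : ℂ => toC (f z)) K := fun z hz =>
    (ContinuousAt.comp (f := fun z : ℂ => f z) (continuousAt_toC (hfin z hz)) (hf.comp continuous_coe).continuousAt).continuousWithinAt
  have hk0 : ∀ z ∈ K, toC (f z) ≠ 0 := by
    intro z hz h
    apply zero_notMem_Ann
    rw [← h, coe_toC (hfin z hz)]; exact hz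
  have hconn : ∀ x : ℂ, x ∉ K → Conn ((↑) '' K : Set (OnePoint ℂ))ᶜ (x : OnePoint ℂ) ((0:ℂ) : OnePoint ℂ) ∨ Conn ((↑) '' K : Set (OnePoint ℂ))ᶜ (x : OnePoint ℂ) ∞ := by
    intro x hx
    rw [hKim, ← preimage_compl]
    by_cases hxi : f x = ∞
    · right
      refine Conn.preimage hcl hs hfib ?_
      rw [hxi, f1]
      exact Conn.refl infty_notMem_Ann
    obtain ⟨w, hw⟩ := ne_infty_iff_exists.1 hxi
    by_cases h2 : ‖w‖ ≤ 2
    · left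
      refine Conn.preimage hcl hs hfib ?_
      rw [f0, ← hw]
      have h3 : ‖w‖ < 1/2 := by
        by_contra h3
        exact hx (show f x ∈ Ann from ⟨w, ⟨not_lt.1 h3, h2⟩, hw⟩)
      refine Conn.mono (U := (↑) '' Metric.ball (0:ℂ) (1/2)) ?_ ?_
      · exact Conn.image (continuous_coe.continuousOn) ((convex_ball (0:ℂ) (1/2)).isPreconnected.conn (by simpa using h3) (by simp))
      · rintro _ ⟨z, hz, rfl⟩ ⟨z', hz', e⟩
        rw [coe_injective e] at hz'
        have := hz'.1
        rw [mem_ball_zero_iff] at hz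
        linarith
    · right
      refine Conn.preimage hcl hs hfib ?_
      rw [f1, ← hw]
      exact conn_ray (R := 2) (fun z hz => by simpa using hz.2) (not_le.1 h2) zero_le_two
  obtain ⟨n', l, hl, hn'⟩ := good_pow hK h0 hconn (good_all hK hk hk0)
  obtain ⟨L, hL, hLl⟩ := exists_extension hK.isClosed hl
  have hz0 : ∀ z ∈ K, z ≠ 0 := fun z hz h => h0 (h ▸ hz)
  have hn : ∀ z ∈ K, toC (f z) = Complex.exp (L z) * z ^ (-n') := by
    intro z hz
    rw [hLl z hz, hn' z hz, mul_assoc, ← zpow_add₀ (hz0 z hz)]; simp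
  refine ⟨L, hL, ?_⟩
  set K1 : Set ℂ := (↑) ⁻¹' (f ⁻¹' ((↑) '' Metric.sphere (0:ℂ) 1)) with hK1
  have hK1K : K1 ⊆ K := by
    rintro z ⟨w, hw, e⟩
    have : ‖w‖ = 1 := by simpa using hw
    exact ⟨w, ⟨by rw [this]; norm_num, by rw [this]; norm_num⟩, e⟩
  have hc1 : IsClosed ((↑) '' Metric.sphere (0:ℂ) 1 : Set (OnePoint ℂ)) := ((isCompact_sphere (0:ℂ) 1).image continuous_coe).isClosed
  have hcK1 : IsCompact K1 := hK.of_isClosed_subset (hc1.preimage (hf.comp continuous_coe)) hK1K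
  have hfibC : ∀ w : ℂ, IsPreconnected {z : ℂ | f z = w} := by
    intro w
    have := hfib w
    rw [← coe_image_preimage (A := f ⁻¹' {(w : OnePoint ℂ)}) (by rw [mem_preimage, f1]; exact fun h => coe_ne_infty w h.symm)] at this
    exact (isOpenEmbedding_coe.isInducing.isPreconnected_image).1 this
  have hfinal : -n' = 1 ∨ -n' = -1 := by
    refine circle_unique hcK1 (hk.mono hK1K) hL.continuousOn ?_ ?_ (fun h => h0 (hK1K h)) (fun z hz => hn z (hK1K hz))
    · ext w
      constructor
      · rintro ⟨z, ⟨w, hw, e⟩, rfl⟩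
        simp only [← e]; exact hw
      · intro hw
        obtain ⟨p, hp⟩ := hs w
        have hpi : p ≠ ∞ := by
          rintro rfl; rw [f1] at hp; exact coe_ne_infty w hp.symm
        obtain ⟨z, rfl⟩ := ne_infty_iff_exists.1 hpi
        exact ⟨z, ⟨w, hw, hp.symm⟩, by simp only [hp]; rfl⟩
    · intro w
      by_cases hw : w ∈ Metric.sphere (0:ℂ) 1
      · convert hfibC w using 1
        ext z
        constructor
        · rintro ⟨⟨w', hw', e⟩, h2⟩
          have h2 : toC (f z) = w := h2
          show f z = w
          rw [← h2, coe_toC (by rw [← e]; exact coe_ne_infty w')]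
        · intro h
          have h : f z = w := h
          refine ⟨⟨w, hw, h.symm⟩, ?_⟩
          show toC (f z) = w
          rw [h]; rfl
      · convert isPreconnected_empty
        rw [eq_empty_iff_forall_notMem]
        rintro z ⟨⟨w', hw', e⟩, h2⟩
        have h2 : toC (f z) = w := h2
        rw [← e, toC_coe] at h2
        exact hw (h2 ▸ hw')
  rcases hfinal with e | e
  · left; intro z hz; rw [hn z hz, e, zpow_one]
  · right; intro z hz; rw [hn z hz, e, zpow_neg_one]

end MooreSphere

namespace MooreSphere
open Set Filter Topology
open OnePoint

/-- stereographic coordinates, horizontal part -/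
noncomputable def hv (p : OnePoint ℂ) : ℂ := p.elim 0 (fun z => ((2 / (1 + ‖z‖^2) : ℝ) : ℂ) * z)
/-- stereographic coordinates, height -/
noncomputable def ht (p : OnePoint ℂ) : ℝ := p.elim 1 (fun z => 1 - 2 / (1 + ‖z‖^2))

theorem hv_coe (z : ℂ) : hv (z : OnePoint ℂ) = ((2 / (1 + ‖z‖^2) : ℝ) : ℂ) * z := rfl
theorem ht_coe (z : ℂ) : ht (z : OnePoint ℂ) = 1 - 2 / (1 + ‖z‖^2) := rfl
theorem hv_infty : hv ∞ = 0 := rfl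
theorem ht_infty : ht ∞ = 1 := rfl
theorem ht_zero : ht ((0:ℂ) : OnePoint ℂ) = -1 := by rw [ht_coe]; norm_num

theorem tendsto_aux : Tendsto (fun z : ℂ => 2 / (1 + ‖z‖^2)) (cocompact ℂ) (𝓝 0) := by
  have h1 : Tendsto (fun z : ℂ => 1 + ‖z‖^2) (cocompact ℂ) atTop :=
    tendsto_atTop_add_const_left _ _ ((tendsto_pow_atTop two_ne_zero).comp (tendsto_norm_cocompact_atTop (E := ℂ)))
  exact h1.const_div_atTop 2

theorem continuous_ht : Continuous ht := by
  rw [OnePoint.continuous_iff, Filter.coclosedCompact_eq_cocompact]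
  constructor
  · have : Tendsto (fun z : ℂ => 1 - 2 / (1 + ‖z‖^2)) (cocompact ℂ) (𝓝 (1 - 0)) := tendsto_const_nhds.sub tendsto_aux
    rw [sub_zero] at this
    exact this
  · show Continuous (fun z : ℂ => 1 - 2 / (1 + ‖z‖^2))
    exact continuous_const.sub (Continuous.div (by fun_prop) (by fun_prop) fun z => by positivity)

theorem continuous_hv : Continuous hv := by
  rw [OnePoint.continuous_iff, Filter.coclosedCompact_eq_cocompact]
  constructor
  · have h1 : Tendsto (fun z : ℂ => 2 / ‖z‖) (cocompact ℂ) (𝓝 0) :=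
      (tendsto_norm_cocompact_atTop (E := ℂ)).const_div_atTop 2
    refine squeeze_zero_norm (a := fun z : ℂ => 2 / ‖z‖) (fun z => ?_) h1
    rw [hv_coe, norm_mul, Complex.norm_real, Real.norm_of_nonneg (by positivity)]
    rcases (norm_nonneg z).eq_or_lt with h | h
    · rw [← h]; simp
    · rw [div_mul_eq_mul_div, div_le_div_iff₀ (by positivity) h]
      nlinarith
  · show Continuous (fun z : ℂ => ((2 / (1 + ‖z‖^2) : ℝ) : ℂ) * z)
    refine Continuous.mul (Complex.continuous_ofReal.comp ?_) continuous_id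
    exact Continuous.div (by fun_prop) (by fun_prop) fun z => by positivity

theorem tendsto_infty' {α : Type*} {l : Filter α} {F : α → OnePoint ℂ}
    (h : ∀ R : ℝ, ∀ᶠ x in l, ∀ z : ℂ, F x = z → R < ‖z‖) : Tendsto F l (𝓝 ∞) := by
  rw [tendsto_def]
  intro U hU
  obtain ⟨O, hOU, hO, hi⟩ := mem_nhds_iff.1 hU
  have hc : IsCompact ((↑) ⁻¹' O : Set ℂ)ᶜ := (OnePoint.isOpen_def.1 hO).1 hi
  obtain ⟨R, hR⟩ := hc.isBounded.subset_closedBall 0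
  filter_upwards [h R] with x hx
  apply hOU
  by_contra hn
  have hne : F x ≠ ∞ := fun e => hn (e ▸ hi)
  obtain ⟨z, hz⟩ := ne_infty_iff_exists.1 hne
  have := hR (show z ∈ ((↑) ⁻¹' O : Set ℂ)ᶜ from fun h => hn (hz ▸ h))
  rw [mem_closedBall_zero_iff] at this
  linarith [hx z hz.symm]

/-- radial length -/
noncomputable def rr (q : ℂ × ℝ) : ℝ := √(‖q.1‖^2 + q.2^2)

theorem continuous_rr : Continuous rr := by unfold rr; fun_prop
theorem rr_sq (q : ℂ × ℝ) : rr q ^ 2 = ‖q.1‖^2 + q.2^2 := Real.sq_sqrt (by positivity)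
theorem rr_nonneg (q : ℂ × ℝ) : 0 ≤ rr q := Real.sqrt_nonneg _

open Classical in
/-- normalisation map from nonzero vectors to the sphere -/
noncomputable def Nn (q : ℂ × ℝ) : OnePoint ℂ := if rr q - q.2 = 0 then ∞ else (((rr q - q.2 : ℝ) : ℂ)⁻¹ * q.1 : ℂ)

theorem continuousAt_Nn {q : ℂ × ℝ} (hq : q ≠ 0) : ContinuousAt Nn q := by
  by_cases h : rr q - q.2 = 0
  · have hq2 : 0 < q.2 := by
      have h1 : q.2 = rr q := by linarith
      have h2 := rr_nonneg q
      rcases (h1 ▸ h2 : 0 ≤ q.2).eq_or_lt with h3 | h3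
      · exfalso
        have h4 := rr_sq q
        rw [← h1, ← h3] at h4
        have h5 : ‖q.1‖ = 0 := by nlinarith [norm_nonneg q.1]
        exact hq (Prod.ext (norm_eq_zero.1 h5) h3.symm)
      · exact h3
    have hN : Nn q = ∞ := by simp [Nn, h]
    rw [ContinuousAt, hN]
    apply tendsto_infty'
    intro R
    have hv0 : ‖q.1‖ = 0 := by
      have h4 := rr_sq q
      rw [show rr q = q.2 by linarith] at h4
      nlinarith [norm_nonneg q.1]
    have e1 : ∀ᶠ x : ℂ × ℝ in 𝓝 q, (|R|+1) * ‖x.1‖ < rr x + x.2 := by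
      have hc1 : ContinuousAt (fun x : ℂ × ℝ => (|R|+1) * ‖x.1‖) q := by fun_prop
      have hc2 : ContinuousAt (fun x : ℂ × ℝ => rr x + x.2) q := (continuous_rr.add continuous_snd).continuousAt
      exact hc1.eventually_lt hc2 (by rw [hv0]; linarith)
    filter_upwards [e1] with x hx z hz
    by_cases hx0 : rr x - x.2 = 0
    · simp [Nn, hx0] at hz
    · simp only [Nn, hx0, if_false] at hz
      have hz := coe_injective hz
      rw [← hz, norm_mul, norm_inv, Complex.norm_real]
      have h1 := rr_sq x
      have hpos : 0 < rr x - x.2 := by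
        rcases lt_or_gt_of_ne hx0 with h2 | h2
        · nlinarith [norm_nonneg x.1, rr_nonneg x]
        · exact h2
      have hv1 : 0 < ‖x.1‖ := by
        rcases (norm_nonneg x.1).eq_or_lt with h2 | h2
        · exfalso
          rw [← h2] at h1 hx
          have : (rr x - x.2) * (rr x + x.2) = 0 := by ring_nf; nlinarith
          have := mul_pos hpos (show 0 < rr x + x.2 by linarith)
          linarith
        · exact h2
      rw [Real.norm_of_nonneg hpos.le, ← div_eq_inv_mul, lt_div_iff₀ hpos]
      have h2 : (|R|+1) * ‖x.1‖ * (rr x - x.2) < (rr x + x.2) * (rr x - x.2) := mul_lt_mul_of_pos_right hx hpos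
      have h3 : (rr x + x.2) * (rr x - x.2) = ‖x.1‖ * ‖x.1‖ := by nlinarith
      have h4 : (|R|+1) * (rr x - x.2) < ‖x.1‖ := by nlinarith
      nlinarith [le_abs_self R]
  · have hc : ContinuousAt (fun x : ℂ × ℝ => ((((rr x - x.2 : ℝ) : ℂ)⁻¹ * x.1 : ℂ) : OnePoint ℂ)) q := by
      refine continuous_coe.continuousAt.comp (ContinuousAt.mul (ContinuousAt.inv₀ ?_ ?_) continuous_fst.continuousAt)
      · exact (Complex.continuous_ofReal.comp (continuous_rr.sub continuous_snd)).continuousAt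
      · exact_mod_cast h
    refine hc.congr ?_
    have : ∀ᶠ x : ℂ × ℝ in 𝓝 q, rr x - x.2 ≠ 0 := (continuous_rr.sub continuous_snd).continuousAt.eventually_ne h
    filter_upwards [this] with x hx
    simp [Nn, hx]

theorem Nn_stereo (p : OnePoint ℂ) : Nn (hv p, ht p) = p := by
  induction p using OnePoint.rec with
  | infty => simp [Nn, rr, hv_infty, ht_infty]
  | coe z =>
    have hp : (0:ℝ) < 1 + ‖z‖^2 := by positivity
    have h1 : rr (hv z, ht z) = 1 := by
      unfold rr
      rw [Real.sqrt_eq_one]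
      simp only [hv_coe, ht_coe]
      rw [norm_mul, Complex.norm_real, Real.norm_of_nonneg (by positivity)]
      field_simp
      ring
    have h2 : rr (hv z, ht z) - ht z = 2 / (1 + ‖z‖^2) := by rw [h1, ht_coe]; ring
    have h3 : 2 / (1 + ‖z‖^2) ≠ 0 := by positivity
    have h4 : ¬ (rr (hv z, ht z) - (hv (z : OnePoint ℂ), ht (z : OnePoint ℂ)).2 = 0) := by
      show ¬ (rr (hv z, ht z) - ht z = 0)
      rw [h2]; exact h3
    rw [Nn, if_neg h4]
    show (((rr (hv z, ht z) - ht z : ℝ) : ℂ)⁻¹ * hv z : ℂ) = (z : OnePoint ℂ)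
    rw [h2, hv_coe, inv_mul_cancel_left₀ (by exact_mod_cast h3)]

theorem homotopic_of {F : unitInterval × OnePoint ℂ → ℂ × ℝ} (hF : Continuous F) (h0 : ∀ x, F x ≠ 0) {a b : C(OnePoint ℂ, OnePoint ℂ)}
    (ha : ∀ x, Nn (F (0, x)) = a x) (hb : ∀ x, Nn (F (1, x)) = b x) : a.Homotopic b :=
  ⟨{ toFun := fun x => Nn (F x)
     continuous_toFun := continuous_iff_continuousAt.2 fun x => (continuousAt_Nn (h0 x)).comp hF.continuousAt
     map_zero_left := ha
     map_one_left := hb }⟩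

end MooreSphere

namespace MooreSphere
open Set Filter Topology
open OnePoint

/-- cut-off -/
noncomputable def rho (p : OnePoint ℂ) : ℝ := max 0 (3/5 - |ht p|)

theorem continuous_rho : Continuous rho := by
  have := continuous_ht
  unfold rho; fun_prop

theorem rho_nonneg (p : OnePoint ℂ) : 0 ≤ rho p := le_max_left _ _

theorem rho_zero {p : OnePoint ℂ} (h : rho p = 0) : ht p ≠ 0 := by
  intro h'
  rw [rho, h'] at h
  norm_num at h

theorem ht_ne_or (p : OnePoint ℂ) : ht p ≠ 0 ∨ 0 < rho p := by
  rcases (rho_nonneg p).eq_or_lt with h | h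
  · exact Or.inl (rho_zero h.symm)
  · exact Or.inr h

theorem mem_Ann_of_rho {p : OnePoint ℂ} (h : 0 < rho p) : p ∈ Ann := by
  have h : |ht p| < 3/5 := by
    by_contra h'
    rw [rho, max_eq_left (by linarith)] at h
    exact lt_irrefl _ h
  rw [abs_lt] at h
  induction p using OnePoint.rec with
  | infty => rw [ht_infty] at h; norm_num at h
  | coe z =>
    rw [ht_coe] at h
    have hp : (0:ℝ) < 1 + ‖z‖^2 := by positivity
    have h1 : 2 / (1 + ‖z‖^2) < 8/5 := by linarith
    have h2 : 2/5 < 2 / (1 + ‖z‖^2) := by linarith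
    rw [div_lt_iff₀ hp] at h1
    rw [lt_div_iff₀ hp] at h2
    refine ⟨z, ⟨?_, ?_⟩, rfl⟩
    · nlinarith [norm_nonneg z]
    · nlinarith [norm_nonneg z]

/-- rotating direction -/
noncomputable def dir (L : ℂ → ℂ) (t : ℝ) (z : ℂ) : ℂ := Complex.exp (((t * (L z).im : ℝ) : ℂ) * Complex.I) * (((‖z‖⁻¹ : ℝ) : ℂ) * z)

/-- horizontal component -/
noncomputable def VV (g : OnePoint ℂ → OnePoint ℂ) (L : ℂ → ℂ) (x : ℝ × OnePoint ℂ) : ℂ := (rho (g x.2) : ℂ) * dir L x.1 (toC x.2)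

section
variable {g : OnePoint ℂ → OnePoint ℂ} {L : ℂ → ℂ}

theorem continuous_VV (hg : Continuous g) (g0 : g ((0:ℂ) : OnePoint ℂ) = ((0:ℂ) : OnePoint ℂ)) (g1 : g ∞ = ∞) (hL : Continuous L) : Continuous (VV g L) := by
  rw [continuous_iff_continuousAt]
  rintro ⟨t, p⟩
  by_cases hp : 3/5 < |ht (g p)|
  · have hev : ∀ᶠ x : ℝ × OnePoint ℂ in 𝓝 (t, p), 3/5 < |ht (g x.2)| :=
      continuousAt_const.eventually_lt (((continuous_ht.comp hg).comp continuous_snd).abs.continuousAt) hp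
    have : (fun _ => (0:ℂ)) =ᶠ[𝓝 (t, p)] VV g L := by
      filter_upwards [hev] with x hx
      rw [VV, rho, max_eq_left (by linarith)]; simp
    exact continuousAt_const.congr this
  · have hpi : p ≠ ∞ := by
      rintro rfl
      rw [g1, ht_infty] at hp; norm_num at hp
    obtain ⟨z, rfl⟩ := ne_infty_iff_exists.1 hpi
    have hz : z ≠ 0 := by
      rintro rfl
      rw [g0, ht_zero] at hp; norm_num at hp
    have hC : ContinuousAt (fun x : ℝ × OnePoint ℂ => toC x.2) (t, (z : OnePoint ℂ)) :=
      ContinuousAt.comp (f := Prod.snd) (continuousAt_toC (coe_ne_infty z)) continuousAt_snd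
    have hLC : ContinuousAt (fun x : ℝ × OnePoint ℂ => L (toC x.2)) (t, (z : OnePoint ℂ)) := hL.continuousAt.comp hC
    have hI : ContinuousAt (fun x : ℝ × OnePoint ℂ => (L (toC x.2)).im) (t, (z : OnePoint ℂ)) := Complex.continuous_im.continuousAt.comp hLC
    have hM : ContinuousAt (fun x : ℝ × OnePoint ℂ => x.1 * (L (toC x.2)).im) (t, (z : OnePoint ℂ)) := continuousAt_fst.mul hI
    have hM' : ContinuousAt (fun x : ℝ × OnePoint ℂ => ((x.1 * (L (toC x.2)).im : ℝ) : ℂ)) (t, (z : OnePoint ℂ)) := Complex.continuous_ofReal.continuousAt.comp hM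
    have hE : ContinuousAt (fun x : ℝ × OnePoint ℂ => Complex.exp (((x.1 * (L (toC x.2)).im : ℝ) : ℂ) * Complex.I)) (t, (z : OnePoint ℂ)) :=
      Complex.continuous_exp.continuousAt.comp (hM'.mul continuousAt_const)
    have hN : ContinuousAt (fun x : ℝ × OnePoint ℂ => ‖toC x.2‖⁻¹) (t, (z : OnePoint ℂ)) := hC.norm.inv₀ (by simpa [toC_coe] using hz)
    have hN' : ContinuousAt (fun x : ℝ × OnePoint ℂ => ((‖toC x.2‖⁻¹ : ℝ) : ℂ)) (t, (z : OnePoint ℂ)) := Complex.continuous_ofReal.continuousAt.comp hN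
    have hR : ContinuousAt (fun x : ℝ × OnePoint ℂ => (rho (g x.2) : ℂ)) (t, (z : OnePoint ℂ)) :=
      (Complex.continuous_ofReal.comp ((continuous_rho.comp hg).comp continuous_snd)).continuousAt
    exact hR.mul (hE.mul (hN'.mul hC))

theorem VV_one (g1 : g ∞ = ∞) (h : ∀ z : ℂ, g z ∈ Ann → toC (g z) = Complex.exp (L z) * z) {p : OnePoint ℂ} {w : ℂ} (hp : 0 < rho (g p)) (hw : g p = w) : ∃ c : ℝ, 0 < c ∧ VV g L (1, p) = c * w ∧ w ≠ 0 := by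
  have hA := mem_Ann_of_rho hp
  have hpi : p ≠ ∞ := by
    rintro rfl
    rw [g1] at hA; exact infty_notMem_Ann hA
  obtain ⟨z, rfl⟩ := ne_infty_iff_exists.1 hpi
  have hw0 : w ≠ 0 := by
    rintro rfl
    rw [hw] at hA; exact zero_notMem_Ann hA
  have hz : w = Complex.exp (L z) * z := by rw [← h z hA, hw]; rfl
  have hz0 : z ≠ 0 := by rintro rfl; simp at hz; exact hw0 hz
  have hzn : 0 < ‖z‖ := norm_pos_iff.2 hz0
  refine ⟨rho (g z) * (Real.exp (-(L z).re) * ‖z‖⁻¹), by positivity, ?_, hw0⟩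
  have e : Complex.exp (((1 * (L z).im : ℝ) : ℂ) * Complex.I) = ((Real.exp (-(L z).re) : ℝ) : ℂ) * Complex.exp (L z) := by
    rw [Complex.ofReal_exp, ← Complex.exp_add]
    congr 1
    apply Complex.ext <;> simp
  simp only [VV, dir, toC_coe]
  rw [hz, e]
  push_cast
  ring

theorem VV_zero (z : ℂ) : VV g L (0, (z : OnePoint ℂ)) = ((rho (g z) * ‖z‖⁻¹ : ℝ) : ℂ) * z := by
  simp only [VV, dir, toC_coe]
  push_cast
  simp [mul_assoc]

theorem VV_infty (t : ℝ) (g1 : g ∞ = ∞) : VV g L (t, ∞) = 0 := by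
  have : rho ∞ = 0 := by rw [rho, ht_infty]; norm_num
  rw [VV, g1, this]; simp

end

theorem homotopic_id (g : C(OnePoint ℂ, OnePoint ℂ)) (g0 : g ((0:ℂ) : OnePoint ℂ) = ((0:ℂ) : OnePoint ℂ)) (g1 : g ∞ = ∞)
    {L : ℂ → ℂ} (hL : Continuous L) (h : ∀ z : ℂ, g z ∈ Ann → toC (g z) = Complex.exp (L z) * z) :
    g.Homotopic (ContinuousMap.id _) := by
  have hg : Continuous g := g.continuous
  have cV := continuous_VV hg g0 g1 hL
  have chv := continuous_hv
  have cht := continuous_ht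
  -- nonvanishing of the middle family
  have nz : ∀ t : ℝ, ∀ p, ((VV g L (t, p), ht (g p)) : ℂ × ℝ) ≠ 0 := by
    intro t p e
    have e2 : ht (g p) = 0 := congrArg Prod.snd e
    have e1 : VV g L (t, p) = 0 := congrArg Prod.fst e
    have hr := (ht_ne_or (g p)).resolve_left (not_not.2 e2)
    have hA := mem_Ann_of_rho hr
    have hpi : p ≠ ∞ := by
      rintro rfl
      rw [g1] at hA; exact infty_notMem_Ann hA
    obtain ⟨z, rfl⟩ := ne_infty_iff_exists.1 hpi
    have hz : z ≠ 0 := by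
      rintro rfl
      rw [g0] at hA; exact zero_notMem_Ann hA
    simp only [VV, dir, toC_coe, mul_eq_zero, Complex.ofReal_eq_zero, hr.ne', Complex.exp_ne_zero, inv_eq_zero, norm_eq_zero, hz, or_self] at e1
  have cmid : ∀ t : ℝ, Continuous fun p => ((VV g L (t, p), ht (g p)) : ℂ × ℝ) := fun t =>
    (cV.comp (Continuous.prodMk_right t)).prodMk (cht.comp hg)
  let a : ℝ → C(OnePoint ℂ, OnePoint ℂ) := fun t => ⟨fun p => Nn (VV g L (t, p), ht (g p)),
    continuous_iff_continuousAt.2 fun p => (continuousAt_Nn (nz t p)).comp (f := fun p => ((VV g L (t, p), ht (g p)) : ℂ × ℝ)) (cmid t).continuousAt⟩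
  have H1 : g.Homotopic (a 1) := by
    refine homotopic_of (F := fun x => (((1 - (x.1:ℝ) : ℝ) : ℂ) * hv (g x.2) + (((x.1:ℝ)) : ℂ) * VV g L (1, x.2), ht (g x.2))) ?_ ?_ ?_ ?_
    · have : Continuous fun x : unitInterval × OnePoint ℂ => VV g L (1, x.2) := cV.comp (continuous_const.prodMk continuous_snd)
      fun_prop
    · rintro ⟨t, p⟩ e
      have e2 : ht (g p) = 0 := congrArg Prod.snd e
      have e1 : ((1 - (t:ℝ) : ℝ) : ℂ) * hv (g p) + ((t:ℝ) : ℂ) * VV g L (1, p) = 0 := congrArg Prod.fst e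
      have hr := (ht_ne_or (g p)).resolve_left (not_not.2 e2)
      obtain ⟨w, _, hw⟩ := mem_Ann_of_rho hr
      obtain ⟨c, hc, hV, hw0⟩ := VV_one g1 h hr hw.symm
      rw [hV, ← hw, hv_coe] at e1
      have e3 : (((1 - (t:ℝ)) * (2 / (1 + ‖w‖^2)) + t * c : ℝ) : ℂ) * w = 0 := by rw [← e1]; push_cast; ring
      rw [mul_eq_zero, or_iff_left hw0, Complex.ofReal_eq_zero] at e3
      have t0 := t.2.1
      have t1 := t.2.2
      have hq : 0 < 2 / (1 + ‖w‖^2) := by positivity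
      rcases t0.eq_or_lt with h' | h'
      · rw [← h'] at e3; linarith
      · have := mul_pos h' hc
        have := mul_nonneg (sub_nonneg.2 t1) hq.le
        linarith
    · intro x; simp [Nn_stereo]
    · intro x; simp [a]
  have H2 : (a 0).Homotopic (a 1) := by
    refine homotopic_of (F := fun x => (VV g L ((x.1:ℝ), x.2), ht (g x.2))) ?_ (fun x => nz _ _) ?_ ?_
    · have : Continuous fun x : unitInterval × OnePoint ℂ => VV g L ((x.1:ℝ), x.2) := cV.comp ((continuous_subtype_val.comp continuous_fst).prodMk continuous_snd)
      fun_prop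
    · intro x; simp [a]
    · intro x; simp [a]
  have H3 : (a 0).Homotopic (ContinuousMap.id _) := by
    refine homotopic_of (F := fun x => (((1 - (x.1:ℝ) : ℝ) : ℂ) * VV g L (0, x.2) + (((x.1:ℝ)) : ℂ) * hv x.2, (1 - (x.1:ℝ)) * ht (g x.2) + (x.1:ℝ) * ht x.2)) ?_ ?_ ?_ ?_
    · have : Continuous fun x : unitInterval × OnePoint ℂ => VV g L (0, x.2) := cV.comp (continuous_const.prodMk continuous_snd)
      fun_prop
    · rintro ⟨t, p⟩ e
      have e2 : (1 - (t:ℝ)) * ht (g p) + (t:ℝ) * ht p = 0 := congrArg Prod.snd e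
      have e1 : ((1 - (t:ℝ) : ℝ) : ℂ) * VV g L (0, p) + ((t:ℝ) : ℂ) * hv p = 0 := congrArg Prod.fst e
      induction p using OnePoint.rec with
      | infty => rw [g1, ht_infty] at e2; linarith
      | coe z =>
        by_cases hz : z = 0
        · subst hz
          rw [g0, ht_zero] at e2; linarith
        rw [VV_zero, hv_coe] at e1
        have e3 : (((1 - (t:ℝ)) * (rho (g z) * ‖z‖⁻¹) + t * (2 / (1 + ‖z‖^2)) : ℝ) : ℂ) * z = 0 := by rw [← e1]; push_cast; ring
        rw [mul_eq_zero, or_iff_left hz, Complex.ofReal_eq_zero] at e3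
        have t0 := t.2.1
        have t1 := t.2.2
        have hq : 0 < 2 / (1 + ‖z‖^2) := by positivity
        have hzn : 0 < ‖z‖⁻¹ := inv_pos.2 (norm_pos_iff.2 hz)
        have h1 := mul_nonneg (sub_nonneg.2 t1) (mul_nonneg (rho_nonneg (g z)) hzn.le)
        rcases t0.eq_or_lt with h' | h'
        · rw [← h'] at e3 e2
          have h3 : rho (g z) * ‖z‖⁻¹ = 0 := by linarith
          rw [mul_eq_zero, or_iff_left hzn.ne'] at h3
          exact rho_zero h3 (by linarith)
        · have := mul_pos h' hq
          linarith
    · intro x; simp [a]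
    · intro x; simp [Nn_stereo]
  exact H1.trans (H2.symm.trans H3)

theorem exists_homotopic {f : OnePoint ℂ → OnePoint ℂ} (hf : Continuous f) (hs : f.Surjective) (hfib : ∀ y, IsPreconnected (f ⁻¹' {y}))
    (f0 : f ((0:ℂ) : OnePoint ℂ) = ((0:ℂ) : OnePoint ℂ)) (f1 : f ∞ = ∞) :
    ∃ e : OnePoint ℂ ≃ₜ OnePoint ℂ, ContinuousMap.Homotopic (⟨fun x => e (f x), e.continuous.comp hf⟩ : C(OnePoint ℂ, OnePoint ℂ)) (ContinuousMap.id _) := by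
  obtain ⟨L, hL, h | h⟩ := exists_degree hf hs hfib f0 f1
  · exact ⟨Homeomorph.refl _, homotopic_id _ f0 f1 hL h⟩
  · let e : OnePoint ℂ ≃ₜ OnePoint ℂ := Complex.conjLIE.toHomeomorph.onePointCongr
    have ec : ∀ z : ℂ, e z = ((starRingEnd ℂ z : ℂ) : OnePoint ℂ) := fun z => rfl
    have ei : e ∞ = ∞ := rfl
    have cc : Continuous fun z : ℂ => starRingEnd ℂ (L z) := Complex.continuous_conj.comp hL
    have hex : ∃ L' : ℂ → ℂ, Continuous L' ∧ ∀ z : ℂ, f z ∈ Ann → L' z = starRingEnd ℂ (L z) - ((2 * Real.log ‖z‖ : ℝ) : ℂ) := by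
      have hK : IsClosed ((fun z : ℂ => f z) ⁻¹' Ann) := isClosed_Ann.preimage (hf.comp continuous_coe)
      refine exists_extension hK (l := fun z => starRingEnd ℂ (L z) - ((2 * Real.log ‖z‖ : ℝ) : ℂ)) ?_
      refine cc.continuousOn.sub (Complex.continuous_ofReal.comp_continuousOn (continuousOn_const.mul (continuous_norm.continuousOn.log ?_)))
      intro z hz h0
      have : z = 0 := norm_eq_zero.1 h0
      subst this
      rw [mem_preimage, f0] at hz
      exact zero_notMem_Ann hz
    obtain ⟨L', hL', hLL⟩ := hex
    refine ⟨e, homotopic_id _ ?_ ?_ hL' ?_⟩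
    · show e (f _) = _
      rw [f0, ec]; simp
    · show e (f _) = _
      rw [f1, ei]
    · intro z hz
      have hz : e (f z) ∈ Ann := hz
      show toC (e (f z)) = _
      obtain ⟨w, hw, hwe⟩ := hz
      have hfz : f z ≠ ∞ := by
        intro h'; rw [h', ei] at hwe; exact coe_ne_infty w hwe
      obtain ⟨w', hw'⟩ := ne_infty_iff_exists.1 hfz
      rw [← hw', ec] at hwe
      have hww := coe_injective hwe
      have hA : f z ∈ Ann := by
        refine ⟨w', ?_, hw'⟩
        rw [hww] at hw
        simpa using hw
      have hz0 : z ≠ 0 := by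
        rintro rfl
        rw [f0] at hA; exact zero_notMem_Ann hA
      have hzn : 0 < ‖z‖ := norm_pos_iff.2 hz0
      rw [hLL z hA]
      have h1 := h z hA
      rw [← hw', toC_coe] at h1
      rw [← hw', ec, toC_coe, h1, map_mul, map_inv₀, ← Complex.exp_conj, Complex.exp_sub, ← Complex.ofReal_exp,
        show Real.exp (2 * Real.log ‖z‖) = ‖z‖^2 by rw [two_mul, Real.exp_add, Real.exp_log hzn, sq]]
      have h2 : (starRingEnd ℂ z) * z = ((‖z‖^2 : ℝ) : ℂ) := by
        rw [Complex.conj_mul']; push_cast; rfl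
      have h3 : starRingEnd ℂ z ≠ 0 := by simpa using hz0
      have h4 : ((‖z‖^2 : ℝ) : ℂ) ≠ 0 := by exact_mod_cast (by positivity : (‖z‖^2 : ℝ) ≠ 0)
      rw [← h2]
      field_simp

end MooreSphere

namespace MooreSphere
open Set Filter Topology
open OnePoint

theorem exists_chart2 {u v : SS} (huv : u ≠ v) : ∃ e : OnePoint ℂ ≃ₜ SS, e ((0:ℂ) : OnePoint ℂ) = u ∧ e ∞ = v := by
  obtain ⟨e, rfl⟩ := exists_chart v
  obtain ⟨p, rfl⟩ := e.surjective u
  have hp : p ≠ ∞ := fun h => huv (h ▸ rfl)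
  obtain ⟨c, rfl⟩ := ne_infty_iff_exists.1 hp
  refine ⟨(Homeomorph.addLeft c).onePointCongr.trans e, ?_, ?_⟩
  · show e (((c + 0 : ℂ)) : OnePoint ℂ) = _
    rw [add_zero]
  · rfl

theorem moore_main (r : SS → SS → Prop) (hr : Equivalence r)
    (hconn : ∀ x : SS, IsConnected {y : SS | r x y})
    (hcompl : ∀ x : SS, IsConnected ({y : SS | r x y}ᶜ))
    (hclosed : IsClosed {p : SS × SS | r p.1 p.2}) :
    ∃ φ : C(SS, SS),
      ContinuousMap.Homotopic φ (ContinuousMap.id SS) ∧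
      (∀ p : SS, ∃ x : SS, φ ⁻¹' {p} = {y : SS | r x y}) ∧
      (∀ x : SS, ∃ p : SS, {y : SS | r x y} = φ ⁻¹' {p}) ∧
      Nonempty (Quotient (⟨r, hr⟩ : Setoid SS) ≃ₜ SS) := by
  have hmet := quot_metrizable hr hclosed
  letI : MetricSpace (QQ hr) := TopologicalSpace.metrizableSpaceMetric (QQ hr)
  let m : SS → QQ hr := Quotient.mk (⟨r, hr⟩ : Setoid SS)
  have hm : Continuous m := continuous_quot_mk
  have hms : m.Surjective := Quotient.mk_surjective
  have hmeq : ∀ x y, m x = m y ↔ r x y := fun x y => ⟨fun h => Quotient.exact h, fun h => Quotient.sound h⟩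
  have hfib : ∀ x, m ⁻¹' {m x} = {y | r x y} := quot_fiber hr
  obtain ⟨v⟩ : Nonempty SS := (jan_SS.nontriv).to_nonempty
  obtain ⟨u, hu⟩ := (hcompl v).nonempty
  have hmuv : m u ≠ m v := fun h => hu ((hmeq v u).1 h.symm)
  have jQ : Jan (QQ hr) := by
    refine jan_of_map m hm hms (fun y => ?_) (fun y => ?_) ⟨m u, m v, hmuv⟩
    · obtain ⟨x, rfl⟩ := hms y
      rw [hfib]; exact (hconn x).isPreconnected
    · obtain ⟨x, rfl⟩ := hms y
      rw [hfib]; exact (hcompl x).isPreconnected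
  have jS := jan_SS
  obtain ⟨Q⟩ := jan_homeo (QQ hr) SS
  have huv : u ≠ v := fun h => hmuv (h ▸ rfl)
  obtain ⟨e1, a1, a2⟩ := exists_chart2 huv
  obtain ⟨e2, b1, b2⟩ := exists_chart2 (u := Q (m u)) (v := Q (m v)) (fun h => hmuv (Q.injective h))
  let f : OnePoint ℂ → OnePoint ℂ := fun x => e2.symm (Q (m (e1 x)))
  have hf : Continuous f := e2.symm.continuous.comp (Q.continuous.comp (hm.comp e1.continuous))
  have hs : f.Surjective := e2.symm.surjective.comp (Q.surjective.comp (hms.comp e1.surjective))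
  have hff : ∀ y, IsPreconnected (f ⁻¹' {y}) := by
    intro y
    obtain ⟨x, rfl⟩ := hs y
    have : f ⁻¹' {f x} = e1.symm '' {y | r (e1 x) y} := by
      rw [e1.symm.image_eq_preimage_symm, ← hfib]
      ext z
      simp [f]
    rw [this]
    exact (hconn _).isPreconnected.image _ e1.symm.continuous.continuousOn
  obtain ⟨e, he⟩ := exists_homotopic hf hs hff (by show e2.symm (Q (m (e1 _))) = _; rw [a1, ← b1]; simp) (by show e2.symm (Q (m (e1 _))) = _; rw [a2, ← b2]; simp)
  let g : C(OnePoint ℂ, OnePoint ℂ) := ⟨fun x => e (f x), e.continuous.comp hf⟩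
  let E : C(OnePoint ℂ, SS) := ⟨e1, e1.continuous⟩
  let E' : C(SS, OnePoint ℂ) := ⟨e1.symm, e1.symm.continuous⟩
  let φ : C(SS, SS) := E.comp (g.comp E')
  have hφ : ∀ x, φ x = e1 (e (e2.symm (Q (m x)))) := by
    intro x
    show e1 (e (e2.symm (Q (m (e1 (e1.symm x)))))) = _
    rw [e1.apply_symm_apply]
  have hφf : ∀ x, φ ⁻¹' {φ x} = {y | r x y} := by
    intro x
    rw [← hfib]
    ext y
    simp [hφ]
  have hφs : Function.Surjective φ := by
    intro y
    obtain ⟨x, hx⟩ := hms (Q.symm (e2 (e.symm (e1.symm y))))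
    exact ⟨x, by rw [hφ, hx]; simp⟩
  refine ⟨φ, ?_, ?_, ?_, ⟨Q⟩⟩
  · have h1 : φ.Homotopic (E.comp ((ContinuousMap.id _).comp E')) :=
      ContinuousMap.Homotopic.comp (ContinuousMap.Homotopic.refl E) (ContinuousMap.Homotopic.comp he (ContinuousMap.Homotopic.refl E'))
    have h2 : E.comp ((ContinuousMap.id _).comp E') = ContinuousMap.id SS := by
      ext1 x
      exact e1.apply_symm_apply x
    rwa [h2] at h1
  · intro p
    obtain ⟨x, rfl⟩ := hφs p
    exact ⟨x, hφf x⟩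
  · intro x
    exact ⟨φ x, (hφf x).symm⟩

end MooreSphere

/-- Moore's theorem for the sphere: if `r` is a closed (upper semi-continuous)
equivalence relation on `S²` all of whose classes are compact, connected and have nonempty
connected complement, then there is a continuous map `φ : S² → S²`, homotopic to the identity,
whose fibers are exactly the equivalence classes of `r`; in particular `S²/r ≃ₜ S²`. -/
theorem moore_theorem_sphere (r : ↥S2 → ↥S2 → Prop) (hr : Equivalence r)
    (hcompact : ∀ x : ↥S2, IsCompact {y : ↥S2 | r x y})
    (hconn : ∀ x : ↥S2, IsConnected {y : ↥S2 | r x y})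
    (hcompl : ∀ x : ↥S2, IsConnected ({y : ↥S2 | r x y}ᶜ))
    (hclosed : IsClosed {p : ↥S2 × ↥S2 | r p.1 p.2}) :
    ∃ φ : C(↥S2, ↥S2),
      ContinuousMap.Homotopic φ (ContinuousMap.id ↥S2) ∧
      (∀ p : ↥S2, ∃ x : ↥S2, φ ⁻¹' {p} = {y : ↥S2 | r x y}) ∧
      (∀ x : ↥S2, ∃ p : ↥S2, {y : ↥S2 | r x y} = φ ⁻¹' {p}) ∧
      Nonempty (Quotient (⟨r, hr⟩ : Setoid ↥S2) ≃ₜ ↥S2) := by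
  exact MooreSphere.moore_main r hr hconn hcompl hclosed
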